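/- For every k ∈ ℕ there exists a simplicially metrized game space (X,d) whose underlying topological space is homeomorphic to a closed orientable surface (a compact connected orientable 2-manifold without boundary) and whose cop number satisfies c(X) > k. -/

import Mathlib

/-!
Game of Cops and Robber on metric spaces, following Mohar, formalized relative to an
explicit distance function `d : Y → Y → ℝ`.
-/

open Set Filter Topology

/-- The length of (the restriction to `[0,1]` of) a map `p : ℝ → Y` with respect to an
extended-real-valued cost function `c`, defined as the supremum over all finite monotone
partitions of `[0,1]` of the sums of the costs of consecutive points. -/
noncomputable def elen {Y : Type*} (c : Y → Y → ENNReal) (p : ℝ → Y) : ENNReal :=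
  ⨆ q : ℕ × {u : ℕ → ℝ // Monotone u ∧ ∀ i, u i ∈ Set.Icc (0 : ℝ) 1},
    ∑ i ∈ Finset.range q.1, c (p (q.2.1 i)) (p (q.2.1 (i + 1)))

/-- Continuity on `[0,1]` of a map `p : ℝ → Y` with respect to a cost function `c`,
stated in `ε`-`δ` form. -/
def econt {Y : Type*} (c : Y → Y → ENNReal) (p : ℝ → Y) : Prop :=
  ∀ t ∈ Set.Icc (0 : ℝ) 1, ∀ ε : ENNReal, 0 < ε →
    ∃ δ : ℝ, 0 < δ ∧ ∀ t' ∈ Set.Icc (0 : ℝ) 1, |t' - t| < δ → c (p t) (p t') < ε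

/-- `d` is a metric on `Y`. -/
def IsMetricD (Y : Type*) (d : Y → Y → ℝ) : Prop :=
  (∀ x, d x x = 0) ∧ (∀ x y, d x y = 0 → x = y) ∧
    (∀ x y, d x y = d y x) ∧ (∀ x y z, d x z ≤ d x y + d y z)

/-- Compactness of the metric space `(Y,d)`, in its sequential form: every sequence has a
convergent subsequence. -/
def CompactD (Y : Type*) (d : Y → Y → ℝ) : Prop :=
  ∀ u : ℕ → Y, ∃ (x : Y) (φ : ℕ → ℕ), StrictMono φ ∧
    Filter.Tendsto (fun n => d (u (φ n)) x) Filter.atTop (nhds 0)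

/-- `(Y,d)` is a geodesic metric space: any two points `x, y` are joined by a continuous
path `p : [0,1] → Y` whose length equals `d x y`. -/
def IsGeodesicD (Y : Type*) (d : Y → Y → ℝ) : Prop :=
  ∀ x y : Y, ∃ p : ℝ → Y,
    econt (fun a b => ENNReal.ofReal (d a b)) p ∧ p 0 = x ∧ p 1 = y ∧
      elen (fun a b => ENNReal.ofReal (d a b)) p = ENNReal.ofReal (d x y)

/-- A game space is a (nonempty) compact geodesic metric space. -/
def GameSpaceD (Y : Type*) (d : Y → Y → ℝ) : Prop :=
  Nonempty Y ∧ IsMetricD Y d ∧ CompactD Y d ∧ IsGeodesicD Y d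

/-- An agility function: positive, with divergent sum. -/
def IsAgility (τ : ℕ → ℝ) : Prop := (∀ n, 0 < τ n) ∧ ¬ Summable τ

/-- The trajectory of the `k` cops determined by initial positions `c0`, a cop strategy `σ`
(where `σ n` computes the cops' positions at step `n+1` from the robber's positions
`r^0, …, r^(n+1)`), and a robber trajectory `r`. -/
def copTraj {Y : Type*} {k : ℕ} (c0 : Fin k → Y)
    (σ : (n : ℕ) → (Fin (n + 2) → Y) → Fin k → Y) (r : ℕ → Y) : ℕ → Fin k → Y
  | 0 => c0
  | n + 1 => σ n fun i => r i

/-- The trajectory of the robber determined by his initial position `r0`, a robber strategy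
`ρ` (where `ρ n` computes the robber's position at step `n+1` from the cops' positions
`c^0, …, c^n`), and a cop trajectory `c`. -/
def robTraj {Y : Type*} {k : ℕ} (r0 : Y)
    (ρ : (n : ℕ) → (Fin (n + 1) → Fin k → Y) → Y) (c : ℕ → Fin k → Y) : ℕ → Y
  | 0 => r0
  | n + 1 => ρ n fun i => c i

/-- `k` cops have a winning strategy on `(Y,d)`: for every agility function and every initial
position chosen by the robber there is a cop strategy `σ`, assigning legal cop moves to every
history, such that against every legal robber trajectory the cops come arbitrarily close to
the robber. -/
def CopsWinWith (Y : Type*) (d : Y → Y → ℝ) (k : ℕ) : Prop :=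
  ∀ τ : ℕ → ℝ, IsAgility τ → ∀ r0 : Y, ∀ c0 : Fin k → Y,
    ∃ σ : (n : ℕ) → (Fin (n + 2) → Y) → Fin k → Y,
      ∀ r : ℕ → Y, r 0 = r0 → (∀ n, d (r n) (r (n + 1)) ≤ τ (n + 1)) →
        (∀ n i, d (copTraj c0 σ r n i) (copTraj c0 σ r (n + 1) i) ≤ τ (n + 1)) ∧
          (∀ ε : ℝ, 0 < ε → ∃ n i, d (r n) (copTraj c0 σ r n i) < ε)

/-- The cop number of `(Y,d)`, as an extended natural number: the least `k` such that `k`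
cops have a winning strategy (`⊤` if there is no such `k`). -/
noncomputable def copNumber (Y : Type*) (d : Y → Y → ℝ) : ℕ∞ :=
  sInf {m : ℕ∞ | ∃ k : ℕ, m = (k : ℕ∞) ∧ CopsWinWith Y d k}

/-- The robber has a strategy against `k` cops on `(Y,d)` with agility function `τ` which
guarantees that his moves are legal and that every cop always stays at distance `> ε` from
him, against every legal cop play. -/
def RobberWins (Y : Type*) (d : Y → Y → ℝ) (k : ℕ) (τ : ℕ → ℝ) (ε : ℝ) : Prop :=
  ∃ (r0 : Y) (c0 : Fin k → Y) (ρ : (n : ℕ) → (Fin (n + 1) → Fin k → Y) → Y),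
    ∀ c : ℕ → Fin k → Y, c 0 = c0 → (∀ n i, d (c n i) (c (n + 1) i) ≤ τ (n + 1)) →
      (∀ n, d (robTraj r0 ρ c n) (robTraj r0 ρ c (n + 1)) ≤ τ (n + 1)) ∧
        (∀ n i, ε < d (robTraj r0 ρ c n) (c n i))

/-!
Simplicially metrized spaces: metric spaces isometric to the underlying space `|K|` of a
finite geometric simplicial complex all of whose simplices are regular with edge length 1
(equivalently, all pairwise distances between the vertices of a simplex equal 1), equipped
with the intrinsic length metric induced by the Euclidean metric.
-/

/-- The intrinsic (extended-real-valued) distance between two points of a subset `A` of a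
metric space: the infimum of the lengths of continuous paths joining them within `A`. -/
noncomputable def intrinsicDistE {E : Type*} [MetricSpace E] (A : Set E) (a b : ↥A) :
    ENNReal :=
  ⨅ p : {p : ℝ → ↥A // ContinuousOn p (Set.Icc (0:ℝ) 1) ∧ p 0 = a ∧ p 1 = b},
    eVariationOn (fun t => ((p.1 t : E))) (Set.Icc (0:ℝ) 1)

/-- A metric space `(X, dist)` is simplicially metrized if it is isometric to the underlying
space `|K|` of a finite geometric simplicial complex `K` in some Euclidean space, all of
whose simplices are regular with edge length `1`, equipped with the intrinsic length metric
induced by the Euclidean metric. -/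
def SimpliciallyMetrized (X : Type*) [MetricSpace X] : Prop :=
  ∃ (N : ℕ) (K : Geometry.SimplicialComplex ℝ (EuclideanSpace ℝ (Fin N))),
    K.faces.Finite ∧
    (∀ f ∈ K.faces, ∀ x ∈ f, ∀ y ∈ f, x ≠ y → dist x y = 1) ∧
    ∃ e : X ≃ ↥(K.space),
      ∀ x y : X, ENNReal.ofReal (dist x y) = intrinsicDistE K.space (e x) (e y)

/-- `Y` is (homeomorphic to) a closed orientable surface, i.e. a compact connected
orientable 2-manifold without boundary. We use the classical characterization that a closed
surface is orientable if and only if it embeds topologically in `ℝ³`: `Y` is homeomorphic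
to a compact connected subset `M` of `ℝ³` each of whose points has an open neighbourhood in
`M` homeomorphic to `ℝ²`. -/
def IsClosedOrientableSurface (Y : Type*) [TopologicalSpace Y] : Prop :=
  ∃ M : Set (EuclideanSpace ℝ (Fin 3)), IsCompact M ∧ IsConnected M ∧
    (∀ x : M, ∃ U : Set M, IsOpen U ∧ x ∈ U ∧
      Nonempty (↥U ≃ₜ EuclideanSpace ℝ (Fin 2))) ∧
    Nonempty (Y ≃ₜ ↥M)

/-- A compact metric space in which points can be approximately interpolated along distances
has a Lipschitz geodesic between any two points. -/
theorem exists_lipschitz_geodesic {X : Type*} [MetricSpace X] [CompactSpace X]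
    (h : ∀ x y : X, ∀ ε > 0, ∀ s, 0 ≤ s → s ≤ dist x y →
      ∃ z, dist x z = s ∧ dist z y ≤ dist x y - s + ε) (x y : X) :
    ∃ p : ℝ → X, p 0 = x ∧ p 1 = y ∧
      ∀ s ∈ Icc (0 : ℝ) 1, ∀ t ∈ Icc (0 : ℝ) 1, dist (p s) (p t) ≤ |s - t| * dist x y := by
  have between : ∀ x y : X, ∀ a b : ℝ, 0 ≤ a → 0 ≤ b → dist x y ≤ a + b →
      ∃ z, dist x z ≤ a ∧ dist z y ≤ b := by
    intro x y a b ha hb hab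
    rcases le_total a (dist x y) with hs | hs
    · have hc : IsCompact {z : X | dist x z = a} :=
        (isClosed_eq (by fun_prop) continuous_const).isCompact
      obtain ⟨z0, hz0, -⟩ := h x y 1 one_pos a ha hs
      obtain ⟨z, hz, hmin⟩ := hc.exists_isMinOn ⟨z0, hz0⟩
        (f := fun z => dist z y) (by fun_prop)
      refine ⟨z, hz.le, le_of_forall_pos_le_add fun ε hε => ?_⟩
      obtain ⟨w, hw, hwy⟩ := h x y ε hε a ha hs
      have := isMinOn_iff.1 hmin w hw
      linarith
    · exact ⟨y, hs, by simpa using hb⟩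
  set D := dist x y with hD
  have hD0 : 0 ≤ D := dist_nonneg
  have fin : ∀ S : Finset ℝ, (∀ s ∈ S, s ∈ Icc (0 : ℝ) 1) → ∃ p : ℝ → X, p 0 = x ∧
      (∀ s ∈ insert 0 S, ∀ t ∈ insert 0 S, dist (p s) (p t) ≤ |s - t| * D) ∧
      ∀ s ∈ insert 0 S, dist (p s) y ≤ (1 - s) * D := by
    intro S
    induction S using Finset.induction_on_max with
    | empty => exact fun _ => ⟨fun _ => x, rfl, by simp, by simp [hD]⟩
    | insert m S hm ih =>
      intro hS
      obtain ⟨p, h0, h1, h2⟩ := ih fun s hs => hS s (Finset.mem_insert_of_mem hs)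
      have hm1 := hS m (Finset.mem_insert_self _ _)
      rcases hm1.1.eq_or_lt with rfl | hpos
      · exact ⟨p, h0, by simpa using h1, by simpa using h2⟩
      have hne : (insert 0 S).Nonempty := ⟨0, Finset.mem_insert_self _ _⟩
      set s0 := (insert 0 S).max' hne with hs0
      have hs0mem : s0 ∈ insert 0 S := Finset.max'_mem _ _
      have hle : ∀ s ∈ insert 0 S, s ≤ s0 := fun s hs => Finset.le_max' _ _ hs
      have hlt : ∀ s ∈ insert 0 S, s < m := by
        intro s hs
        rcases Finset.mem_insert.1 hs with rfl | hs
        exacts [hpos, hm s hs]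
      obtain ⟨z, hz1, hz2⟩ := between (p s0) y ((m - s0) * D) ((1 - m) * D)
        (mul_nonneg (by linarith [hlt s0 hs0mem]) hD0) (mul_nonneg (by linarith [hm1.2]) hD0)
        (by linarith [h2 s0 hs0mem])
      have key : ∀ s ∈ insert 0 S, dist (p s) z ≤ (m - s) * D := by
        intro s hs
        have := h1 s hs s0 hs0mem
        rw [abs_of_nonpos (by linarith [hle s hs])] at this
        linarith [dist_triangle (p s) (p s0) z]
      have hup : ∀ s ∈ insert 0 S, Function.update p m z s = p s := fun s hs =>
        Function.update_of_ne (hlt s hs).ne _ _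
      refine ⟨Function.update p m z, ?_, ?_, ?_⟩
      · rw [Function.update_of_ne hpos.ne, h0]
      · intro s hs t ht
        rw [Finset.insert_comm, Finset.mem_insert] at hs ht
        rcases hs with rfl | hs <;> rcases ht with rfl | ht
        · simp
        · rw [hup t ht, Function.update_self, dist_comm,
            abs_of_nonneg (by linarith [hlt t ht])]
          exact key t ht
        · rw [hup s hs, Function.update_self, abs_sub_comm,
            abs_of_nonneg (by linarith [hlt s hs])]
          exact key s hs
        · rw [hup s hs, hup t ht]; exact h1 s hs t ht
      · intro s hs
        rw [Finset.insert_comm, Finset.mem_insert] at hs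
        rcases hs with rfl | hs
        · rwa [Function.update_self]
        · rw [hup s hs]; exact h2 s hs
  let C : Icc (0 : ℝ) 1 × Icc (0 : ℝ) 1 → Set (ℝ → X) := fun q =>
    {p | p 0 = x ∧ p 1 = y ∧ dist (p q.1) (p q.2) ≤ |(q.1 : ℝ) - q.2| * D}
  have hclosed : ∀ q, IsClosed (C q) := fun q =>
    (isClosed_eq (continuous_apply _) continuous_const).inter
      ((isClosed_eq (continuous_apply _) continuous_const).inter
        (isClosed_le ((continuous_apply _).dist (continuous_apply _)) continuous_const))
  have hne : (⋂ q, C q).Nonempty := by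
    rw [nonempty_iff_ne_empty]
    intro hempty
    obtain ⟨u, hu⟩ := isCompact_univ.elim_finite_subfamily_closed
      C hclosed (by simpa using hempty)
    obtain ⟨p, h0, h1, h2⟩ := fin
      (insert 1 (u.image (fun q => (q.1 : ℝ)) ∪ u.image (fun q => (q.2 : ℝ)))) (by
        intro s hs
        simp only [Finset.mem_insert, Finset.mem_union, Finset.mem_image] at hs
        rcases hs with rfl | ⟨q, -, rfl⟩ | ⟨q, -, rfl⟩
        exacts [⟨zero_le_one, le_rfl⟩, q.1.2, q.2.2])
    have : p ∈ ⋂ i ∈ u, C i := by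
      simp only [mem_iInter]
      intro q hq
      refine ⟨h0, ?_, h1 _ ?_ _ ?_⟩
      · have := h2 1 (by simp)
        simpa using this
      · refine Finset.mem_insert_of_mem (Finset.mem_insert_of_mem (Finset.mem_union_left _ ?_))
        exact Finset.mem_image_of_mem (fun q : Icc (0 : ℝ) 1 × Icc (0 : ℝ) 1 => (q.1 : ℝ)) hq
      · refine Finset.mem_insert_of_mem (Finset.mem_insert_of_mem (Finset.mem_union_right _ ?_))
        exact Finset.mem_image_of_mem (fun q : Icc (0 : ℝ) 1 × Icc (0 : ℝ) 1 => (q.2 : ℝ)) hq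
    exact (hu.subset ⟨mem_univ _, this⟩).elim
  obtain ⟨p, hp⟩ := hne
  rw [mem_iInter] at hp
  have h00 := hp (⟨0, by simp⟩, ⟨0, by simp⟩)
  exact ⟨p, h00.1, h00.2.1, fun s hs t ht => (hp (⟨s, hs⟩, ⟨t, ht⟩)).2.2⟩

/-- A compact metric space with Lipschitz geodesics is a game space. -/
theorem gameSpaceD_of_lipschitz_geodesic {X : Type*} [MetricSpace X] [CompactSpace X]
    [Nonempty X]
    (h : ∀ x y : X, ∃ p : ℝ → X, p 0 = x ∧ p 1 = y ∧
      ∀ s ∈ Icc (0 : ℝ) 1, ∀ t ∈ Icc (0 : ℝ) 1, dist (p s) (p t) ≤ |s - t| * dist x y) :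
    GameSpaceD X (fun x y => dist x y) := by
  refine ⟨inferInstance, ⟨dist_self, fun x y => eq_of_dist_eq_zero, dist_comm, dist_triangle⟩,
    ?_, ?_⟩
  · intro u
    obtain ⟨x, -, φ, hφ, hx⟩ := isCompact_univ.tendsto_subseq (x := u) (fun n => mem_univ _)
    exact ⟨x, φ, hφ, tendsto_iff_dist_tendsto_zero.1 hx⟩
  · intro x y
    obtain ⟨p, h0, h1, hp⟩ := h x y
    refine ⟨p, ?_, h0, h1, le_antisymm ?_ ?_⟩
    · intro t ht ε hε
      have hc : ContinuousOn p (Icc 0 1) := by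
        refine (LipschitzOnWith.of_dist_le_mul (K := ⟨dist x y, dist_nonneg⟩) ?_).continuousOn
        intro s hs t ht
        rw [mul_comm, Real.dist_eq]
        exact hp s hs t ht
      have := hc t ht
      have := EMetric.tendsto_nhdsWithin_nhds.1 this ε hε
      obtain ⟨δ, hδ, H⟩ := this
      refine ⟨(min δ 1).toReal, ENNReal.toReal_pos (lt_min hδ one_pos).ne'
        (ne_top_of_le_ne_top ENNReal.one_ne_top (min_le_right _ _)), ?_⟩
      intro t' ht' hlt
      simp only []
      rw [← edist_dist, edist_comm]
      refine H ht' ?_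
      rw [edist_dist, Real.dist_eq]
      refine lt_of_lt_of_le ((ENNReal.ofReal_lt_iff_lt_toReal (abs_nonneg _)
        (ne_top_of_le_ne_top ENNReal.one_ne_top (min_le_right _ _))).2 hlt) (min_le_left _ _)
    · refine iSup_le fun ⟨n, u, hu, hI⟩ => ?_
      calc ∑ i ∈ Finset.range n, ENNReal.ofReal (dist (p (u i)) (p (u (i + 1))))
          ≤ ∑ i ∈ Finset.range n, ENNReal.ofReal ((u (i + 1) - u i) * dist x y) := by
            refine Finset.sum_le_sum fun i _ => ENNReal.ofReal_le_ofReal ?_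
            have := hp _ (hI i) _ (hI (i + 1))
            rwa [abs_sub_comm, abs_of_nonneg (sub_nonneg.2 (hu (Nat.le_succ i)))] at this
        _ = ENNReal.ofReal (∑ i ∈ Finset.range n, (u (i + 1) - u i) * dist x y) :=
            (ENNReal.ofReal_sum_of_nonneg fun i _ => mul_nonneg
              (sub_nonneg.2 (hu (Nat.le_succ i))) dist_nonneg).symm
        _ ≤ ENNReal.ofReal (dist x y) := by
            refine ENNReal.ofReal_le_ofReal ?_
            rw [← Finset.sum_mul, Finset.sum_range_sub]
            have h1 := (hI n).2
            have h2 := (hI 0).1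
            nlinarith [dist_nonneg (x := x) (y := y)]
    · let u : ℕ → ℝ := fun i => if i = 0 then 0 else 1
      have hu : Monotone u := by
        intro i j hij
        by_cases hi : i = 0
        · by_cases hj : j = 0 <;> simp [u, hi, hj]
        · have hj : j ≠ 0 := by omega
          simp [u, hi, hj]
      have hI : ∀ i, u i ∈ Icc (0 : ℝ) 1 := by
        intro i; by_cases hi : i = 0 <;> simp [u, hi]
      refine le_iSup_of_le (⟨1, u, hu, hI⟩ : ℕ × {u : ℕ → ℝ // Monotone u ∧ ∀ i, u i ∈ Icc (0 : ℝ) 1}) ?_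
      simp [u, h0, h1]

/-- A function on a space with Lipschitz geodesics which is pointwise `C`-Lipschitz is
`C`-Lipschitz. -/
theorem abs_sub_le_of_pointwise_lipschitz {X : Type*} [MetricSpace X]
    (h : ∀ x y : X, ∃ p : ℝ → X, p 0 = x ∧ p 1 = y ∧
      ∀ s ∈ Icc (0 : ℝ) 1, ∀ t ∈ Icc (0 : ℝ) 1, dist (p s) (p t) ≤ |s - t| * dist x y)
    {f : X → ℝ} {C : ℝ} (hC : 0 ≤ C)
    (hf : ∀ x, ∀ᶠ y in 𝓝 x, |f y - f x| ≤ C * dist x y) (x y : X) :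
    f y - f x ≤ C * dist x y := by
  obtain ⟨p, h0, h1, hp⟩ := h x y
  have hfc : Continuous f := by
    refine continuous_iff_continuousAt.2 fun x => ?_
    rw [ContinuousAt, tendsto_iff_dist_tendsto_zero]
    refine squeeze_zero' (Eventually.of_forall fun _ => dist_nonneg) (hf x) ?_
    have : Continuous fun y => C * dist x y := by fun_prop
    simpa using this.tendsto x
  have hpc : ContinuousOn p (Icc 0 1) := by
    refine (LipschitzOnWith.of_dist_le_mul (K := ⟨dist x y, dist_nonneg⟩) ?_).continuousOn
    intro s hs t ht
    rw [mul_comm, Real.dist_eq]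
    exact hp s hs t ht
  have key := image_le_of_liminf_slope_right_le_deriv_boundary (f := fun t => f (p t))
    (a := 0) (b := 1) (hfc.comp_continuousOn hpc)
    (B := fun t => f x + t * (C * dist x y)) (B' := fun _ => C * dist x y) (by simp [h0])
    (by fun_prop) (fun t _ => by
      simpa using (((hasDerivAt_id t).mul_const (C * dist x y)).const_add (f x)).hasDerivWithinAt)
    (fun t ht r hr => by
      have hmem : Icc (0 : ℝ) 1 ∈ 𝓝[>] t := Icc_mem_nhdsGT_of_mem ht
      have htend : Tendsto p (𝓝[>] t) (𝓝 (p t)) :=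
        ((hpc t (Ico_subset_Icc_self ht)).mono_of_mem_nhdsWithin hmem)
      have hev := htend.eventually (hf (p t))
      refine Eventually.frequently ?_
      filter_upwards [hev, hmem, self_mem_nhdsWithin] with z hz hz1 hzt
      rw [slope_def_field]
      have hzt' : 0 < z - t := sub_pos.2 hzt
      refine lt_of_le_of_lt ?_ hr
      rw [div_le_iff₀ hzt']
      have := hp t (Ico_subset_Icc_self ht) z hz1
      rw [abs_sub_comm, abs_of_pos hzt'] at this
      calc _ ≤ C * dist (p t) (p z) := (le_abs_self _).trans hz
        _ ≤ C * ((z - t) * dist x y) := by gcongr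
        _ = _ := by ring)
  have := key (show (1 : ℝ) ∈ Icc (0 : ℝ) 1 by simp)
  simp only [h1, one_mul] at this
  linarith

section Intrinsic

variable {E : Type*} [MetricSpace E] {A : Set E}

theorem intrinsicDistE_le_of_path {p : ℝ → A} {a b : ℝ} (hab : a ≤ b)
    (hp : ContinuousOn p (Icc a b)) :
    intrinsicDistE A (p a) (p b) ≤ eVariationOn (fun t => (p t : E)) (Icc a b) := by
  have hmaps : MapsTo (fun t : ℝ => a + t * (b - a)) (Icc 0 1) (Icc a b) := by
    intro t ht
    have h1 := ht.1
    have h2 := ht.2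
    constructor <;> nlinarith
  have hc : ContinuousOn (fun t => p (a + t * (b - a))) (Icc 0 1) :=
    hp.comp (by fun_prop) hmaps
  refine (iInf_le _ ⟨fun t => p (a + t * (b - a)), hc, by simp, by simp⟩).trans ?_
  · refine eVariationOn.comp_le_of_monotoneOn (fun t => (p t : E))
      (fun t : ℝ => a + t * (b - a)) ?_ hmaps
    intro s _ t _ hst
    have : 0 ≤ b - a := sub_nonneg.2 hab
    simp only
    nlinarith

theorem intrinsicDistE_self (x : A) : intrinsicDistE A x x = 0 := by
  refine le_antisymm ?_ zero_le
  refine (iInf_le _ ⟨fun _ => x, continuousOn_const, rfl, rfl⟩).trans ?_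
  refine (eVariationOn.constant_on ?_).le
  rintro _ ⟨_, _, rfl⟩ _ ⟨_, _, rfl⟩
  rfl

theorem intrinsicDistE_comm (x y : A) : intrinsicDistE A x y = intrinsicDistE A y x := by
  suffices ∀ x y : A, intrinsicDistE A x y ≤ intrinsicDistE A y x from
    le_antisymm (this x y) (this y x)
  intro x y
  refine le_iInf fun ⟨p, hp, h0, h1⟩ => ?_
  have hmaps : MapsTo (fun t : ℝ => 1 - t) (Icc 0 1) (Icc 0 1) := fun t ht =>
    ⟨by linarith [ht.2], by linarith [ht.1]⟩
  refine (iInf_le _ ⟨fun t => p (1 - t), hp.comp (by fun_prop) hmaps, by simp [h1],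
    by simp [h0]⟩).trans ?_
  exact eVariationOn.comp_le_of_antitoneOn (fun t => (p t : E))
    (fun t : ℝ => 1 - t) (fun s _ t _ hst => sub_le_sub_left hst 1) hmaps

theorem intrinsicDistE_triangle (x y z : A) :
    intrinsicDistE A x z ≤ intrinsicDistE A x y + intrinsicDistE A y z := by
  refine ENNReal.le_iInf_add_iInf fun ⟨p, hp, p0, p1⟩ ⟨q, hq, q0, q1⟩ => ?_
  let r : ℝ → A := fun t => if t ≤ 1 then p t else q (t - 1)
  have hrp : EqOn r p (Icc 0 1) := fun t ht => if_pos ht.2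
  have hrq : EqOn r (fun t => q (t - 1)) (Icc 1 2) := by
    intro t ht
    rcases ht.1.eq_or_lt with rfl | h
    · simp [r, p1, q0]
    · exact if_neg (not_le.2 h)
  have hmaps : MapsTo (fun t : ℝ => t - 1) (Icc 1 2) (Icc 0 1) := fun t ht =>
    ⟨by linarith [ht.1], by linarith [ht.2]⟩
  have hr : ContinuousOn r (Icc 0 2) := by
    rw [← Icc_union_Icc_eq_Icc (zero_le_one' ℝ) one_le_two]
    exact (hp.congr hrp).union_of_isClosed ((hq.comp (by fun_prop) hmaps).congr hrq)
      isClosed_Icc isClosed_Icc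
  have h := intrinsicDistE_le_of_path (zero_le_two (α := ℝ)) hr
  have r0 : r 0 = x := by simp [r, p0]
  have r2 : r 2 = z := by
    have := hrq (show (2 : ℝ) ∈ Icc 1 2 by simp)
    rw [this]; norm_num [q1]
  rw [r0, r2] at h
  refine h.trans ?_
  have hadd := eVariationOn.Icc_add_Icc (fun t => (r t : E)) (s := univ) (zero_le_one' ℝ)
    one_le_two (mem_univ _)
  simp only [univ_inter] at hadd
  rw [← hadd]
  refine add_le_add (eVariationOn.eq_of_eqOn fun t ht => by simp only [hrp ht]).le ?_
  rw [eVariationOn.eq_of_eqOn (f' := (fun t => (q t : E)) ∘ fun t => t - 1)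
    (fun t ht => by simp only [hrq ht]; rfl)]
  exact eVariationOn.comp_le_of_monotoneOn _ _ (fun s _ t _ hst => by simpa using hst) hmaps

theorem edist_le_intrinsicDistE (x y : A) : edist (x : E) y ≤ intrinsicDistE A x y := by
  refine le_iInf fun ⟨p, hp, h0, h1⟩ => ?_
  have := eVariationOn.edist_le (fun t => (p t : E)) (s := Icc (0 : ℝ) 1) (x := 0) (y := 1)
    (by simp) (by simp)
  simpa [h0, h1] using this

end Intrinsic

theorem intrinsicDistE_eq_of_segment {E : Type*} [NormedAddCommGroup E] [NormedSpace ℝ E]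
    {A : Set E} {x y : A} (h : segment ℝ (x : E) y ⊆ A) :
    intrinsicDistE A x y = edist (x : E) y := by
  refine le_antisymm ?_ (edist_le_intrinsicDistE x y)
  have hmem : ∀ t : ℝ, AffineMap.lineMap (x : E) (y : E) (projIcc 0 1 zero_le_one t : ℝ) ∈ A :=
    fun t => h (by
      rw [segment_eq_image_lineMap]
      exact mem_image_of_mem _ (projIcc 0 1 zero_le_one t).2)
  have hcont : Continuous fun t => (⟨_, hmem t⟩ : A) :=
    (AffineMap.lineMap_continuous.comp
      (continuous_subtype_val.comp continuous_projIcc)).subtype_mk _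
  refine (iInf_le _ ⟨fun t => ⟨_, hmem t⟩, hcont.continuousOn, Subtype.ext (by simp),
    Subtype.ext (by simp)⟩).trans ?_
  · simp only
    have hL : LipschitzWith (nndist (x : E) y) (AffineMap.lineMap (k := ℝ) (x : E) (y : E)) :=
      lipschitzWith_lineMap _ _
    have := hL.lipschitzOnWith (s := univ) |>.comp_eVariationOn_le
      (g := fun t => (projIcc 0 1 zero_le_one t : ℝ)) (s := Icc (0 : ℝ) 1) (mapsTo_univ _ _)
    refine this.trans ?_
    have hm : MonotoneOn (fun t => (projIcc (0 : ℝ) 1 zero_le_one t : ℝ)) univ :=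
      fun s _ t _ hst => monotone_projIcc _ hst
    have h2 := hm.eVariationOn_eq (a := 0) (b := 1) (mem_univ _) (mem_univ _)
    rw [univ_inter] at h2
    rw [h2, edist_nndist]
    simp

/-- The intrinsic metric of a compact set that locally is star-shaped around each point. -/
theorem exists_intrinsic_metric {E : Type} [NormedAddCommGroup E] [NormedSpace ℝ E]
    {A : Set E} (hA : IsCompact A) (hne : A.Nonempty)
    (hloc : ∀ x ∈ A, ∃ r > 0, ∀ y ∈ A, dist x y < r → segment ℝ x y ⊆ A)
    (hfin : ∀ x y : A, intrinsicDistE A x y ≠ ⊤) :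
    ∃ (X : Type) (_ : MetricSpace X) (e : X ≃ₜ A),
      (∀ x y, ENNReal.ofReal (dist x y) = intrinsicDistE A (e x) (e y)) ∧
      GameSpaceD X (fun x y => dist x y) ∧
      ∀ x y : X, ∃ p : ℝ → X, p 0 = x ∧ p 1 = y ∧
        ∀ s ∈ Icc (0 : ℝ) 1, ∀ t ∈ Icc (0 : ℝ) 1, dist (p s) (p t) ≤ |s - t| * dist x y := by
  obtain ⟨X, mX, e, he⟩ : ∃ (X : Type) (_ : MetricSpace X) (e : X ≃ A), ∀ x y,
      ENNReal.ofReal (dist x y) = intrinsicDistE A (e x) (e y) := by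
    let m : MetricSpace A := {
      dist := fun x y => (intrinsicDistE A x y).toReal
      dist_self := fun x => by rw [intrinsicDistE_self]; rfl
      dist_comm := fun x y => by rw [intrinsicDistE_comm]
      dist_triangle := fun x y z => by
        rw [← ENNReal.toReal_add (hfin _ _) (hfin _ _)]
        exact ENNReal.toReal_mono (ENNReal.add_ne_top.2 ⟨hfin _ _, hfin _ _⟩)
          (intrinsicDistE_triangle x y z)
      eq_of_dist_eq_zero := fun {x y} h => by
        have h0 : intrinsicDistE A x y = 0 :=
          ((ENNReal.toReal_eq_zero_iff _).1 h).resolve_right (hfin _ _)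
        have := edist_le_intrinsicDistE x y
        rw [h0] at this
        exact Subtype.ext (edist_le_zero.1 this) }
    exact ⟨A, m, Equiv.refl _, fun x y => ENNReal.ofReal_toReal (hfin _ _)⟩
  have hle : ∀ x y : X, dist (e x : E) (e y) ≤ dist x y := by
    intro x y
    have := edist_le_intrinsicDistE (e x) (e y)
    rwa [← he, edist_dist, ENNReal.ofReal_le_ofReal_iff dist_nonneg] at this
  have heq : ∀ x y : X, segment ℝ (e x : E) (e y) ⊆ A → dist x y = dist (e x : E) (e y) := by
    intro x y h
    have := intrinsicDistE_eq_of_segment h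
    rwa [← he, edist_dist, ENNReal.ofReal_eq_ofReal_iff dist_nonneg dist_nonneg] at this
  have hc1 : Continuous e := by
    refine (LipschitzWith.of_dist_le_mul (K := 1) fun x y => ?_).continuous
    simpa [Subtype.dist_eq] using hle x y
  have hc2 : Continuous e.symm := by
    refine continuous_iff_continuousAt.2 fun a => ?_
    obtain ⟨r, hr, H⟩ := hloc a a.2
    rw [ContinuousAt, tendsto_iff_dist_tendsto_zero]
    have : Tendsto (fun b : A => dist (b : E) a) (𝓝 a) (𝓝 0) := by
      have : Continuous fun b : A => dist (b : E) a := by fun_prop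
      simpa using this.tendsto a
    refine this.congr' ?_
    filter_upwards [Metric.ball_mem_nhds a hr] with b hb
    rw [Metric.mem_ball, dist_comm] at hb
    have := heq (e.symm a) (e.symm b) (by simpa using H b b.2 hb)
    simp only [Equiv.apply_symm_apply] at this
    rw [dist_comm (e.symm b), this, dist_comm]
  let h : X ≃ₜ A := ⟨e, hc1, hc2⟩
  have : CompactSpace A := isCompact_iff_compactSpace.1 hA
  have : CompactSpace X := h.symm.compactSpace
  have : Nonempty X := ⟨e.symm ⟨_, hne.some_mem⟩⟩
  have hgeo : ∀ x y : X, ∃ p : ℝ → X, p 0 = x ∧ p 1 = y ∧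
        ∀ s ∈ Icc (0 : ℝ) 1, ∀ t ∈ Icc (0 : ℝ) 1, dist (p s) (p t) ≤ |s - t| * dist x y := by
    refine exists_lipschitz_geodesic fun x y ε hε s hs0 hs => ?_
    have hlt : intrinsicDistE A (e x) (e y) < ENNReal.ofReal (dist x y + ε) := by
      rw [← he]
      exact (ENNReal.ofReal_lt_ofReal_iff (by positivity)).2 (by linarith)
    obtain ⟨⟨p, hp, h0, h1⟩, hL⟩ := iInf_lt_iff.1 hlt
    have hcont : ContinuousOn (fun t => dist x (e.symm (p t))) (Icc 0 1) :=
      (continuous_const.dist (continuous_id.comp hc2)).comp_continuousOn hp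
    obtain ⟨t, ht, hts⟩ := intermediate_value_Icc zero_le_one hcont
      (show s ∈ Icc _ _ by simpa [h0, h1] using ⟨hs0, hs⟩)
    refine ⟨e.symm (p t), hts, ?_⟩
    have e1 := intrinsicDistE_le_of_path ht.1 (hp.mono (Icc_subset_Icc_right ht.2))
    have e2 := intrinsicDistE_le_of_path ht.2 (hp.mono (Icc_subset_Icc_left ht.1))
    have hadd := eVariationOn.Icc_add_Icc (fun t => (p t : E)) (s := univ) ht.1 ht.2 (mem_univ _)
    simp only [univ_inter] at hadd
    have := (add_le_add e1 e2).trans_lt (hadd.trans_lt hL)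
    have t1 := he x (e.symm (p t))
    have t2 := he (e.symm (p t)) y
    simp only [Equiv.apply_symm_apply] at t1 t2
    rw [h0, h1, ← t1, ← t2, ← ENNReal.ofReal_add dist_nonneg dist_nonneg,
      ENNReal.ofReal_lt_ofReal_iff (by positivity)] at this
    simp only at hts
    linarith
  exact ⟨X, mX, h, he, gameSpaceD_of_lipschitz_geodesic hgeo, hgeo⟩

theorem copTraj_congr {Y : Type*} {k : ℕ} (c0 : Fin k → Y)
    (σ : (n : ℕ) → (Fin (n + 2) → Y) → Fin k → Y) {r r' : ℕ → Y} {n : ℕ}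
    (h : ∀ m ≤ n, r m = r' m) : copTraj c0 σ r n = copTraj c0 σ r' n := by
  cases n with
  | zero => rfl
  | succ n =>
    simp only [copTraj]
    congr 1
    funext i
    exact h i (by omega)

/-- A robber responding to the current position of the cops produces a trajectory. -/
theorem exists_response_sequence {Y S : Type*} {k : ℕ} (c0 : Fin k → Y)
    (σ : (n : ℕ) → (Fin (n + 2) → Y) → Fin k → Y) (st : S → Y) (s0 : S)
    (next : S → (Fin k → Y) → S) :
    ∃ s : ℕ → S, s 0 = s0 ∧ ∀ n, s (n + 1) = next (s n) (copTraj c0 σ (fun m => st (s m)) n) := by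
  let hist : ℕ → ℕ → S := fun n => Nat.rec (fun _ => s0) (fun n g =>
    Function.update g (n + 1) (next (g n) (copTraj c0 σ (fun m => st (g m)) n))) n
  have hs : ∀ n, hist (n + 1) = Function.update (hist n) (n + 1)
    (next (hist n n) (copTraj c0 σ (fun m => st (hist n m)) n)) := fun n => rfl
  have key : ∀ n m, m ≤ n → hist n m = hist m m := by
    intro n
    induction n with
    | zero => intro m hm; rw [Nat.le_zero.1 hm]
    | succ n ih =>
      intro m hm
      rcases hm.eq_or_lt with rfl | hm
      · rfl
      · rw [hs, Function.update_of_ne hm.ne, ih m (by omega)]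
  refine ⟨fun n => hist n n, rfl, fun n => ?_⟩
  simp only
  rw [hs, Function.update_self]
  congr 1
  exact copTraj_congr c0 σ fun m hm => by rw [key n m hm]

/-- A criterion for the robber to escape `k` cops by jumping between stations `st v`.  Here
`h v` measures how far a cop is from threatening the station `v`. -/
theorem lt_copNumber_of_stations {X S : Type*} [MetricSpace X] {k : ℕ} (st : S → X)
    (adj : S → S → Prop) (h : S → X → ℝ) {L M δ ε : ℝ} (hL : 0 < L) (hε : 0 < ε)
    (hadj : ∀ v w, adj v w → dist (st v) (st w) ≤ L)
    (hstep : ∀ v x y, dist x y ≤ L → h v x - M ≤ h v y)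
    (hfar : ∀ v x, δ < h v x → ε ≤ dist (st v) x)
    (huniq : ∀ v x w₁ w₂, δ < h v x → adj v w₁ → adj v w₂ → h w₁ x ≤ M + δ → h w₂ x ≤ M + δ →
      w₁ = w₂)
    (hdeg : ∀ v, ∃ f : Fin (k + 1) → S, Function.Injective f ∧ ∀ j, adj v (f j))
    (hstart : ∃ s x, δ < h s x) :
    (k : ℕ∞) < copNumber X (fun x y => dist x y) := by
  classical
  have main : ∀ j ≤ k, ¬ CopsWinWith X (fun x y => dist x y) j := by
    intro j hj hwin
    obtain ⟨s0, x0, hs0⟩ := hstart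
    obtain ⟨σ, hσ⟩ := hwin (fun _ => L) ⟨fun _ => hL, by
      rw [summable_const_iff]; exact hL.ne'⟩ (st s0) (fun _ => x0)
    have good : ∀ v (c : Fin j → X), (∀ i, δ < h v (c i)) →
        ∃ w, adj v w ∧ ∀ i, M + δ < h w (c i) := by
      intro v c hc
      by_contra! hbad
      obtain ⟨f, hf, hfa⟩ := hdeg v
      choose i hi using fun m => hbad (f m) (hfa m)
      obtain ⟨m, m', hne, he⟩ := Fintype.exists_ne_map_eq_of_card_lt i (by simp; omega)
      have h2 := hi m'
      rw [← he] at h2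
      exact hne (hf (huniq v (c (i m)) _ _ (hc _) (hfa m) (hfa m') (hi m) h2))
    let next : S → (Fin j → X) → S := fun v c =>
      if H : ∃ w, adj v w ∧ ∀ i, M + δ < h w (c i) then H.choose else v
    obtain ⟨s, h0, hs⟩ := exists_response_sequence (fun _ => x0) σ st s0 next
    set c := copTraj (fun _ => x0) σ (fun m => st (s m)) with hc
    have hlegal : ∀ n, dist (st (s n)) (st (s (n + 1))) ≤ L := by
      intro n
      rw [hs n]
      by_cases H : ∃ w, adj (s n) w ∧ ∀ i, M + δ < h w (c n i)
      · simp only [next, dif_pos H]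
        exact hadj _ _ H.choose_spec.1
      · simp only [next, dif_neg H, dist_self]
        exact hL.le
    obtain ⟨hmove, hcatch⟩ := hσ (fun m => st (s m)) (by simp [h0]) hlegal
    have inv : ∀ n i, δ < h (s n) (c n i) := by
      intro n
      induction n with
      | zero => intro i; rw [h0]; exact hs0
      | succ n ih =>
        intro i
        have H := good (s n) (c n) ih
        have : s (n + 1) = H.choose := by rw [hs n]; simp only [next, dif_pos H]
        rw [this]
        have h1 := H.choose_spec.2 i
        have h2 := hstep H.choose _ _ (hmove n i)
        linarith
    obtain ⟨n, i, hlt⟩ := hcatch ε hε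
    exact absurd (hfar _ _ (inv n i)) (not_le.2 hlt)
  have : ((k + 1 : ℕ) : ℕ∞) ≤ copNumber X (fun x y => dist x y) := by
    refine le_sInf ?_
    rintro _ ⟨j, rfl, hj⟩
    refine Nat.cast_le.2 ?_
    by_contra hlt
    exact main j (by omega) hj
  exact lt_of_lt_of_le (Nat.cast_lt.2 (Nat.lt_succ_self k)) this

/-- The closed simplex spanned by a finite set of vertices, in barycentric coordinates. -/
def baryFace {V : Type*} [Fintype V] (t : Finset V) : Set (V → ℝ) :=
  {w | (∀ u, 0 ≤ w u) ∧ ∑ u, w u = 1 ∧ ∀ u ∉ t, w u = 0}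

/-- The realization, in barycentric coordinates, of the complex with the given facets. -/
def realization {V : Type*} [Fintype V] (T : Set (Finset V)) : Set (V → ℝ) :=
  {w | ∃ t ∈ T, w ∈ baryFace t}

section Realization

variable {V : Type*} [Fintype V]

theorem convex_baryFace (t : Finset V) : Convex ℝ (baryFace t) := by
  rintro w ⟨h0, h1, h2⟩ w' ⟨h0', h1', h2'⟩ a b ha hb hab
  refine ⟨fun u => ?_, ?_, fun u hu => ?_⟩
  · have := h0 u
    have := h0' u
    simp only [Pi.add_apply, Pi.smul_apply, smul_eq_mul]
    positivity
  · simp only [Pi.add_apply, Pi.smul_apply, smul_eq_mul, Finset.sum_add_distrib,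
      ← Finset.mul_sum, h1, h1', mul_one, hab]
  · simp [h2 u hu, h2' u hu]

theorem isClosed_baryFace (t : Finset V) : IsClosed (baryFace t) := by
  have : baryFace t = (⋂ u, {w : V → ℝ | 0 ≤ w u}) ∩ ({w | ∑ u, w u = 1} ∩
      ⋂ u, ⋂ _ : u ∉ t, {w | w u = 0}) := by
    ext w; simp [baryFace]
  rw [this]
  refine (isClosed_iInter fun u => isClosed_le continuous_const (continuous_apply u)).inter
    (IsClosed.inter (isClosed_eq (by fun_prop) continuous_const) ?_)
  exact isClosed_iInter fun u => isClosed_iInter fun _ =>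
    isClosed_eq (continuous_apply u) continuous_const

theorem isCompact_baryFace (t : Finset V) : IsCompact (baryFace t) := by
  refine (isCompact_univ_pi fun _ : V => isCompact_Icc (a := (0 : ℝ)) (b := 1)).of_isClosed_subset
    (isClosed_baryFace t) ?_
  rintro w ⟨h0, h1, -⟩ u -
  exact ⟨h0 u, h1 ▸ Finset.single_le_sum (fun v _ => h0 v) (Finset.mem_univ u)⟩

theorem isCompact_realization (T : Set (Finset V)) : IsCompact (realization T) := by
  have : realization T = ⋃ t ∈ T, baryFace t := by ext; simp [realization]
  rw [this]
  exact T.toFinite.isCompact_biUnion fun t _ => isCompact_baryFace t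

theorem single_mem_baryFace [DecidableEq V] {t : Finset V} {u : V} (hu : u ∈ t) :
    Pi.single u (1 : ℝ) ∈ baryFace t := by
  refine ⟨fun v => ?_, ?_, fun v hv => ?_⟩
  · by_cases h : v = u
    · subst h; simp
    · simp [h]
  · simp
  · have : v ≠ u := fun h => hv (h ▸ hu)
    simp [this]

theorem baryFace_eq_convexHull [DecidableEq V] (t : Finset V) :
    baryFace t = convexHull ℝ ((fun u => Pi.single u (1 : ℝ)) '' (t : Set V)) := by
  refine Subset.antisymm ?_ (convexHull_min ?_ (convex_baryFace t))
  · rintro w ⟨h0, h1, h2⟩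
    have hw : w = ∑ u ∈ t, w u • Pi.single u (1 : ℝ) := by
      ext v
      simp only [Finset.sum_apply, Pi.smul_apply, Pi.single_apply, smul_eq_mul, mul_ite, mul_one,
        mul_zero, Finset.sum_ite_eq]
      split_ifs with hv
      exacts [rfl, h2 v hv]
    rw [hw]
    refine (convex_convexHull ℝ _).sum_mem (fun u _ => h0 u) ?_ fun u hu =>
      subset_convexHull ℝ _ ⟨u, hu, rfl⟩
    rw [← h1]
    exact Finset.sum_subset (Finset.subset_univ t) fun u _ hu => h2 u hu
  · rintro _ ⟨u, hu, rfl⟩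
    exact single_mem_baryFace hu

theorem sq_sum_mul_le_of_card_eq_three {t : Finset V} (ht : t.card = 3) {D z : V → ℝ}
    (hD : ∀ u ∈ t, ∀ v ∈ t, |D u - D v| ≤ 1) (hz : ∑ u, z u = 0) (hzt : ∀ u ∉ t, z u = 0) :
    (∑ u, D u * z u) ^ 2 ≤ 2 / 3 * ∑ u, z u ^ 2 := by
  classical
  have conv : ∀ f : V → ℝ, (∀ u ∉ t, f u = 0) → ∑ u, f u = ∑ u ∈ t, f u := fun f hf =>
    (Finset.sum_subset (Finset.subset_univ t) fun u _ hu => hf u hu).symm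
  rw [conv _ fun u hu => by simp [hzt u hu], conv (fun u => z u ^ 2) fun u hu => by simp [hzt u hu]]
  rw [conv _ hzt] at hz
  obtain ⟨a, b, c, hab, hac, hbc, rfl⟩ := Finset.card_eq_three.1 ht
  have h1 := abs_le.1 (hD a (by simp) c (by simp))
  have h2 := abs_le.1 (hD b (by simp) c (by simp))
  have h3 := abs_le.1 (hD a (by simp) b (by simp))
  rw [Finset.sum_insert (by simp [hab, hac]), Finset.sum_insert (by simp [hbc]),
    Finset.sum_singleton] at hz ⊢
  rw [Finset.sum_insert (by simp [hab, hac]), Finset.sum_insert (by simp [hbc]),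
    Finset.sum_singleton]
  have hc : z c = - z a - z b := by linarith
  rw [hc]
  obtain ⟨p, hp⟩ : ∃ p, p = D a - D c := ⟨_, rfl⟩
  obtain ⟨q, hq⟩ : ∃ q, q = D b - D c := ⟨_, rfl⟩
  have hpq : p ^ 2 - p * q + q ^ 2 ≤ 1 := by
    rw [← hp] at h1
    rw [← hq] at h2
    have h3' : -1 ≤ p - q ∧ p - q ≤ 1 := by constructor <;> linarith [h3.1, h3.2]
    rcases le_total 0 p with hp0 | hp0 <;> rcases le_total 0 q with hq0 | hq0 <;>
      rcases le_total p q with h | h <;> nlinarith [h1.1, h1.2, h2.1, h2.2, h3'.1, h3'.2]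
  have hsum : D a * z a + (D b * z b + D c * (- z a - z b)) = p * z a + q * z b := by
    rw [hp, hq]; ring
  rw [hsum]
  nlinarith [sq_nonneg (p * (z a + 2 * z b) - q * (2 * z a + z b)), mul_nonneg (sub_nonneg.2 hpq)
    (show 0 ≤ z a ^ 2 + z a * z b + z b ^ 2 by nlinarith [sq_nonneg (z a + z b), sq_nonneg (z a), sq_nonneg (z b)])]

end Realization

/-- The affine realization of barycentric coordinates in Euclidean space for which
the vertices have mutual distance one. -/
noncomputable def toEuclid {V : Type*} {N : ℕ} (ε : V ≃ Fin N) :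
    (V → ℝ) ≃ₗ[ℝ] EuclideanSpace ℝ (Fin N) :=
  LinearEquiv.funCongrLeft ℝ ℝ ε.symm ≪≫ₗ (WithLp.linearEquiv 2 ℝ (Fin N → ℝ)).symm ≪≫ₗ
    LinearEquiv.smulOfNeZero ℝ _ (√2)⁻¹ (by positivity)

theorem dist_toEuclid_sq {V : Type*} [Fintype V] {N : ℕ} (ε : V ≃ Fin N) (w w' : V → ℝ) :
    dist (toEuclid ε w) (toEuclid ε w') ^ 2 = 1 / 2 * ∑ u, (w u - w' u) ^ 2 := by
  rw [EuclideanSpace.dist_eq, Real.sq_sqrt (by positivity), Finset.mul_sum, ← ε.symm.sum_comp]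
  refine Finset.sum_congr rfl fun i _ => ?_
  simp only [toEuclid, LinearEquiv.trans_apply, LinearEquiv.smulOfNeZero_apply, Real.dist_eq,
    sq_abs, PiLp.smul_apply, smul_eq_mul]
  rw [← mul_sub, mul_pow, inv_pow, Real.sq_sqrt zero_le_two]
  simp [LinearEquiv.funCongrLeft_apply, LinearMap.funLeft_apply]

theorem exists_radius_mem_of_mem_isClosed {E ι : Type*} [PseudoMetricSpace E]
    {T : Set ι} (hT : T.Finite) {C : ι → Set E} (hC : ∀ t, IsClosed (C t)) (x : E) :
    ∃ r > 0, ∀ y, dist x y < r → ∀ t ∈ T, y ∈ C t → x ∈ C t := by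
  have hcl : IsClosed (⋃ t ∈ {t ∈ T | x ∉ C t}, C t) :=
    (hT.subset (sep_subset _ _)).isClosed_biUnion fun t _ => hC t
  have hx : x ∈ (⋃ t ∈ {t ∈ T | x ∉ C t}, C t)ᶜ := by
    simp only [mem_compl_iff, mem_iUnion, not_exists]
    exact fun t ht => ht.2
  obtain ⟨r, hr, H⟩ := Metric.isOpen_iff.1 hcl.isOpen_compl x hx
  refine ⟨r, hr, fun y hy t ht hyt => by_contra fun hxt => ?_⟩
  exact H (by rwa [Metric.mem_ball, dist_comm]) (mem_biUnion (show t ∈ {t ∈ T | x ∉ C t} from ⟨ht, hxt⟩) hyt)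

theorem exists_simplicialComplex_toEuclid {V : Type*} [Fintype V] [DecidableEq V] {N : ℕ}
    (ε : V ≃ Fin N) (T : Set (Finset V)) :
    ∃ K : Geometry.SimplicialComplex ℝ (EuclideanSpace ℝ (Fin N)), K.faces.Finite ∧
      (∀ f ∈ K.faces, ∀ x ∈ f, ∀ y ∈ f, x ≠ y → dist x y = 1) ∧
      K.space = toEuclid ε '' realization T := by
  classical
  let vtx : V → EuclideanSpace ℝ (Fin N) := fun u => toEuclid ε (Pi.single u 1)
  have hinj : Function.Injective vtx := by
    intro u v h
    have h := congrFun ((toEuclid ε).injective h) u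
    by_contra hne
    simp [hne] at h
  have hind : AffineIndependent ℝ (fun x : range vtx => (x : EuclideanSpace ℝ (Fin N))) :=
    (((Pi.linearIndependent_single_one V ℝ).map' (toEuclid ε).toLinearMap
      (LinearEquiv.ker _)).affineIndependent).range
  have himage : ∀ g : Finset V, toEuclid ε '' baryFace g = convexHull ℝ (g.image vtx : Set _) := by
    intro g
    rw [baryFace_eq_convexHull, Finset.coe_image]
    have := (toEuclid ε).toLinearMap.image_convexHull (𝕜 := ℝ)
      ((fun u => Pi.single u (1 : ℝ)) '' (g : Set V))
    rw [image_image] at this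
    exact this
  let P : PreAbstractSimplicialComplex (EuclideanSpace ℝ (Fin N)) :=
    { faces := {s | ∃ g : Finset V, g.Nonempty ∧ (∃ t ∈ T, g ⊆ t) ∧ s = g.image vtx}
      isRelLowerSet_faces := by
        rintro _ ⟨g, hg, ⟨t, ht, hgt⟩, rfl⟩
        refine ⟨hg.image _, fun s hs hne => ?_⟩
        obtain ⟨g', hg', rfl⟩ := Finset.subset_image_iff.1 hs
        exact ⟨g', Finset.image_nonempty.1 hne, ⟨t, ht, subset_trans hg' hgt⟩, rfl⟩ }
  have hsub : (⋃ s ∈ P.faces, (s : Set (EuclideanSpace ℝ (Fin N)))) ⊆ range vtx := by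
    refine iUnion₂_subset ?_
    rintro _ ⟨g, -, -, rfl⟩
    simp
  refine ⟨Geometry.SimplicialComplex.ofAffineIndependent P (hind.mono hsub), ?_, ?_, ?_⟩
  · refine (finite_range fun g : Finset V => g.image vtx).subset ?_
    rintro _ ⟨g, -, -, rfl⟩
    exact ⟨g, rfl⟩
  · rintro _ ⟨g, -, -, rfl⟩ x hx y hy hxy
    obtain ⟨u, -, rfl⟩ := Finset.mem_image.1 hx
    obtain ⟨v, -, rfl⟩ := Finset.mem_image.1 hy
    have huv : u ≠ v := fun h => hxy (by rw [h])
    have h := dist_toEuclid_sq ε (Pi.single u (1 : ℝ)) (Pi.single v 1)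
    have hsum : ∑ i, ((Pi.single u (1 : ℝ) : V → ℝ) i - (Pi.single v (1 : ℝ) : V → ℝ) i) ^ 2 = 2 := by
      have : ∀ i, ((Pi.single u (1 : ℝ) : V → ℝ) i - (Pi.single v (1 : ℝ) : V → ℝ) i) ^ 2 =
          (Pi.single u (1 : ℝ) : V → ℝ) i + (Pi.single v (1 : ℝ) : V → ℝ) i := by
        intro i
        by_cases hi : i = u
        · subst hi; simp [huv]
        · by_cases hi' : i = v
          · subst hi'; simp [hi]
          · simp [hi, hi']
      simp only [this, Finset.sum_add_distrib]
      norm_num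
    rw [hsum] at h
    have h1 : dist (vtx u) (vtx v) ^ 2 = 1 := by simpa using h
    exact (pow_eq_one_iff_of_nonneg dist_nonneg two_ne_zero).1 h1
  · ext y
    rw [Geometry.SimplicialComplex.mem_space_iff]
    constructor
    · rintro ⟨_, ⟨g, -, ⟨t, ht, hgt⟩, rfl⟩, hy⟩
      rw [← himage] at hy
      obtain ⟨w, ⟨h0, h1, h2⟩, rfl⟩ := hy
      exact ⟨w, ⟨t, ht, h0, h1, fun u hu => h2 u fun h => hu (hgt h)⟩, rfl⟩
    · rintro ⟨w, ⟨t, ht, hw⟩, rfl⟩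
      refine ⟨t.image vtx, ⟨t, ?_, ⟨t, ht, subset_rfl⟩, rfl⟩, ?_⟩
      · rw [Finset.nonempty_iff_ne_empty]
        rintro rfl
        have := hw.2.1
        rw [Finset.sum_eq_zero fun u _ => hw.2.2 u (by simp)] at this
        exact zero_ne_one this
      · rw [← himage]
        exact mem_image_of_mem _ hw

theorem exists_homeomorph_of_eq_image {E F : Type*} [TopologicalSpace E] [TopologicalSpace F]
    (f : E ≃ₜ F) {S : Set E} {S' : Set F} (h : S' = f '' S) :
    ∃ g : S ≃ₜ S', ∀ w, (g w : F) = f w := by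
  subst h
  exact ⟨f.image S, fun _ => rfl⟩

/-- Every connected finite abstract complex whose facets are triangles has a simplicially
metrized realization which is a game space. -/
theorem exists_simplicially_metrized {V : Type} [Fintype V] [DecidableEq V] (T : Set (Finset V))
    (hT : ∀ t ∈ T, t.card = 3) (hne : T.Nonempty)
    (hconn : ∀ t ∈ T, ∀ t' ∈ T, ∀ u ∈ t, ∀ v ∈ t',
      Relation.ReflTransGen (fun u v => ∃ t ∈ T, u ∈ t ∧ v ∈ t) u v) :
    ∃ (X : Type) (_ : MetricSpace X) (e : X ≃ₜ realization T),
      GameSpaceD X (fun x y => dist x y) ∧ SimpliciallyMetrized X ∧ IsPathConnected (realization T) ∧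
      (∀ x y, ∀ t ∈ T, (e x).1 ∈ baryFace t → (e y).1 ∈ baryFace t →
        dist x y ^ 2 = 1 / 2 * ∑ u, ((e x).1 u - (e y).1 u) ^ 2) ∧
      ∀ D : V → ℝ, (∀ t ∈ T, ∀ u ∈ t, ∀ v ∈ t, |D u - D v| ≤ 1) → ∀ x y,
        ∑ u, D u * (e y).1 u - ∑ u, D u * (e x).1 u ≤ 2 / √3 * dist x y := by
  let ε : V ≃ Fin (Fintype.card V) := Fintype.equivFin V
  obtain ⟨K, hK1, hK2, hK3⟩ := exists_simplicialComplex_toEuclid ε T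
  let Φ := (toEuclid ε).toContinuousLinearEquiv
  have hΦ : ∀ w, Φ w = toEuclid ε w := fun w => rfl
  have hA : IsCompact K.space := by
    rw [hK3]
    exact (isCompact_realization T).image Φ.continuous
  obtain ⟨t0, ht0⟩ := hne
  obtain ⟨u0, hu0⟩ : t0.Nonempty := Finset.card_pos.1 (by rw [hT t0 ht0]; norm_num)
  have hAne : K.space.Nonempty := by
    rw [hK3]
    exact ⟨_, mem_image_of_mem _ ⟨t0, ht0, single_mem_baryFace hu0⟩⟩
  have hseg : ∀ t ∈ T, ∀ w ∈ baryFace t, ∀ w' ∈ baryFace t,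
      segment ℝ (toEuclid ε w) (toEuclid ε w') ⊆ K.space := by
    intro t ht w hw w' hw'
    have := image_segment ℝ (toEuclid ε).toLinearMap.toAffineMap w w'
    simp only [LinearMap.coe_toAffineMap, LinearEquiv.coe_coe] at this
    rw [← this, hK3]
    exact image_mono fun z hz => ⟨t, ht, (convex_baryFace t).segment_subset hw hw' hz⟩
  have hloc' : ∀ w ∈ realization T, ∃ r > 0, ∀ w' ∈ realization T,
      dist (toEuclid ε w) (toEuclid ε w') < r → ∃ t ∈ T, w ∈ baryFace t ∧ w' ∈ baryFace t := by
    intro w hw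
    obtain ⟨r, hr, H⟩ := exists_radius_mem_of_mem_isClosed T.toFinite
      (C := fun t => toEuclid ε '' baryFace t)
      (fun t => ((isCompact_baryFace t).image Φ.continuous).isClosed) (toEuclid ε w)
    refine ⟨r, hr, ?_⟩
    rintro w' ⟨t, ht, hw't⟩ hd
    have := H _ hd t ht (mem_image_of_mem _ hw't)
    rw [(toEuclid ε).injective.mem_set_image] at this
    exact ⟨t, ht, this, hw't⟩
  have hloc : ∀ x ∈ K.space, ∃ r > 0, ∀ y ∈ K.space, dist x y < r → segment ℝ x y ⊆ K.space := by
    rw [hK3]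
    rintro _ ⟨w, hw, rfl⟩
    obtain ⟨r, hr, H⟩ := hloc' w hw
    refine ⟨r, hr, ?_⟩
    rintro _ ⟨w', hw', rfl⟩ hd
    obtain ⟨t, ht, h1, h2⟩ := H w' hw' hd
    rw [← hK3]
    exact hseg t ht w h1 w' h2
  obtain ⟨pt, hptv⟩ : ∃ pt : realization T → K.space, ∀ w, (pt w : EuclideanSpace ℝ _) =
      toEuclid ε w := ⟨fun w => ⟨toEuclid ε w, hK3 ▸ mem_image_of_mem _ w.2⟩, fun _ => rfl⟩
  have hpt : Function.Surjective pt := by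
    rintro ⟨y, hy⟩
    have hy' := hy
    rw [hK3] at hy'
    obtain ⟨w, hw, rfl⟩ := hy'
    exact ⟨⟨w, hw⟩, Subtype.ext (hptv _)⟩
  have hface : ∀ t ∈ T, ∀ w w' : realization T, w.1 ∈ baryFace t → w'.1 ∈ baryFace t →
      intrinsicDistE K.space (pt w) (pt w') ≠ ⊤ := by
    intro t ht w w' hw hw'
    rw [intrinsicDistE_eq_of_segment (by rw [hptv, hptv]; exact hseg t ht _ hw _ hw')]
    exact edist_ne_top _ _
  have htrans : ∀ x y z, intrinsicDistE K.space x y ≠ ⊤ → intrinsicDistE K.space y z ≠ ⊤ →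
      intrinsicDistE K.space x z ≠ ⊤ := fun x y z h1 h2 =>
    ne_top_of_le_ne_top (ENNReal.add_ne_top.2 ⟨h1, h2⟩) (intrinsicDistE_triangle x y z)
  have hvert : ∀ t ∈ T, ∀ u ∈ t, ∀ v, Relation.ReflTransGen (fun u v => ∃ t ∈ T, u ∈ t ∧ v ∈ t) u v →
      ∀ t' ∈ T, ∀ w : realization T, v ∈ t' → w.1 ∈ baryFace t' → ∀ hu,
      intrinsicDistE K.space (pt ⟨Pi.single u 1, hu⟩) (pt w) ≠ ⊤ := by
    intro t ht u hut v huv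
    induction huv with
    | refl => exact fun t' ht' w hv hw hu => hface t' ht' _ _ (single_mem_baryFace hv) hw
    | @tail b c hb hc ih =>
      intro t' ht' w hv hw hu
      obtain ⟨s, hs, hbs, hcs⟩ := hc
      refine htrans _ (pt ⟨Pi.single c 1, ⟨s, hs, single_mem_baryFace hcs⟩⟩) _ ?_
        (hface t' ht' _ _ (single_mem_baryFace hv) hw)
      exact ih s hs _ hbs (single_mem_baryFace hcs) hu
  have hfin : ∀ x y : K.space, intrinsicDistE K.space x y ≠ ⊤ := by
    intro x y
    obtain ⟨w, rfl⟩ := hpt x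
    obtain ⟨w', rfl⟩ := hpt y
    obtain ⟨t, ht, hwt⟩ := w.2
    obtain ⟨t', ht', hwt'⟩ := w'.2
    obtain ⟨u, hu⟩ : t.Nonempty := Finset.card_pos.1 (by rw [hT t ht]; norm_num)
    obtain ⟨v, hv⟩ : t'.Nonempty := Finset.card_pos.1 (by rw [hT t' ht']; norm_num)
    refine htrans _ (pt ⟨Pi.single u 1, ⟨t, ht, single_mem_baryFace hu⟩⟩) _ ?_ ?_
    · exact hface t ht _ _ hwt (single_mem_baryFace hu)
    · exact hvert t ht u hu v (hconn t ht t' ht' u hu v hv) t' ht' w' hv hwt' _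
  obtain ⟨X, mX, e, he, hgame, hgeo⟩ := exists_intrinsic_metric hA hAne hloc hfin
  obtain ⟨h1, hh1⟩ := exists_homeomorph_of_eq_image Φ.toHomeomorph (S := realization T) hK3
  replace hh1 : ∀ w, (h1 w : EuclideanSpace ℝ _) = toEuclid ε w := hh1
  have hdist : ∀ x y, ∀ t ∈ T, (h1.symm (e x)).1 ∈ baryFace t → (h1.symm (e y)).1 ∈ baryFace t →
        dist x y ^ 2 = 1 / 2 * ∑ u, ((h1.symm (e x)).1 u - (h1.symm (e y)).1 u) ^ 2 := by
    intro x y t ht hx hy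
    rw [← dist_toEuclid_sq ε, ← hh1, ← hh1, h1.apply_symm_apply, h1.apply_symm_apply]
    have := hseg t ht _ hx _ hy
    rw [← hh1, ← hh1, h1.apply_symm_apply, h1.apply_symm_apply] at this
    have := intrinsicDistE_eq_of_segment this
    rw [← he, edist_dist, ENNReal.ofReal_eq_ofReal_iff dist_nonneg dist_nonneg] at this
    rw [this]
  refine ⟨X, mX, e.trans h1.symm, hgame, ⟨_, K, hK1, hK2, e.toEquiv, he⟩, ?_, hdist, ?_⟩
  · have : PathConnectedSpace X := by
      refine ⟨hgame.1, fun x y => ?_⟩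
      obtain ⟨p, p0, p1, hp⟩ := hgeo x y
      have hpc : ContinuousOn p (Icc 0 1) := by
        refine (LipschitzOnWith.of_dist_le_mul (K := ⟨dist x y, dist_nonneg⟩) ?_).continuousOn
        intro s hs t ht
        rw [mul_comm, Real.dist_eq]
        exact hp s hs t ht
      exact ⟨⟨⟨fun t => p t, hpc.comp_continuous continuous_subtype_val fun t => t.2⟩,
        by simpa using p0, by simpa using p1⟩⟩
    rw [isPathConnected_iff_pathConnectedSpace]
    exact (e.trans h1.symm).surjective.pathConnectedSpace (e.trans h1.symm).continuous
  · intro D hD x y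
    refine abs_sub_le_of_pointwise_lipschitz hgeo
      (f := fun x => ∑ u, D u * (h1.symm (e x)).1 u) (by positivity) (fun x => ?_) x y
    obtain ⟨r, hr, H⟩ := hloc' (h1.symm (e x)).1 (h1.symm (e x)).2
    have hcont : Continuous fun y => dist (toEuclid ε (h1.symm (e x)).1) (toEuclid ε (h1.symm (e y)).1) :=
      continuous_const.dist (Φ.continuous.comp
        (continuous_subtype_val.comp (h1.symm.continuous.comp e.continuous)))
    have hev := hcont.continuousAt (x := x) |>.eventually_lt_const (u := r) (by simpa using hr)
    filter_upwards [hev] with y hy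
    obtain ⟨t, ht, hx, hy⟩ := H _ (h1.symm (e y)).2 hy
    have hd := hdist y x t ht hy hx
    have key := sq_sum_mul_le_of_card_eq_three (hT t ht) (hD t ht)
      (z := fun u => (h1.symm (e y)).1 u - (h1.symm (e x)).1 u)
      (by rw [Finset.sum_sub_distrib, hx.2.1, hy.2.1, sub_self])
      (fun u hu => by simp only [hx.2.2 u hu, hy.2.2 u hu, sub_self])
    simp only [mul_sub, Finset.sum_sub_distrib] at key
    refine abs_le_of_sq_le_sq ?_ (by positivity)
    rw [mul_pow, div_pow, Real.sq_sqrt (by norm_num), dist_comm x y, hd]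
    calc _ ≤ _ := key
      _ = _ := by ring

/-- The piecewise linear tent function of the `j`-th ray of the fan of `n` rays with
directions `(cos (2πj/n), sin (2πj/n))`. -/
noncomputable def tent (n j : ℕ) (z : ℝ × ℝ) : ℝ :=
  max 0 (min
    ((z.1 * Real.sin ((j + 1) * (2 * Real.pi / n)) - z.2 * Real.cos ((j + 1) * (2 * Real.pi / n))) /
      Real.sin (2 * Real.pi / n))
    ((z.2 * Real.cos ((j - 1) * (2 * Real.pi / n)) - z.1 * Real.sin ((j - 1) * (2 * Real.pi / n))) /
      Real.sin (2 * Real.pi / n)))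

theorem continuous_tent (n j : ℕ) : Continuous (tent n j) := by
  unfold tent
  fun_prop

/-- The direction of the `j`-th ray of the fan of `n` rays. -/
noncomputable def ray (n j : ℕ) : ℝ × ℝ :=
  (Real.cos (j * (2 * Real.pi / n)), Real.sin (j * (2 * Real.pi / n)))

theorem ray_self {n : ℕ} (hn : 0 < n) : ray n n = ray n 0 := by
  have : (n : ℝ) * (2 * Real.pi / n) = 2 * Real.pi := by field_simp
  simp [ray, this]

theorem tent_nonneg (n j : ℕ) (z : ℝ × ℝ) : 0 ≤ tent n j z := le_max_left _ _

theorem tent_ray_comb {n : ℕ} (hn : 4 ≤ n) {i j : ℕ} (hi : i < n) (hj : j < n) {α β : ℝ}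
    (hα : 0 ≤ α) (hβ : 0 ≤ β) :
    tent n j (α • ray n i + β • ray n (i + 1)) =
      if j = i then α else if j = (i + 1) % n then β else 0 := by
  obtain ⟨h, hh⟩ : ∃ h : ℝ, h = 2 * Real.pi / n := ⟨_, rfl⟩
  have hn' : (4 : ℝ) ≤ n := by exact_mod_cast hn
  have hnh : n * h = 2 * Real.pi := by rw [hh]; field_simp
  have hpos : 0 < h := by rw [hh]; positivity
  have hle : h ≤ Real.pi / 2 := by
    rw [hh, div_le_div_iff₀ (by positivity) two_pos]
    nlinarith [Real.pi_pos]
  have hs : 0 < Real.sin h := Real.sin_pos_of_pos_of_lt_pi hpos (by linarith [Real.pi_pos])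
  have hc : 0 ≤ Real.cos h := Real.cos_nonneg_of_neg_pi_div_two_le_of_le (by linarith) hle
  obtain ⟨d, m, hd, hdm⟩ : ∃ d m : ℕ, d < n ∧ (j : ℝ) = i + d - m * n := by
    rcases le_or_gt i j with h | h
    · refine ⟨j - i, 0, by omega, ?_⟩
      push_cast [h]; ring
    · refine ⟨j + n - i, 1, by omega, ?_⟩
      rw [Nat.cast_sub (by omega)]
      push_cast; ring
  have hdm' : j + m * n = i + d := by
    have : ((j + m * n : ℕ) : ℝ) = (i + d : ℕ) := by push_cast; linarith
    exact_mod_cast this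
  have hA : ((α • ray n i + β • ray n (i + 1)).1 * Real.sin ((j + 1) * h) -
      (α • ray n i + β • ray n (i + 1)).2 * Real.cos ((j + 1) * h)) =
      α * Real.sin ((d + 1) * h) + β * Real.sin (d * h) := by
    have e1 : Real.sin ((d + 1) * h) = Real.sin ((j + 1) * h - i * h) := by
      rw [← Real.sin_sub_nat_mul_two_pi ((d + 1) * h) m, ← hnh, hdm]; ring_nf
    have e2 : Real.sin (d * h) = Real.sin ((j + 1) * h - (i + 1) * h) := by
      rw [← Real.sin_sub_nat_mul_two_pi (d * h) m, ← hnh, hdm]; ring_nf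
    rw [e1, e2, Real.sin_sub, Real.sin_sub]
    simp only [ray, ← hh, Prod.fst_add, Prod.smul_fst, Prod.snd_add, Prod.smul_snd, smul_eq_mul]
    push_cast
    ring
  have hB : ((α • ray n i + β • ray n (i + 1)).2 * Real.cos ((j - 1) * h) -
      (α • ray n i + β • ray n (i + 1)).1 * Real.sin ((j - 1) * h)) =
      - (α * Real.sin ((d - 1) * h) + β * Real.sin ((d - 2) * h)) := by
    have e1 : Real.sin ((d - 1) * h) = Real.sin ((j - 1) * h - i * h) := by
      rw [← Real.sin_sub_nat_mul_two_pi ((d - 1) * h) m, ← hnh, hdm]; ring_nf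
    have e2 : Real.sin ((d - 2) * h) = Real.sin ((j - 1) * h - (i + 1) * h) := by
      rw [← Real.sin_sub_nat_mul_two_pi ((d - 2) * h) m, ← hnh, hdm]; ring_nf
    rw [e1, e2, Real.sin_sub, Real.sin_sub]
    simp only [ray, ← hh, Prod.fst_add, Prod.smul_fst, Prod.snd_add, Prod.smul_snd, smul_eq_mul]
    push_cast
    ring
  have hsin2 : Real.sin (2 * h) = 2 * Real.sin h * Real.cos h := Real.sin_two_mul h
  rw [tent, ← hh, hA, hB]
  have hm : m = 0 ∨ m = 1 := by
    rcases Nat.lt_or_ge m 2 with hm | hm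
    · omega
    · have := Nat.mul_le_mul_right n hm
      omega
  have hmod : (i + 1) % n = if i + 1 = n then 0 else i + 1 := by
    split_ifs with h
    · rw [h, Nat.mod_self]
    · exact Nat.mod_eq_of_lt (by omega)
  rw [hmod]
  rcases Nat.lt_or_ge d 2 with hd2 | hd2
  · rcases Nat.lt_or_ge d 1 with hd1 | hd1
    · have h0 : d = 0 := by omega
      have hji : j = i := by rcases hm with rfl | rfl <;> omega
      rw [if_pos hji]
      subst h0
      have e1 : (((0 : ℕ) : ℝ) + 1) * h = h := by push_cast; ring
      have e2 : (((0 : ℕ) : ℝ) - 1) * h = -h := by push_cast; ring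
      have e3 : (((0 : ℕ) : ℝ) - 2) * h = -(2 * h) := by push_cast; ring
      rw [e1, e2, e3, Real.sin_neg, Real.sin_neg, hsin2]
      simp only [Nat.cast_zero, zero_mul, Real.sin_zero, mul_zero, add_zero]
      have e4 : -(α * -Real.sin h + β * -(2 * Real.sin h * Real.cos h)) / Real.sin h =
        α + 2 * β * Real.cos h := by field_simp; ring
      rw [e4, mul_div_cancel_right₀ _ hs.ne', min_eq_left (le_add_of_nonneg_right (by positivity)),
        max_eq_right hα]
    · have h1 : d = 1 := by omega
      have hji : j = if i + 1 = n then 0 else i + 1 := by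
        split_ifs <;> rcases hm with rfl | rfl <;> omega
      have hne : j ≠ i := by rcases hm with rfl | rfl <;> omega
      rw [if_neg hne, if_pos hji]
      subst h1
      have e1 : (((1 : ℕ) : ℝ) + 1) * h = 2 * h := by push_cast; ring
      have e2 : (((1 : ℕ) : ℝ) - 1) * h = 0 := by push_cast; ring
      have e3 : (((1 : ℕ) : ℝ) - 2) * h = -h := by push_cast; ring
      rw [e1, e2, e3, Real.sin_neg, hsin2]
      simp only [Nat.cast_one, one_mul, Real.sin_zero, mul_zero, zero_add]
      have e4 : (α * (2 * Real.sin h * Real.cos h) + β * Real.sin h) / Real.sin h =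
        2 * α * Real.cos h + β := by field_simp
      have e5 : -(β * -Real.sin h) / Real.sin h = β := by field_simp
      rw [e4, e5, min_eq_right (le_add_of_nonneg_left (by positivity)), max_eq_right hβ]
  · have hji : j ≠ if i + 1 = n then 0 else i + 1 := by
      split_ifs <;> rcases hm with rfl | rfl <;> omega
    have hne : j ≠ i := by rcases hm with rfl | rfl <;> omega
    rw [if_neg hne, if_neg hji]
    refine max_eq_left ?_
    have hd2' : (2 : ℝ) ≤ d := by exact_mod_cast hd2
    have hdn : (d : ℝ) + 1 ≤ n := by exact_mod_cast hd
    rcases le_total ((d - 1) * h) Real.pi with hp | hp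
    · refine min_le_of_right_le (div_nonpos_of_nonpos_of_nonneg ?_ hs.le)
      have s1 : 0 ≤ Real.sin ((d - 1) * h) := Real.sin_nonneg_of_nonneg_of_le_pi
        (mul_nonneg (by linarith) hpos.le) hp
      have s2 : 0 ≤ Real.sin ((d - 2) * h) := Real.sin_nonneg_of_nonneg_of_le_pi
        (mul_nonneg (by linarith) hpos.le) (by nlinarith)
      have := mul_nonneg hα s1
      have := mul_nonneg hβ s2
      linarith
    · refine min_le_of_left_le (div_nonpos_of_nonpos_of_nonneg ?_ hs.le)
      have neg : ∀ x, Real.pi ≤ x → x ≤ 2 * Real.pi → Real.sin x ≤ 0 := by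
        intro x h1 h2
        have := Real.sin_nonneg_of_nonneg_of_le_pi (x := x - Real.pi) (by linarith) (by linarith)
        rw [Real.sin_sub_pi] at this
        linarith
      have s1 := neg ((d + 1) * h) (by nlinarith) (by rw [← hnh]; nlinarith)
      have s2 := neg (d * h) (by nlinarith) (by rw [← hnh]; nlinarith)
      have := mul_nonpos_of_nonneg_of_nonpos hα s1
      have := mul_nonpos_of_nonneg_of_nonpos hβ s2
      linarith

theorem exists_ray_comb {n : ℕ} (hn : 4 ≤ n) (z : ℝ × ℝ) :
    ∃ i < n, ∃ α β : ℝ, 0 ≤ α ∧ 0 ≤ β ∧ z = α • ray n i + β • ray n (i + 1) := by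
  obtain ⟨h, hh⟩ : ∃ h : ℝ, h = 2 * Real.pi / n := ⟨_, rfl⟩
  have hn' : (4 : ℝ) ≤ n := by exact_mod_cast hn
  have hnh : n * h = 2 * Real.pi := by rw [hh]; field_simp
  have hpos : 0 < h := by rw [hh]; positivity
  have hle : h ≤ Real.pi / 2 := by
    rw [hh, div_le_div_iff₀ (by positivity) two_pos]
    nlinarith [Real.pi_pos]
  have hs : 0 < Real.sin h := Real.sin_pos_of_pos_of_lt_pi hpos (by linarith [Real.pi_pos])
  obtain ⟨r, θ, hr, hθ0, hθ1, hz1, hz2⟩ : ∃ r θ : ℝ, 0 ≤ r ∧ 0 ≤ θ ∧ θ < 2 * Real.pi ∧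
      z.1 = r * Real.cos θ ∧ z.2 = r * Real.sin θ := by
    have c1 := Complex.norm_mul_cos_arg (⟨z.1, z.2⟩ : ℂ)
    have c2 := Complex.norm_mul_sin_arg (⟨z.1, z.2⟩ : ℂ)
    have b1 := Complex.neg_pi_lt_arg (⟨z.1, z.2⟩ : ℂ)
    have b2 := Complex.arg_le_pi (⟨z.1, z.2⟩ : ℂ)
    rcases le_or_gt 0 (Complex.arg (⟨z.1, z.2⟩ : ℂ)) with h0 | h0
    · exact ⟨‖(⟨z.1, z.2⟩ : ℂ)‖, Complex.arg (⟨z.1, z.2⟩ : ℂ), norm_nonneg _, h0, by linarith [Real.pi_pos], c1.symm, c2.symm⟩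
    · refine ⟨‖(⟨z.1, z.2⟩ : ℂ)‖, Complex.arg (⟨z.1, z.2⟩ : ℂ) + 2 * Real.pi, norm_nonneg _,
        by linarith,
        by linarith, ?_, ?_⟩
      · rw [Real.cos_add_two_pi]; exact c1.symm
      · rw [Real.sin_add_two_pi]; exact c2.symm
  have f1 : (⌊θ / h⌋₊ : ℝ) * h ≤ θ := (le_div_iff₀ hpos).1 (Nat.floor_le (by positivity))
  have f2 : θ < ((⌊θ / h⌋₊ : ℝ) + 1) * h := (div_lt_iff₀ hpos).1 (Nat.lt_floor_add_one _)
  refine ⟨⌊θ / h⌋₊, ?_, r * Real.sin ((⌊θ / h⌋₊ + 1) * h - θ) / Real.sin h,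
    r * Real.sin (θ - ⌊θ / h⌋₊ * h) / Real.sin h, ?_, ?_, ?_⟩
  · have : (⌊θ / h⌋₊ : ℝ) * h < n * h := by linarith
    exact_mod_cast lt_of_mul_lt_mul_right this hpos.le
  · have := Real.sin_nonneg_of_nonneg_of_le_pi (x := (⌊θ / h⌋₊ + 1) * h - θ) (by linarith)
      (by linarith [Real.pi_pos])
    positivity
  · have := Real.sin_nonneg_of_nonneg_of_le_pi (x := θ - ⌊θ / h⌋₊ * h) (by linarith)
      (by linarith [Real.pi_pos])
    positivity
  · obtain ⟨a, ha⟩ : ∃ a : ℝ, a = ⌊θ / h⌋₊ * h := ⟨_, rfl⟩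
    have e1 : ((⌊θ / h⌋₊ : ℝ) + 1) * h = a + h := by rw [ha]; ring
    rw [← ha, e1]
    have key : Real.sin h ^ 2 + Real.cos h ^ 2 = 1 := Real.sin_sq_add_cos_sq h
    have key2 : Real.sin a ^ 2 + Real.cos a ^ 2 = 1 := Real.sin_sq_add_cos_sq a
    refine Prod.ext ?_ ?_
    · simp only [ray, ← hh, Prod.fst_add, Prod.smul_fst, smul_eq_mul, ← ha, hz1]
      push_cast
      rw [e1, Real.sin_sub, Real.sin_sub, Real.sin_add, Real.cos_add]
      field_simp
      linear_combination (-r * Real.sin h * Real.cos θ) * key2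
    · simp only [ray, ← hh, Prod.snd_add, Prod.smul_snd, smul_eq_mul, ← ha, hz2]
      push_cast
      rw [e1, Real.sin_sub, Real.sin_sub, Real.sin_add, Real.cos_add]
      field_simp
      linear_combination (-r * Real.sin h * Real.sin θ) * key2

/-- The sequence `c` lists cyclically the link of the vertex `u` in the pure two-dimensional
complex with facets `T`. -/
structure IsLinkCycle {V : Type*} [DecidableEq V] (T : Set (Finset V)) (u : V) (n : ℕ)
    (c : ℕ → V) : Prop where
  four_le : 4 ≤ n
  closed : c n = c 0
  inj : ∀ i < n, ∀ j < n, c i = c j → i = j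
  ne : ∀ i < n, c i ≠ u
  subset : ∀ t ∈ T, u ∈ t → ∃ i < n, t ⊆ {u, c i, c (i + 1)}
  exists_mem : ∀ i < n, ∃ t ∈ T, {u, c i, c (i + 1)} ⊆ t

theorem sum_ite_consecutive {M : Type*} [AddCommMonoid M] [Module ℝ M] {n i : ℕ} (hn : 2 ≤ n)
    (hi : i < n) (α β : ℝ) (x : ℕ → M) :
    ∑ j ∈ Finset.range n, (if j = i then α else if j = (i + 1) % n then β else 0) • x j =
      α • x i + β • x ((i + 1) % n) := by
  have hlt : (i + 1) % n < n := Nat.mod_lt _ (by omega)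
  have hne : (i + 1) % n ≠ i := by
    rcases Nat.lt_or_ge (i + 1) n with h | h
    · rw [Nat.mod_eq_of_lt h]; omega
    · rw [show i + 1 = n by omega, Nat.mod_self]; omega
  rw [← Finset.sum_subset (s₁ := {i, (i + 1) % n})]
  · rw [Finset.sum_pair hne.symm]
    simp [hne]
  · intro j hj
    simp only [Finset.mem_insert, Finset.mem_singleton] at hj
    rcases hj with rfl | rfl <;> simpa
  · intro j _ hj
    simp only [Finset.mem_insert, Finset.mem_singleton, not_or] at hj
    simp [hj.1, hj.2]

namespace IsLinkCycle

variable {V : Type*} [DecidableEq V] {T : Set (Finset V)} {u : V} {n : ℕ} {c : ℕ → V}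

theorem apply_mod (h : IsLinkCycle T u n c) {i : ℕ} (hi : i < n) : c ((i + 1) % n) = c (i + 1) := by
  rcases Nat.lt_or_ge (i + 1) n with h' | h'
  · rw [Nat.mod_eq_of_lt h']
  · rw [show i + 1 = n by omega, Nat.mod_self, h.closed]

theorem mod_lt (h : IsLinkCycle T u n c) (i : ℕ) : i % n < n :=
  Nat.mod_lt _ (by have := h.four_le; omega)

/-- The planar chart of the open star of a vertex. -/
noncomputable def chart (u : V) (n : ℕ) (c : ℕ → V) (w : V → ℝ) : ℝ × ℝ :=
  ∑ j ∈ Finset.range n, (w (c j) / w u) • ray n j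

/-- The inverse of the planar chart of the open star of a vertex. -/
noncomputable def unchart (u : V) (n : ℕ) (c : ℕ → V) (z : ℝ × ℝ) (v : V) : ℝ :=
  ((if v = u then 1 else 0) + ∑ j ∈ Finset.range n, tent n j z • (if v = c j then (1 : ℝ) else 0)) /
    (1 + ∑ j ∈ Finset.range n, tent n j z • (1 : ℝ))

/-- The point of the star with the given coordinates relative to the central vertex. -/
noncomputable def starPoint (u : V) (c : ℕ → V) (i : ℕ) (α β : ℝ) (v : V) : ℝ :=
  ((if v = u then 1 else 0) + (α • (if v = c i then (1 : ℝ) else 0) +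
    β • (if v = c (i + 1) then (1 : ℝ) else 0))) / (1 + (α + β))

theorem unchart_comb (h : IsLinkCycle T u n c) {i : ℕ} (hi : i < n) {α β : ℝ} (hα : 0 ≤ α)
    (hβ : 0 ≤ β) : unchart u n c (α • ray n i + β • ray n (i + 1)) = starPoint u c i α β := by
  have hn := h.four_le
  ext v
  have key : ∀ x : ℕ → ℝ, ∑ j ∈ Finset.range n,
      tent n j (α • ray n i + β • ray n (i + 1)) • x j = α • x i + β • x ((i + 1) % n) := by
    intro x
    rw [← sum_ite_consecutive (by omega) hi]
    refine Finset.sum_congr rfl fun j hj => ?_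
    rw [tent_ray_comb hn hi (Finset.mem_range.1 hj) hα hβ]
  rw [unchart, key, key, h.apply_mod hi, starPoint]
  simp

theorem chart_starPoint (h : IsLinkCycle T u n c) {i : ℕ} (hi : i < n) {α β : ℝ} (hα : 0 ≤ α)
    (hβ : 0 ≤ β) : chart u n c (starPoint u c i α β) = α • ray n i + β • ray n (i + 1) := by
  have hn := h.four_le
  have hray : ray n (i + 1) = ray n ((i + 1) % n) := by
    rcases Nat.lt_or_ge (i + 1) n with h' | h'
    · rw [Nat.mod_eq_of_lt h']
    · rw [show i + 1 = n by omega, Nat.mod_self, ray_self (by omega)]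
  have hpos : 0 < 1 + (α + β) := by positivity
  have hcu : ∀ j < n, u ≠ c j := fun j hj e => h.ne j hj e.symm
  have hu : starPoint u c i α β u = 1 / (1 + (α + β)) := by
    rw [starPoint, if_pos rfl, if_neg (hcu i hi), ← h.apply_mod hi,
      if_neg (hcu _ (h.mod_lt _))]
    simp
  rw [hray, ← sum_ite_consecutive (by omega) hi, chart]
  refine Finset.sum_congr rfl fun j hj => ?_
  have hj := Finset.mem_range.1 hj
  congr 1
  rw [hu, starPoint, if_neg (h.ne j hj), ← h.apply_mod hi]
  have e1 : c j = c i ↔ j = i := ⟨h.inj j hj i hi, fun e => e ▸ rfl⟩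
  have e2 : c j = c ((i + 1) % n) ↔ j = (i + 1) % n :=
    ⟨h.inj j hj _ (h.mod_lt _), fun e => e ▸ rfl⟩
  simp only [e1, e2]
  have hne : (i + 1) % n ≠ i := by
    rcases Nat.lt_or_ge (i + 1) n with h | h
    · rw [Nat.mod_eq_of_lt h]; omega
    · rw [show i + 1 = n by omega, Nat.mod_self]; omega
  by_cases h1 : j = i
  · have : ¬ j = (i + 1) % n := fun e => hne (e ▸ h1)
    simp only [h1, if_true, if_neg hne.symm]
    field_simp
    simp
  · simp only [h1, if_false]
    split_ifs <;> field_simp <;> simp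

theorem starPoint_center_pos (h : IsLinkCycle T u n c) {i : ℕ} (hi : i < n) {α β : ℝ} (hα : 0 ≤ α)
    (hβ : 0 ≤ β) : 0 < starPoint u c i α β u := by
  have n1 : u ≠ c i := (h.ne i hi).symm
  have n2 : u ≠ c (i + 1) := by rw [← h.apply_mod hi]; exact (h.ne _ (h.mod_lt _)).symm
  rw [starPoint, if_pos rfl, if_neg n1, if_neg n2]
  simp only [smul_eq_mul, mul_zero, add_zero]
  positivity

variable [Fintype V]

theorem eq_starPoint (h : IsLinkCycle T u n c) {w : V → ℝ} (hw : w ∈ realization T)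
    (hu : 0 < w u) : ∃ i < n, w = starPoint u c i (w (c i) / w u) (w (c (i + 1)) / w u) := by
  obtain ⟨t, ht, h0, h1, h2⟩ := hw
  have hut : u ∈ t := by
    by_contra hc
    exact hu.ne' (h2 u hc)
  obtain ⟨i, hi, hti⟩ := h.subset t ht hut
  refine ⟨i, hi, ?_⟩
  have n1 : u ≠ c i := (h.ne i hi).symm
  have n2 : u ≠ c (i + 1) := by rw [← h.apply_mod hi]; exact (h.ne _ (h.mod_lt _)).symm
  have n3 : c i ≠ c (i + 1) := by
    rw [← h.apply_mod hi]
    intro e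
    have := h.inj i hi _ (h.mod_lt _) e
    rcases Nat.lt_or_ge (i + 1) n with h' | h'
    · rw [Nat.mod_eq_of_lt h'] at this; omega
    · rw [show i + 1 = n by omega, Nat.mod_self] at this
      have := h.four_le
      omega
  have hsum : w u + (w (c i) + w (c (i + 1))) = 1 := by
    rw [← h1, ← Finset.sum_subset (Finset.subset_univ {u, c i, c (i + 1)})
      fun v _ hv => h2 v fun hv' => hv (hti hv'),
      Finset.sum_insert (by simp [n1, n2]), Finset.sum_pair n3]
  have hS : 1 + (w (c i) / w u + w (c (i + 1)) / w u) = 1 / w u := by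
    field_simp
    linarith
  ext v
  rw [starPoint, hS]
  by_cases e0 : v = u
  · subst e0
    rw [if_pos rfl, if_neg n1, if_neg n2]
    field_simp; simp
  by_cases e1 : v = c i
  · subst e1
    rw [if_neg e0, if_pos rfl, if_neg n3]
    simp only [smul_eq_mul, mul_one, mul_zero]
    field_simp
    ring
  by_cases e2 : v = c (i + 1)
  · subst e2
    rw [if_neg e0, if_neg e1, if_pos rfl]
    simp only [smul_eq_mul, mul_one, mul_zero]
    field_simp
    ring
  rw [if_neg e0, if_neg e1, if_neg e2, h2 v fun hv => by simpa [e0, e1, e2] using hti hv]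
  simp

theorem starPoint_mem (h : IsLinkCycle T u n c) {i : ℕ} (hi : i < n) {α β : ℝ} (hα : 0 ≤ α)
    (hβ : 0 ≤ β) : starPoint u c i α β ∈ realization T := by
  obtain ⟨t, ht, hti⟩ := h.exists_mem i hi
  have hpos : 0 < 1 + (α + β) := by positivity
  refine ⟨t, ht, fun v => ?_, ?_, fun v hv => ?_⟩
  · unfold starPoint
    simp only [smul_eq_mul]
    positivity
  · simp only [starPoint]
    rw [← Finset.sum_div, div_eq_one_iff_eq hpos.ne', Finset.sum_add_distrib,
      Finset.sum_add_distrib, ← Finset.smul_sum, ← Finset.smul_sum]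
    simp
  · have e0 : v ≠ u := by rintro rfl; exact hv (hti (by simp))
    have e1 : v ≠ c i := by rintro rfl; exact hv (hti (by simp))
    have e2 : v ≠ c (i + 1) := by rintro rfl; exact hv (hti (by simp))
    simp [starPoint, e0, e1, e2]

/-- The open star of a vertex whose link is a cycle is homeomorphic to the plane. -/
noncomputable def starHomeomorph (h : IsLinkCycle T u n c) :
    {w : realization T | 0 < w.1 u} ≃ₜ ℝ × ℝ where
  toFun w := chart u n c w.1.1
  invFun z := ⟨⟨unchart u n c z, by
      obtain ⟨i, hi, α, β, hα, hβ, rfl⟩ := exists_ray_comb h.four_le z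
      rw [h.unchart_comb hi hα hβ]
      exact h.starPoint_mem hi hα hβ⟩, by
      obtain ⟨i, hi, α, β, hα, hβ, rfl⟩ := exists_ray_comb h.four_le z
      simp only [mem_ofPred_eq]
      rw [h.unchart_comb hi hα hβ]
      exact h.starPoint_center_pos hi hα hβ⟩
  left_inv := by
    rintro ⟨⟨w, hw⟩, hu⟩
    obtain ⟨i, hi, e⟩ := h.eq_starPoint hw hu
    have h0 : ∀ v, 0 ≤ w v := by
      obtain ⟨t, ht, h0, -⟩ := hw
      exact h0
    refine Subtype.ext (Subtype.ext ?_)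
    have hu' : 0 < w u := hu
    have a1 : 0 ≤ w (c i) / w u := div_nonneg (h0 _) hu'.le
    have a2 : 0 ≤ w (c (i + 1)) / w u := div_nonneg (h0 _) hu'.le
    show unchart u n c (chart u n c w) = w
    generalize w (c i) / w u = α at *
    generalize w (c (i + 1)) / w u = β at *
    rw [e, h.chart_starPoint hi a1 a2, h.unchart_comb hi a1 a2]
  right_inv z := by
    show chart u n c (unchart u n c z) = z
    obtain ⟨i, hi, α, β, hα, hβ, rfl⟩ := exists_ray_comb h.four_le z
    rw [h.unchart_comb hi hα hβ, h.chart_starPoint hi hα hβ]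
  continuous_toFun := by
    unfold chart
    refine continuous_finsetSum _ fun j _ => ?_
    refine Continuous.smul (f := fun w : {w : realization T | 0 < w.1 u} => w.1.1 (c j) / w.1.1 u)
      (Continuous.div ?_ ?_ fun w => (show 0 < w.1.1 u from w.2).ne') continuous_const
    · exact (continuous_apply _).comp (continuous_subtype_val.comp continuous_subtype_val)
    · exact (continuous_apply _).comp (continuous_subtype_val.comp continuous_subtype_val)
  continuous_invFun := by
    refine Continuous.subtype_mk (Continuous.subtype_mk ?_ _) _
    refine continuous_pi fun v => ?_
    unfold unchart
    refine Continuous.div ?_ ?_ fun z => ?_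
    · exact continuous_const.add (continuous_finsetSum _ fun j _ =>
        (continuous_tent n j).smul continuous_const)
    · exact continuous_const.add (continuous_finsetSum _ fun j _ =>
        (continuous_tent n j).smul continuous_const)
    · have : 0 ≤ ∑ j ∈ Finset.range n, tent n j z • (1 : ℝ) :=
        Finset.sum_nonneg fun j _ => by simpa using tent_nonneg n j z
      positivity

end IsLinkCycle

/-- A space homeomorphic to a connected complex embedded in space all of whose vertex links are
cycles is a closed orientable surface. -/
theorem isClosedOrientableSurface_of_isLinkCycle {V : Type*} [Fintype V] [DecidableEq V]
    {T : Set (Finset V)} (hconn : IsPathConnected (realization T))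
    (hlink : ∀ t ∈ T, ∀ u ∈ t, ∃ n c, IsLinkCycle T u n c)
    (F : (V → ℝ) → EuclideanSpace ℝ (Fin 3)) (hF : Continuous F) (hinj : InjOn F (realization T))
    {X : Type*} [TopologicalSpace X] (e : X ≃ₜ realization T) : IsClosedOrientableSurface X := by
  have hcomp := isCompact_realization T
  have : CompactSpace (realization T) := isCompact_iff_compactSpace.1 hcomp
  let φ : realization T ≃ₜ F '' realization T :=
    Continuous.homeoOfEquivCompactToT2 (f := Equiv.Set.imageOfInjOn F _ hinj)
      (by exact Continuous.subtype_mk (hF.comp continuous_subtype_val) _)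
  refine ⟨F '' realization T, hcomp.image hF, hconn.isConnected.image F hF.continuousOn, ?_,
    ⟨e.trans φ⟩⟩
  intro x
  obtain ⟨t, ht, h0, h1, h2⟩ := (φ.symm x).2
  obtain ⟨u, hu⟩ : ∃ u, 0 < (φ.symm x).1 u := by
    by_contra! hc
    have : ∑ u, (φ.symm x).1 u = 0 :=
      Finset.sum_eq_zero fun u _ => le_antisymm (hc u) (h0 u)
    linarith
  have hut : u ∈ t := by
    by_contra hc
    exact hu.ne' (h2 u hc)
  obtain ⟨n, c, hc⟩ := hlink t ht u hut
  have hopen : IsOpen {w : realization T | 0 < w.1 u} :=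
    isOpen_lt continuous_const ((continuous_apply u).comp continuous_subtype_val)
  refine ⟨φ.symm ⁻¹' {w : realization T | 0 < w.1 u}, hopen.preimage φ.symm.continuous, hu, ⟨?_⟩⟩
  refine (φ.symm.sets rfl).trans (hc.starHomeomorph.trans ?_)
  exact (Homeomorph.finTwoArrow (X := ℝ)).symm.trans
    (EuclideanSpace.equiv (Fin 2) ℝ).symm.toHomeomorph

/-- The vertices of a single body with `n` tube slots. -/
inductive BodyVertex (n : ℕ)
  | hub
  | bot
  | rim (t : Fin (n + 1))
  | tub (s : Fin n) (l : Fin 3)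

/-- The facets of a single body with `n` tube slots. -/
inductive BodyFacet (n : ℕ)
  | left
  | right
  | base (s : Fin n)
  | hubSide (s : Fin n)
  | rimLeft (s : Fin n)
  | rimRight (s : Fin n)
  | tubBase (s : Fin n)
  | tubRight (s : Fin n)
  | tubLeft (s : Fin n)

namespace BodyVertex

noncomputable instance (n : ℕ) : DecidableEq (BodyVertex n) := Classical.decEq _

noncomputable instance (n : ℕ) : Fintype (BodyVertex n) :=
  Fintype.ofInjective (fun v : BodyVertex n => (match v with
    | hub => Sum.inl true
    | bot => Sum.inl false
    | rim t => Sum.inr (Sum.inl t)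
    | tub s l => Sum.inr (Sum.inr (s, l)) : Bool ⊕ Fin (n + 1) ⊕ Fin n × Fin 3)) <| by
    rintro (_ | _ | _ | _) (_ | _ | _ | _) h <;> simp_all

end BodyVertex

open BodyVertex in
/-- The vertices of a facet of a body. -/
noncomputable def BodyFacet.verts {n : ℕ} : BodyFacet n → Finset (BodyVertex n)
  | left => {bot, hub, rim 0}
  | right => {bot, hub, rim (Fin.last n)}
  | base s => {bot, rim s.castSucc, rim s.succ}
  | hubSide s => {hub, tub s 1, tub s 2}
  | rimLeft s => {rim s.castSucc, tub s 2, tub s 0}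
  | rimRight s => {rim s.succ, tub s 0, tub s 1}
  | tubBase s => {tub s 0, rim s.castSucc, rim s.succ}
  | tubRight s => {tub s 1, rim s.succ, hub}
  | tubLeft s => {tub s 2, hub, rim s.castSucc}

theorem BodyFacet.card_verts {n : ℕ} (k : BodyFacet n) : k.verts.card = 3 := by
  cases k <;> rw [Finset.card_eq_three] <;>
    exact ⟨_, _, _, by simp, by simp [Fin.ext_iff], by simp [Fin.ext_iff], rfl⟩

theorem IsLinkCycle.of_list {V : Type*} [DecidableEq V] {T : Set (Finset V)} {u : V} (L : List V)
    (h4 : 4 ≤ L.length) (hL : L.Nodup) (hu : u ∉ L)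
    (hsub : ∀ t ∈ T, u ∈ t → ∃ i < L.length,
      t ⊆ {u, L.getD i u, L.getD ((i + 1) % L.length) u})
    (hex : ∀ i < L.length, ∃ t ∈ T, {u, L.getD i u, L.getD ((i + 1) % L.length) u} ⊆ t) :
    IsLinkCycle T u L.length fun i => L.getD (i % L.length) u where
  four_le := h4
  closed := by simp
  inj i hi j hj h := by
    simp only [Nat.mod_eq_of_lt hi, Nat.mod_eq_of_lt hj, List.getD_eq_getElem _ _ hi,
      List.getD_eq_getElem _ _ hj] at h
    exact (List.Nodup.getElem_inj_iff hL).1 h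
  ne i hi h := by
    simp only [Nat.mod_eq_of_lt hi, List.getD_eq_getElem _ _ hi] at h
    exact hu (h ▸ List.getElem_mem hi)
  subset t ht hut := by
    obtain ⟨i, hi, h⟩ := hsub t ht hut
    exact ⟨i, hi, by simpa only [Nat.mod_eq_of_lt hi] using h⟩
  exists_mem i hi := by
    obtain ⟨t, ht, h⟩ := hex i hi
    exact ⟨t, ht, by simpa only [Nat.mod_eq_of_lt hi] using h⟩

theorem IsLinkCycle.map {V W : Type*} [DecidableEq V] [DecidableEq W] {T : Set (Finset V)}
    {T' : Set (Finset W)} {g : V → W} (hg : Function.Injective g) {u : V} {n : ℕ} {c : ℕ → V}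
    (h : IsLinkCycle T u n c) (hT : ∀ t ∈ T, t.image g ∈ T')
    (hT' : ∀ t' ∈ T', g u ∈ t' → ∃ t ∈ T, t' = t.image g) :
    IsLinkCycle T' (g u) n (g ∘ c) where
  four_le := h.four_le
  closed := congrArg g h.closed
  inj i hi j hj e := h.inj i hi j hj (hg e)
  ne i hi e := h.ne i hi (hg e)
  subset t' ht' hu := by
    obtain ⟨t, ht, rfl⟩ := hT' t' ht' hu
    obtain ⟨i, hi, hs⟩ := h.subset t ht (by simpa [hg.eq_iff] using hu)
    refine ⟨i, hi, (Finset.image_subset_image hs).trans ?_⟩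
    simp [Finset.image_insert]
  exists_mem i hi := by
    obtain ⟨t, ht, hs⟩ := h.exists_mem i hi
    refine ⟨_, hT t ht, ?_⟩
    have := Finset.image_subset_image (f := g) hs
    simpa [Finset.image_insert] using this

namespace BodyVertex

variable {n : ℕ}

open BodyFacet

/-- The link of the hub of a body. -/
def hubLink [NeZero n] (m : ℕ) : BodyVertex n :=
  if m = 0 ∨ m = 3 * n + 2 then bot
  else if m % 3 = 1 then rim (Fin.ofNat (n + 1) (m / 3))
  else if m % 3 = 2 then tub (Fin.ofNat n (m / 3)) 2
  else tub (Fin.ofNat n (m / 3 - 1)) 1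

theorem hubLink_zero [NeZero n] : hubLink (n := n) 0 = bot := by simp [hubLink]

theorem hubLink_last [NeZero n] : hubLink (n := n) (3 * n + 1 + 1) = bot := by simp [hubLink]

theorem hubLink_rim [NeZero n] {j : ℕ} (hj : j < n + 1) : hubLink (n := n) (3 * j + 1) = rim ⟨j, hj⟩ := by
  rw [hubLink, if_neg (by omega), if_pos (by omega)]
  congr 1
  ext
  simp only [Fin.ofNat]
  rw [Nat.mod_eq_of_lt] <;> omega

theorem hubLink_tub_two [NeZero n] {j : ℕ} (hj : j < n) :
    hubLink (n := n) (3 * j + 1 + 1) = tub ⟨j, hj⟩ 2 := by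
  rw [hubLink, if_neg (by omega), if_neg (by omega), if_pos (by omega)]
  congr 1
  ext
  simp only [Fin.ofNat]
  rw [Nat.mod_eq_of_lt] <;> omega

theorem hubLink_tub_one [NeZero n] {j : ℕ} (hj : j < n) :
    hubLink (n := n) (3 * j + 1 + 1 + 1) = tub ⟨j, hj⟩ 1 := by
  rw [hubLink, if_neg (by omega), if_neg (by omega), if_neg (by omega)]
  congr 1
  ext
  simp only [Fin.ofNat]
  rw [Nat.mod_eq_of_lt] <;> omega

theorem hubLink_cases {m : ℕ} (hm : m < 3 * n + 2) : m = 0 ∨ m = 3 * n + 1 ∨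
    ∃ j < n, m = 3 * j + 1 ∨ m = 3 * j + 1 + 1 ∨ m = 3 * j + 1 + 1 + 1 := by
  by_cases h0 : m = 0
  · exact Or.inl h0
  by_cases h1 : m = 3 * n + 1
  · exact Or.inr (Or.inl h1)
  exact Or.inr (Or.inr ⟨(m - 1) / 3, by omega, by omega⟩)

/-- The position of a vertex in the link of the hub of a body. -/
def hubIndex : BodyVertex n → ℕ
  | hub => 0
  | bot => 0
  | rim t => 3 * t + 1
  | tub s l => if l = 2 then 3 * s + 1 + 1 else 3 * s + 1 + 1 + 1

theorem hubIndex_hubLink [NeZero n] {m : ℕ} (hm : m < 3 * n + 2) :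
    hubIndex (hubLink (n := n) m) = m := by
  rcases hubLink_cases hm with rfl | rfl | ⟨j, hj, rfl | rfl | rfl⟩
  · rw [hubLink_zero]; rfl
  · rw [hubLink_rim (by omega)]; rfl
  · rw [hubLink_rim (by omega)]; rfl
  · rw [hubLink_tub_two hj]; simp [hubIndex]
  · rw [hubLink_tub_one hj]; simp [hubIndex]

theorem isLinkCycle_hub [NeZero n] :
    IsLinkCycle (range (verts (n := n))) hub (3 * n + 2) hubLink where
  four_le := by have := NeZero.pos n; omega
  closed := by rw [hubLink_last, hubLink_zero]
  inj i hi j hj h := by rw [← hubIndex_hubLink hi, h, hubIndex_hubLink hj]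
  ne i hi := by
    rcases hubLink_cases hi with rfl | rfl | ⟨j, hj, rfl | rfl | rfl⟩
    · rw [hubLink_zero]; simp
    · rw [hubLink_rim (by omega)]; simp
    · rw [hubLink_rim (by omega)]; simp
    · rw [hubLink_tub_two hj]; simp
    · rw [hubLink_tub_one hj]; simp
  subset := by
    rintro _ ⟨k, rfl⟩ hk
    have hn := NeZero.pos n
    cases k with
    | left =>
      refine ⟨0, by omega, ?_⟩
      have := hubLink_rim (n := n) (j := 0) (by omega)
      rw [hubLink_zero, show 0 + 1 = 3 * 0 + 1 by rfl, this]
      simp [verts, Finset.subset_iff]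
    | right =>
      refine ⟨3 * n + 1, by omega, ?_⟩
      rw [hubLink_rim (by omega), hubLink_last]
      simp [verts, Finset.subset_iff, Fin.last]
    | base s => simp [verts] at hk
    | rimLeft s => simp [verts] at hk
    | rimRight s => simp [verts] at hk
    | tubBase s => simp [verts] at hk
    | hubSide s =>
      refine ⟨3 * s + 1 + 1, by omega, ?_⟩
      rw [hubLink_tub_two s.2, hubLink_tub_one s.2]
      simp [verts, Finset.subset_iff]
    | tubRight s =>
      refine ⟨3 * s + 1 + 1 + 1, by omega, ?_⟩
      rw [hubLink_tub_one s.2, show 3 * s.1 + 1 + 1 + 1 + 1 = 3 * (s.1 + 1) + 1 by ring,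
        hubLink_rim (by omega)]
      simp [verts, Finset.subset_iff, Fin.ext_iff]
    | tubLeft s =>
      refine ⟨3 * s + 1, by omega, ?_⟩
      rw [hubLink_tub_two s.2, hubLink_rim (by omega)]
      simp [verts, Finset.subset_iff, Fin.ext_iff]
  exists_mem i hi := by
    rcases hubLink_cases hi with rfl | rfl | ⟨j, hj, rfl | rfl | rfl⟩
    · refine ⟨_, ⟨left, rfl⟩, ?_⟩
      have := hubLink_rim (n := n) (j := 0) (by omega)
      rw [hubLink_zero, show 0 + 1 = 3 * 0 + 1 by rfl, this]
      simp [verts, Finset.subset_iff]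
    · refine ⟨_, ⟨right, rfl⟩, ?_⟩
      rw [hubLink_rim (by omega), hubLink_last]
      simp [verts, Finset.subset_iff, Fin.last]
    · refine ⟨_, ⟨tubLeft ⟨j, hj⟩, rfl⟩, ?_⟩
      rw [hubLink_tub_two hj, hubLink_rim (by omega)]
      simp [verts, Finset.subset_iff, Fin.ext_iff]
    · refine ⟨_, ⟨hubSide ⟨j, hj⟩, rfl⟩, ?_⟩
      rw [hubLink_tub_two hj, hubLink_tub_one hj]
      simp [verts, Finset.subset_iff]
    · refine ⟨_, ⟨tubRight ⟨j, hj⟩, rfl⟩, ?_⟩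
      rw [hubLink_tub_one hj, show 3 * j + 1 + 1 + 1 + 1 = 3 * (j + 1) + 1 by ring,
        hubLink_rim (by omega)]
      simp [verts, Finset.subset_iff, Fin.ext_iff]

/-- The link of the bottom vertex of a body. -/
def botLink (m : ℕ) : BodyVertex n :=
  if m = 0 ∨ m = n + 2 then hub else rim (Fin.ofNat (n + 1) (m - 1))

theorem botLink_rim {j : ℕ} (hj : j < n + 1) : botLink (n := n) (j + 1) = rim ⟨j, hj⟩ := by
  rw [botLink, if_neg (by omega)]
  congr 1
  ext
  simp only [Fin.ofNat]
  rw [Nat.mod_eq_of_lt] <;> omega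

theorem botLink_cases {m : ℕ} (hm : m < n + 2) : m = 0 ∨ m = n + 1 ∨ ∃ j < n, m = j + 1 := by
  by_cases h0 : m = 0
  · exact Or.inl h0
  by_cases h1 : m = n + 1
  · exact Or.inr (Or.inl h1)
  exact Or.inr (Or.inr ⟨m - 1, by omega, by omega⟩)

/-- The position of a vertex in the link of the bottom vertex of a body. -/
def botIndex : BodyVertex n → ℕ
  | rim t => t + 1
  | _ => 0

theorem botIndex_botLink {m : ℕ} (hm : m < n + 2) : botIndex (botLink (n := n) m) = m := by
  rcases botLink_cases hm with rfl | rfl | ⟨j, hj, rfl⟩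
  · simp [botLink, botIndex]
  · rw [botLink_rim (by omega)]; rfl
  · rw [botLink_rim (by omega)]; rfl

theorem isLinkCycle_bot (hn : 2 ≤ n) :
    IsLinkCycle (range (verts (n := n))) bot (n + 2) botLink where
  four_le := by omega
  closed := by simp [botLink]
  inj i hi j hj h := by rw [← botIndex_botLink hi, h, botIndex_botLink hj]
  ne i hi := by
    rcases botLink_cases hi with rfl | rfl | ⟨j, hj, rfl⟩
    · simp [botLink]
    · rw [botLink_rim (by omega)]; simp
    · rw [botLink_rim (by omega)]; simp
  subset := by
    rintro _ ⟨k, rfl⟩ hk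
    cases k with
    | left =>
      refine ⟨0, by omega, ?_⟩
      rw [botLink_rim (by omega)]
      simp [verts, Finset.subset_iff, botLink]
    | right =>
      refine ⟨n + 1, by omega, ?_⟩
      rw [botLink_rim (by omega)]
      simp [verts, Finset.subset_iff, botLink, Fin.last]
    | base s =>
      refine ⟨s + 1, by omega, ?_⟩
      rw [botLink_rim (by omega), botLink_rim (by omega)]
      simp [verts, Finset.subset_iff, Fin.ext_iff]
    | rimLeft s => simp [verts] at hk
    | rimRight s => simp [verts] at hk
    | tubBase s => simp [verts] at hk
    | hubSide s => simp [verts] at hk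
    | tubRight s => simp [verts] at hk
    | tubLeft s => simp [verts] at hk
  exists_mem i hi := by
    rcases botLink_cases hi with rfl | rfl | ⟨j, hj, rfl⟩
    · refine ⟨_, ⟨left, rfl⟩, ?_⟩
      rw [botLink_rim (by omega)]
      simp [verts, Finset.subset_iff, botLink]
    · refine ⟨_, ⟨right, rfl⟩, ?_⟩
      rw [botLink_rim (by omega)]
      simp [verts, Finset.subset_iff, botLink, Fin.last]
    · refine ⟨_, ⟨base ⟨j, hj⟩, rfl⟩, ?_⟩
      rw [botLink_rim (by omega), botLink_rim (by omega)]
      simp [verts, Finset.subset_iff, Fin.ext_iff]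

theorem exists_isLinkCycle_rim (hn : 2 ≤ n) (t : Fin (n + 1)) :
    ∃ m c, IsLinkCycle (range (verts (n := n))) (rim t) m c := by
  rcases Fin.eq_zero_or_eq_succ t with rfl | ⟨s, rfl⟩
  · obtain ⟨n, rfl⟩ : ∃ k, n = k + 1 := ⟨n - 1, by omega⟩
    have h1 : ∀ r : Fin (n + 1), 0 = r.castSucc ↔ r = 0 := fun r => by
      rw [eq_comm, Fin.castSucc_eq_zero_iff]
    have h2 : ∀ r : Fin (n + 1), 0 ≠ r.succ := fun r => (Fin.succ_ne_zero r).symm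
    refine ⟨_, _, IsLinkCycle.of_list [hub, tub 0 2, tub 0 0, rim 1, bot] (by simp) (by simp)
      (by simp) ?_ ?_⟩
    · rintro _ ⟨k, rfl⟩ hk
      cases k with
      | left => exact ⟨4, by simp, by simp [verts, Finset.subset_iff]⟩
      | base s =>
        obtain rfl : s = 0 := by simpa [verts, h1, h2] using hk
        exact ⟨3, by simp, by simp [verts, Finset.subset_iff]⟩
      | rimLeft s =>
        obtain rfl : s = 0 := by simpa [verts, h1, h2] using hk
        exact ⟨1, by simp, by simp [verts, Finset.subset_iff]⟩
      | tubBase s =>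
        obtain rfl : s = 0 := by simpa [verts, h1, h2] using hk
        exact ⟨2, by simp, by simp [verts, Finset.subset_iff]⟩
      | tubLeft s =>
        obtain rfl : s = 0 := by simpa [verts, h1, h2] using hk
        exact ⟨0, by simp, by simp [verts, Finset.subset_iff]⟩
      | right => simp [verts, Fin.ext_iff] at hk
      | rimRight s => simp [verts, h2] at hk
      | hubSide s => simp [verts] at hk
      | tubRight s => simp [verts, h2] at hk
    · intro i hi
      simp only [List.length_cons, List.length_nil] at hi
      interval_cases i
      · exact ⟨_, ⟨tubLeft 0, rfl⟩, by simp [verts, Finset.subset_iff]⟩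
      · exact ⟨_, ⟨rimLeft 0, rfl⟩, by simp [verts, Finset.subset_iff]⟩
      · exact ⟨_, ⟨tubBase 0, rfl⟩, by simp [verts, Finset.subset_iff]⟩
      · exact ⟨_, ⟨base 0, rfl⟩, by simp [verts, Finset.subset_iff]⟩
      · exact ⟨_, ⟨left, rfl⟩, by simp [verts, Finset.subset_iff]⟩
  by_cases hs : s.1 + 1 < n
  · obtain ⟨s', hs'⟩ : ∃ s' : Fin n, s.succ = s'.castSucc := ⟨⟨s + 1, hs⟩, rfl⟩
    have hne : s ≠ s' := by rintro rfl; simp [Fin.ext_iff] at hs'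
    have hne2 : s.castSucc ≠ s'.succ := by
      intro h
      simp [Fin.ext_iff] at h hs'
      omega
    have hz : s'.castSucc ≠ 0 := by rw [← hs']; simp
    have hl : s'.castSucc ≠ Fin.last n := by simp [Fin.ext_iff, s'.2.ne]
    have h1 : ∀ r : Fin n, s'.castSucc = r.succ ↔ r = s := fun r => by
      rw [← hs', Fin.succ_inj, eq_comm]
    have h2 : ∀ r : Fin n, s'.castSucc = r.castSucc ↔ r = s' := fun r => by
      rw [Fin.castSucc_inj, eq_comm]
    have h3 : s.castSucc ≠ s'.castSucc := by simp [hne]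
    have h4 : s'.succ ≠ s'.castSucc := by simp [Fin.ext_iff]
    rw [hs']
    refine ⟨_, _, IsLinkCycle.of_list [hub, tub s' 2, tub s' 0, rim s'.succ, bot, rim s.castSucc,
      tub s 0, tub s 1] (by simp) (by simp [hne, hne.symm, hne2, hne2.symm])
      (by simp [h3.symm, h4.symm]) ?_ ?_⟩
    · rintro _ ⟨k, rfl⟩ hk
      cases k with
      | base r =>
        simp only [verts, Finset.mem_insert, Finset.mem_singleton, rim.injEq, h1, h2,
          reduceCtorEq, false_or] at hk
        rcases hk with rfl | rfl
        · exact ⟨3, by simp, by simp [verts, Finset.subset_iff]⟩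
        · exact ⟨4, by simp, by simp [verts, Finset.subset_iff, hs']⟩
      | tubBase r =>
        simp only [verts, Finset.mem_insert, Finset.mem_singleton, rim.injEq, h1, h2,
          reduceCtorEq, false_or] at hk
        rcases hk with rfl | rfl
        · exact ⟨2, by simp, by simp [verts, Finset.subset_iff]⟩
        · exact ⟨5, by simp, by simp [verts, Finset.subset_iff, hs']⟩
      | rimLeft r =>
        obtain rfl : r = s' := by simpa [verts, h2] using hk
        exact ⟨1, by simp, by simp [verts, Finset.subset_iff]⟩
      | tubLeft r =>
        obtain rfl : r = s' := by simpa [verts, h2] using hk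
        exact ⟨0, by simp, by simp [verts, Finset.subset_iff]⟩
      | rimRight r =>
        obtain rfl : r = s := by simpa [verts, h1] using hk
        exact ⟨6, by simp, by simp [verts, Finset.subset_iff, hs']⟩
      | tubRight r =>
        obtain rfl : r = s := by simpa [verts, h1] using hk
        exact ⟨7, by simp, by simp [verts, Finset.subset_iff, hs']⟩
      | left => simp [verts, hz] at hk
      | right => simp [verts, hl] at hk
      | hubSide r => simp [verts] at hk
    · intro i hi
      simp only [List.length_cons, List.length_nil] at hi
      interval_cases i
      · exact ⟨_, ⟨tubLeft s', rfl⟩, by simp [verts, Finset.subset_iff]⟩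
      · exact ⟨_, ⟨rimLeft s', rfl⟩, by simp [verts, Finset.subset_iff]⟩
      · exact ⟨_, ⟨tubBase s', rfl⟩, by simp [verts, Finset.subset_iff]⟩
      · exact ⟨_, ⟨base s', rfl⟩, by simp [verts, Finset.subset_iff]⟩
      · exact ⟨_, ⟨base s, rfl⟩, by simp [verts, Finset.subset_iff, hs']⟩
      · exact ⟨_, ⟨tubBase s, rfl⟩, by simp [verts, Finset.subset_iff, hs']⟩
      · exact ⟨_, ⟨rimRight s, rfl⟩, by simp [verts, Finset.subset_iff, hs']⟩
      · exact ⟨_, ⟨tubRight s, rfl⟩, by simp [verts, Finset.subset_iff, hs']⟩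
  · have hsl : s.succ = Fin.last n := by ext; simp; omega
    have h1 : ∀ r : Fin n, s.succ = r.succ ↔ r = s := fun r => by
      rw [Fin.succ_inj, eq_comm]
    have h2 : ∀ r : Fin n, s.succ ≠ r.castSucc := fun r => by
      rw [hsl]; simp [Fin.ext_iff, r.2.ne']
    refine ⟨_, _, IsLinkCycle.of_list [hub, tub s 1, tub s 0, rim s.castSucc, bot] (by simp)
      (by simp) (by simp [h2]) ?_ ?_⟩
    · rintro _ ⟨k, rfl⟩ hk
      cases k with
      | right => exact ⟨4, by simp, by simp [verts, Finset.subset_iff, hsl]⟩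
      | base r =>
        obtain rfl : r = s := by simpa [verts, h1, h2] using hk
        exact ⟨3, by simp, by simp [verts, Finset.subset_iff]⟩
      | tubBase r =>
        obtain rfl : r = s := by simpa [verts, h1, h2] using hk
        exact ⟨2, by simp, by simp [verts, Finset.subset_iff]⟩
      | rimRight r =>
        obtain rfl : r = s := by simpa [verts, h1] using hk
        exact ⟨1, by simp, by simp [verts, Finset.subset_iff]⟩
      | tubRight r =>
        obtain rfl : r = s := by simpa [verts, h1] using hk
        exact ⟨0, by simp, by simp [verts, Finset.subset_iff]⟩
      | left => simp [verts] at hk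
      | rimLeft r => simp [verts, h2] at hk
      | tubLeft r => simp [verts, h2] at hk
      | hubSide r => simp [verts] at hk
    · intro i hi
      simp only [List.length_cons, List.length_nil] at hi
      interval_cases i
      · exact ⟨_, ⟨tubRight s, rfl⟩, by simp [verts, Finset.subset_iff]⟩
      · exact ⟨_, ⟨rimRight s, rfl⟩, by simp [verts, Finset.subset_iff]⟩
      · exact ⟨_, ⟨tubBase s, rfl⟩, by simp [verts, Finset.subset_iff]⟩
      · exact ⟨_, ⟨base s, rfl⟩, by simp [verts, Finset.subset_iff]⟩
      · exact ⟨_, ⟨right, rfl⟩, by simp [verts, Finset.subset_iff, hsl]⟩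

end BodyVertex

/-- The vertices of the surface glued from two families of bodies, of the two colours and both
indexed by `I`, along tubes; tubes are indexed by the slots of the bodies of colour `false`. -/
inductive SurfVertex (n : ℕ) (I : Type)
  | hub (c : Bool) (i : I)
  | bot (c : Bool) (i : I)
  | rim (c : Bool) (i : I) (t : Fin (n + 1))
  | tub (e : I × Fin n) (l : Fin 3)

/-- The exchange of the last two corners of a tube. -/
def cornerSwap : Fin 3 → Fin 3 := ![0, 2, 1]

theorem cornerSwap_zero : cornerSwap 0 = 0 := rfl

theorem cornerSwap_one : cornerSwap 1 = 2 := rfl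

theorem cornerSwap_two : cornerSwap 2 = 1 := rfl

theorem cornerSwap_cornerSwap (l : Fin 3) : cornerSwap (cornerSwap l) = l := by
  fin_cases l <;> rfl

namespace SurfVertex

noncomputable instance (n : ℕ) (I : Type) : DecidableEq (SurfVertex n I) := Classical.decEq _

noncomputable instance (n : ℕ) (I : Type) [Fintype I] : Fintype (SurfVertex n I) :=
  Fintype.ofInjective (fun v : SurfVertex n I => (match v with
    | hub c i => Sum.inl (Sum.inl (c, i))
    | bot c i => Sum.inl (Sum.inr (c, i))
    | rim c i t => Sum.inr (Sum.inl (c, i, t))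
    | tub e l => Sum.inr (Sum.inr (e, l)) :
      (Bool × I ⊕ Bool × I) ⊕ (Bool × I × Fin (n + 1)) ⊕ (I × Fin n) × Fin 3)) <| by
    rintro (_ | _ | _ | _) (_ | _ | _ | _) h <;> simp_all

end SurfVertex

section Surface

variable {n : ℕ} {I : Type} (φ : I × Fin n → I × Fin n)

/-- The vertices of the surface belonging to a body. -/
def bodyMap (c : Bool) (i : I) : BodyVertex n → SurfVertex n I
  | .hub => .hub c i
  | .bot => .bot c i
  | .rim t => .rim c i t
  | .tub s l => bif c then .tub (φ (i, s)) (cornerSwap l) else .tub (i, s) l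

/-- The facets of the surface glued from bodies along tubes according to `φ`. -/
def surfFacets : Set (Finset (SurfVertex n I)) :=
  {t | ∃ c i, ∃ k : BodyFacet n, t = k.verts.image (bodyMap φ c i)}

theorem bodyMap_false_tub (i : I) (s : Fin n) (l : Fin 3) :
    bodyMap φ false i (.tub s l) = .tub (i, s) l := rfl

theorem bodyMap_true_tub (i : I) (s : Fin n) (l : Fin 3) :
    bodyMap φ true i (.tub s l) = .tub (φ (i, s)) (cornerSwap l) := rfl

theorem image_mem_surfFacets (c : Bool) (i : I) (k : BodyFacet n) :
    k.verts.image (bodyMap φ c i) ∈ surfFacets φ := ⟨c, i, k, rfl⟩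

variable {φ}

theorem bodyMap_injective (hφ : Function.Involutive φ) (c : Bool) (i : I) :
    Function.Injective (bodyMap φ c i) := by
  have h : Function.Injective cornerSwap := Function.LeftInverse.injective cornerSwap_cornerSwap
  intro v w e
  cases c <;> cases v <;> cases w <;> simp_all [bodyMap, hφ.injective.eq_iff, h.eq_iff]

theorem card_of_mem_surfFacets (hφ : Function.Involutive φ) :
    ∀ t ∈ surfFacets φ, t.card = 3 := by
  rintro _ ⟨c, i, k, rfl⟩
  rw [Finset.card_image_of_injective _ (bodyMap_injective hφ c i), k.card_verts]

theorem exists_isLinkCycle_bodyMap (hφ : Function.Involutive φ) (c : Bool) (i : I)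
    {v : BodyVertex n} (hv : ∀ s l, v ≠ .tub s l)
    (h : ∃ m l, IsLinkCycle (range (BodyFacet.verts (n := n))) v m l) :
    ∃ m l, IsLinkCycle (surfFacets φ) (bodyMap φ c i v) m l := by
  obtain ⟨m, l, h⟩ := h
  refine ⟨m, _, h.map (bodyMap_injective hφ c i) ?_ ?_⟩
  · rintro _ ⟨k, rfl⟩
    exact ⟨c, i, k, rfl⟩
  · rintro _ ⟨c', i', k, rfl⟩ hk
    obtain ⟨w, hw, e⟩ := Finset.mem_image.1 hk
    have : c' = c ∧ i' = i := by
      cases c' <;> cases c <;> cases w <;> cases v <;> simp_all [bodyMap]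
    obtain ⟨rfl, rfl⟩ := this
    exact ⟨_, ⟨k, rfl⟩, rfl⟩

theorem exists_tub_mem_of_mem_image (hφ : Function.Involutive φ) {c : Bool} {i : I}
    {k : BodyFacet n} {e : I × Fin n} {l : Fin 3}
    (h : SurfVertex.tub e l ∈ k.verts.image (bodyMap φ c i)) :
    (c = false ∧ i = e.1 ∧ .tub e.2 l ∈ k.verts) ∨
      (c = true ∧ i = (φ e).1 ∧ .tub (φ e).2 (cornerSwap l) ∈ k.verts) := by
  obtain ⟨w, hw, hwe⟩ := Finset.mem_image.1 h
  cases w with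
  | tub s l' =>
    cases c
    · rw [bodyMap_false_tub] at hwe
      cases hwe
      exact Or.inl ⟨rfl, rfl, hw⟩
    · rw [bodyMap_true_tub] at hwe
      cases hwe
      refine Or.inr ⟨rfl, ?_, ?_⟩
      · rw [hφ]
      · rwa [hφ, cornerSwap_cornerSwap]
  | _ => simp [bodyMap] at hwe

theorem exists_isLinkCycle_tub (hφ : Function.Involutive φ) (e : I × Fin n) (l : Fin 3) :
    ∃ m c, IsLinkCycle (surfFacets φ) (.tub e l) m c := by
  obtain ⟨i, s⟩ := e
  obtain ⟨⟨j, t⟩, hij⟩ : ∃ f, φ (i, s) = f := ⟨_, rfl⟩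
  have hji : φ (j, t) = (i, s) := by rw [← hij, hφ]
  obtain rfl | rfl | rfl : l = 0 ∨ l = 1 ∨ l = 2 := by fin_cases l <;> simp
  · refine ⟨_, _, IsLinkCycle.of_list [.tub (i, s) 2, .rim false i s.castSucc,
      .rim false i s.succ, .tub (i, s) 1, .rim true j t.castSucc, .rim true j t.succ]
      (by simp) (by simp [Fin.ext_iff]) (by simp) ?_ ?_⟩
    · rintro _ ⟨c, i', k, rfl⟩ hk
      rcases exists_tub_mem_of_mem_image hφ hk with ⟨rfl, rfl, hk'⟩ | ⟨rfl, rfl, hk'⟩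
      · cases k with
        | rimLeft r =>
          obtain rfl : s = r := by simpa [BodyFacet.verts] using hk'
          exact ⟨0, by simp, by simp [BodyFacet.verts, bodyMap, Finset.subset_iff]⟩
        | tubBase r =>
          obtain rfl : s = r := by simpa [BodyFacet.verts] using hk'
          exact ⟨1, by simp, by simp [BodyFacet.verts, bodyMap, Finset.subset_iff]⟩
        | rimRight r =>
          obtain rfl : s = r := by simpa [BodyFacet.verts] using hk'
          exact ⟨2, by simp, by simp [BodyFacet.verts, bodyMap, Finset.subset_iff]⟩
        | _ => simp [BodyFacet.verts] at hk'
      · simp only [hij, cornerSwap_zero] at hk' ⊢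
        cases k with
        | rimLeft r =>
          obtain rfl : t = r := by simpa [BodyFacet.verts] using hk'
          exact ⟨3, by simp, by simp [BodyFacet.verts, bodyMap, Finset.subset_iff, hji, cornerSwap]⟩
        | tubBase r =>
          obtain rfl : t = r := by simpa [BodyFacet.verts] using hk'
          exact ⟨4, by simp, by simp [BodyFacet.verts, bodyMap, Finset.subset_iff, hji, cornerSwap]⟩
        | rimRight r =>
          obtain rfl : t = r := by simpa [BodyFacet.verts] using hk'
          exact ⟨5, by simp, by simp [BodyFacet.verts, bodyMap, Finset.subset_iff, hji, cornerSwap]⟩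
        | _ => simp [BodyFacet.verts] at hk'
    · intro r hr
      simp only [List.length_cons, List.length_nil] at hr
      interval_cases r
      · exact ⟨_, image_mem_surfFacets φ false i (.rimLeft s), by
          simp [BodyFacet.verts, bodyMap, Finset.subset_iff]⟩
      · exact ⟨_, image_mem_surfFacets φ false i (.tubBase s), by
          simp [BodyFacet.verts, bodyMap, Finset.subset_iff]⟩
      · exact ⟨_, image_mem_surfFacets φ false i (.rimRight s), by
          simp [BodyFacet.verts, bodyMap, Finset.subset_iff]⟩
      · exact ⟨_, image_mem_surfFacets φ true j (.rimLeft t), by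
          simp [BodyFacet.verts, bodyMap, Finset.subset_iff, hji, cornerSwap]⟩
      · exact ⟨_, image_mem_surfFacets φ true j (.tubBase t), by
          simp [BodyFacet.verts, bodyMap, Finset.subset_iff, hji, cornerSwap]⟩
      · exact ⟨_, image_mem_surfFacets φ true j (.rimRight t), by
          simp [BodyFacet.verts, bodyMap, Finset.subset_iff, hji, cornerSwap]⟩
  · refine ⟨_, _, IsLinkCycle.of_list [.tub (i, s) 2, .hub false i,
      .rim false i s.succ, .tub (i, s) 0, .rim true j t.castSucc, .hub true j]
      (by simp) (by simp) (by simp) ?_ ?_⟩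
    · rintro _ ⟨c, i', k, rfl⟩ hk
      rcases exists_tub_mem_of_mem_image hφ hk with ⟨rfl, rfl, hk'⟩ | ⟨rfl, rfl, hk'⟩
      · cases k with
        | hubSide r =>
          obtain rfl : s = r := by simpa [BodyFacet.verts] using hk'
          exact ⟨0, by simp, by simp [BodyFacet.verts, bodyMap, Finset.subset_iff]⟩
        | tubRight r =>
          obtain rfl : s = r := by simpa [BodyFacet.verts] using hk'
          exact ⟨1, by simp, by simp [BodyFacet.verts, bodyMap, Finset.subset_iff]⟩
        | rimRight r =>
          obtain rfl : s = r := by simpa [BodyFacet.verts] using hk'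
          exact ⟨2, by simp, by simp [BodyFacet.verts, bodyMap, Finset.subset_iff]⟩
        | _ => simp [BodyFacet.verts] at hk'
      · simp only [hij, cornerSwap_one] at hk' ⊢
        cases k with
        | rimLeft r =>
          obtain rfl : t = r := by simpa [BodyFacet.verts] using hk'
          exact ⟨3, by simp, by simp [BodyFacet.verts, bodyMap, Finset.subset_iff, hji, cornerSwap]⟩
        | tubLeft r =>
          obtain rfl : t = r := by simpa [BodyFacet.verts] using hk'
          exact ⟨4, by simp, by simp [BodyFacet.verts, bodyMap, Finset.subset_iff, hji, cornerSwap]⟩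
        | hubSide r =>
          obtain rfl : t = r := by simpa [BodyFacet.verts] using hk'
          exact ⟨5, by simp, by simp [BodyFacet.verts, bodyMap, Finset.subset_iff, hji, cornerSwap]⟩
        | _ => simp [BodyFacet.verts] at hk'
    · intro r hr
      simp only [List.length_cons, List.length_nil] at hr
      interval_cases r
      · exact ⟨_, image_mem_surfFacets φ false i (.hubSide s), by
          simp [BodyFacet.verts, bodyMap, Finset.subset_iff]⟩
      · exact ⟨_, image_mem_surfFacets φ false i (.tubRight s), by
          simp [BodyFacet.verts, bodyMap, Finset.subset_iff]⟩
      · exact ⟨_, image_mem_surfFacets φ false i (.rimRight s), by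
          simp [BodyFacet.verts, bodyMap, Finset.subset_iff]⟩
      · exact ⟨_, image_mem_surfFacets φ true j (.rimLeft t), by
          simp [BodyFacet.verts, bodyMap, Finset.subset_iff, hji, cornerSwap]⟩
      · exact ⟨_, image_mem_surfFacets φ true j (.tubLeft t), by
          simp [BodyFacet.verts, bodyMap, Finset.subset_iff, hji, cornerSwap]⟩
      · exact ⟨_, image_mem_surfFacets φ true j (.hubSide t), by
          simp [BodyFacet.verts, bodyMap, Finset.subset_iff, hji, cornerSwap]⟩
  · refine ⟨_, _, IsLinkCycle.of_list [.tub (i, s) 1, .hub false i,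
      .rim false i s.castSucc, .tub (i, s) 0, .rim true j t.succ, .hub true j]
      (by simp) (by simp) (by simp) ?_ ?_⟩
    · rintro _ ⟨c, i', k, rfl⟩ hk
      rcases exists_tub_mem_of_mem_image hφ hk with ⟨rfl, rfl, hk'⟩ | ⟨rfl, rfl, hk'⟩
      · cases k with
        | hubSide r =>
          obtain rfl : s = r := by simpa [BodyFacet.verts] using hk'
          exact ⟨0, by simp, by simp [BodyFacet.verts, bodyMap, Finset.subset_iff]⟩
        | tubLeft r =>
          obtain rfl : s = r := by simpa [BodyFacet.verts] using hk'
          exact ⟨1, by simp, by simp [BodyFacet.verts, bodyMap, Finset.subset_iff]⟩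
        | rimLeft r =>
          obtain rfl : s = r := by simpa [BodyFacet.verts] using hk'
          exact ⟨2, by simp, by simp [BodyFacet.verts, bodyMap, Finset.subset_iff]⟩
        | _ => simp [BodyFacet.verts] at hk'
      · simp only [hij, cornerSwap_two] at hk' ⊢
        cases k with
        | rimRight r =>
          obtain rfl : t = r := by simpa [BodyFacet.verts] using hk'
          exact ⟨3, by simp, by simp [BodyFacet.verts, bodyMap, Finset.subset_iff, hji, cornerSwap]⟩
        | tubRight r =>
          obtain rfl : t = r := by simpa [BodyFacet.verts] using hk'
          exact ⟨4, by simp, by simp [BodyFacet.verts, bodyMap, Finset.subset_iff, hji, cornerSwap]⟩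
        | hubSide r =>
          obtain rfl : t = r := by simpa [BodyFacet.verts] using hk'
          exact ⟨5, by simp, by simp [BodyFacet.verts, bodyMap, Finset.subset_iff, hji, cornerSwap]⟩
        | _ => simp [BodyFacet.verts] at hk'
    · intro r hr
      simp only [List.length_cons, List.length_nil] at hr
      interval_cases r
      · exact ⟨_, image_mem_surfFacets φ false i (.hubSide s), by
          simp [BodyFacet.verts, bodyMap, Finset.subset_iff]⟩
      · exact ⟨_, image_mem_surfFacets φ false i (.tubLeft s), by
          simp [BodyFacet.verts, bodyMap, Finset.subset_iff]⟩
      · exact ⟨_, image_mem_surfFacets φ false i (.rimLeft s), by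
          simp [BodyFacet.verts, bodyMap, Finset.subset_iff]⟩
      · exact ⟨_, image_mem_surfFacets φ true j (.rimRight t), by
          simp [BodyFacet.verts, bodyMap, Finset.subset_iff, hji, cornerSwap]⟩
      · exact ⟨_, image_mem_surfFacets φ true j (.tubRight t), by
          simp [BodyFacet.verts, bodyMap, Finset.subset_iff, hji, cornerSwap]⟩
      · exact ⟨_, image_mem_surfFacets φ true j (.hubSide t), by
          simp [BodyFacet.verts, bodyMap, Finset.subset_iff, hji, cornerSwap]⟩

/-- All vertex links of the surface are cycles. -/
theorem exists_isLinkCycle_surfFacets (hφ : Function.Involutive φ) (hn : 2 ≤ n)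
    (u : SurfVertex n I) : ∃ m c, IsLinkCycle (surfFacets φ) u m c := by
  have : NeZero n := ⟨by omega⟩
  cases u with
  | hub c i =>
    exact exists_isLinkCycle_bodyMap hφ c i (v := .hub) (by simp) ⟨_, _, BodyVertex.isLinkCycle_hub⟩
  | bot c i =>
    exact exists_isLinkCycle_bodyMap hφ c i (v := .bot) (by simp)
      ⟨_, _, BodyVertex.isLinkCycle_bot hn⟩
  | rim c i t =>
    exact exists_isLinkCycle_bodyMap hφ c i (v := .rim t) (by simp)
      (BodyVertex.exists_isLinkCycle_rim hn t)
  | tub e l => exact exists_isLinkCycle_tub hφ e l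

/-- Two bodies of different colour are joined by a tube. -/
def BodyAdj (φ : I × Fin n → I × Fin n) (β γ : Bool × I) : Prop :=
  γ.1 = !β.1 ∧ ∃ s, (φ (β.2, s)).1 = γ.2

theorem BodyAdj.symm (hφ : Function.Involutive φ) {β γ : Bool × I} (h : BodyAdj φ β γ) :
    BodyAdj φ γ β := by
  obtain ⟨h1, s, h2⟩ := h
  refine ⟨by simp [h1], (φ (β.2, s)).2, ?_⟩
  rw [← h2, Prod.mk.eta, hφ]

/-- Two vertices of a complex lie in a common facet. -/
def SharesFacet {V : Type*} (T : Set (Finset V)) (u v : V) : Prop := ∃ t ∈ T, u ∈ t ∧ v ∈ t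

theorem SharesFacet.symm {V : Type*} {T : Set (Finset V)} {u v : V} (h : SharesFacet T u v) :
    SharesFacet T v u := by
  obtain ⟨t, ht, h1, h2⟩ := h
  exact ⟨t, ht, h2, h1⟩

theorem reflTransGen_sharesFacet_hub (c : Bool) (i : I) (v : BodyVertex n) :
    Relation.ReflTransGen (SharesFacet (surfFacets φ)) (bodyMap φ c i v) (.hub c i) := by
  have key : ∀ k : BodyFacet n, ∀ v ∈ k.verts, ∀ w ∈ k.verts,
      SharesFacet (surfFacets φ) (bodyMap φ c i v) (bodyMap φ c i w) := fun k v hv w hw =>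
    ⟨_, image_mem_surfFacets φ c i k, Finset.mem_image_of_mem _ hv, Finset.mem_image_of_mem _ hw⟩
  cases v with
  | hub => exact Relation.ReflTransGen.refl
  | bot => exact .single (key .left .bot (by simp [BodyFacet.verts]) .hub (by simp [BodyFacet.verts]))
  | rim t =>
    rcases Fin.eq_zero_or_eq_succ t with rfl | ⟨s, rfl⟩
    · exact .single (key .left (.rim 0) (by simp [BodyFacet.verts]) .hub
        (by simp [BodyFacet.verts]))
    · exact .single (key (.tubRight s) (.rim s.succ) (by simp [BodyFacet.verts]) .hub
        (by simp [BodyFacet.verts]))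
  | tub s l =>
    refine .trans (.single (b := bodyMap φ c i (.tub s 1)) ?_)
      (.single (key (.tubRight s) (.tub s 1) (by simp [BodyFacet.verts]) .hub
        (by simp [BodyFacet.verts])))
    obtain rfl | rfl | rfl : l = 0 ∨ l = 1 ∨ l = 2 := by fin_cases l <;> simp
    · exact key (.rimRight s) _ (by simp [BodyFacet.verts]) _ (by simp [BodyFacet.verts])
    · exact key (.rimRight s) _ (by simp [BodyFacet.verts]) _ (by simp [BodyFacet.verts])
    · exact key (.hubSide s) _ (by simp [BodyFacet.verts]) _ (by simp [BodyFacet.verts])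

theorem reflTransGen_sharesFacet_of_bodyAdj (hφ : Function.Involutive φ) {β γ : Bool × I}
    (h : BodyAdj φ β γ) :
    Relation.ReflTransGen (SharesFacet (surfFacets φ)) (.hub β.1 β.2) (.hub γ.1 γ.2) := by
  have sym : Std.Symm (SharesFacet (surfFacets φ)) := ⟨fun _ _ h => h.symm⟩
  obtain ⟨c, i⟩ := β
  obtain ⟨c', j⟩ := γ
  obtain ⟨h1, s, h2⟩ := h
  simp only at h1 h2
  subst h1 h2
  have e : bodyMap φ c i (.tub s 0) = bodyMap φ (!c) (φ (i, s)).1 (.tub (φ (i, s)).2 0) := by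
    cases c <;> simp [bodyMap, hφ (i, s), cornerSwap]
  have h1 := reflTransGen_sharesFacet_hub (φ := φ) c i (.tub s 0)
  have h2 := reflTransGen_sharesFacet_hub (φ := φ) (!c) (φ (i, s)).1 (.tub (φ (i, s)).2 0)
  rw [← e] at h2
  exact (Relation.ReflTransGen.stdSymm.symm _ _ h1).trans h2

theorem reflTransGen_sharesFacet (hφ : Function.Involutive φ)
    (hconn : ∀ β γ, Relation.ReflTransGen (BodyAdj φ) β γ) (u v : SurfVertex n I) :
    Relation.ReflTransGen (SharesFacet (surfFacets φ)) u v := by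
  have sym : Std.Symm (SharesFacet (surfFacets φ)) := ⟨fun _ _ h => h.symm⟩
  have key : ∀ u : SurfVertex n I, ∃ c i,
      Relation.ReflTransGen (SharesFacet (surfFacets φ)) u (.hub c i) := by
    intro u
    cases u with
    | hub c i => exact ⟨c, i, .refl⟩
    | bot c i => exact ⟨c, i, reflTransGen_sharesFacet_hub c i .bot⟩
    | rim c i t => exact ⟨c, i, reflTransGen_sharesFacet_hub c i (.rim t)⟩
    | tub e l => exact ⟨false, e.1, reflTransGen_sharesFacet_hub false e.1 (.tub e.2 l)⟩
  obtain ⟨c, i, hu⟩ := key u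
  obtain ⟨c', i', hv⟩ := key v
  refine hu.trans (.trans ?_ (Relation.ReflTransGen.stdSymm.symm _ _ hv))
  have : ∀ β γ : Bool × I, Relation.ReflTransGen (BodyAdj φ) β γ →
      Relation.ReflTransGen (SharesFacet (surfFacets φ)) (.hub β.1 β.2) (.hub γ.1 γ.2) := by
    intro β γ h
    induction h with
    | refl => exact .refl
    | tail _ h ih => exact ih.trans (reflTransGen_sharesFacet_of_bodyAdj hφ h)
  exact this (c, i) (c', i') (hconn _ _)

end Surface

section Surface

variable {n : ℕ} {I : Type} (φ : I × Fin n → I × Fin n)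

/-- The tube at a slot of a body. -/
def slotTube (c : Bool) (i : I) (s : Fin n) : I × Fin n := bif c then φ (i, s) else (i, s)

/-- The body of the given colour at the end of a tube. -/
def tubEnd (c : Bool) (e : I × Fin n) : I := bif c then (φ e).1 else e.1

open Classical in
/-- The combinatorial distance from the hub of the body `β` to the vertices of the body `γ`
outside the tubes. -/
noncomputable def bodyDist (β γ : Bool × I) : ℝ :=
  if γ = β then 0 else if BodyAdj φ β γ then 2 else 3

open Classical in
/-- The combinatorial distance from the hub of the body `β` to the vertices of a tube. -/
noncomputable def tubDist (β : Bool × I) (e : I × Fin n) : ℝ :=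
  if tubEnd φ β.1 e = β.2 then 1 else 3

/-- The combinatorial distance from the hub of the body `β`, truncated at three. -/
noncomputable def surfDist (β : Bool × I) : SurfVertex n I → ℝ
  | .hub c i => bodyDist φ β (c, i)
  | .bot c i => bodyDist φ β (c, i)
  | .rim c i _ => bodyDist φ β (c, i)
  | .tub e _ => tubDist φ β e

/-- The indicator function of the tubes. -/
def tubIndicator : SurfVertex n I → ℝ
  | .tub _ _ => 1
  | _ => 0

variable {φ}

theorem tubEnd_slotTube (hφ : Function.Involutive φ) (c : Bool) (i : I) (s : Fin n) :
    tubEnd φ c (slotTube φ c i s) = i := by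
  cases c <;> simp [tubEnd, slotTube, hφ (i, s)]

theorem tubEnd_not_slotTube (c : Bool) (i : I) (s : Fin n) :
    tubEnd φ (!c) (slotTube φ c i s) = (φ (i, s)).1 := by
  cases c <;> simp [tubEnd, slotTube]

theorem bodyDist_self (β : Bool × I) : bodyDist φ β β = 0 := if_pos rfl

theorem BodyAdj.ne {β γ : Bool × I} (h : BodyAdj φ β γ) : γ ≠ β := by
  rintro rfl
  have := h.1
  simp at this

theorem BodyAdj.bodyDist {β γ : Bool × I} (h : BodyAdj φ β γ) : bodyDist φ β γ = 2 := by
  rw [_root_.bodyDist, if_neg h.ne, if_pos h]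

theorem bodyDist_of_not_bodyAdj {β γ : Bool × I} (h : γ ≠ β) (h' : ¬ BodyAdj φ β γ) :
    bodyDist φ β γ = 3 := by
  rw [bodyDist, if_neg h, if_neg h']

theorem tubDist_slotTube_self (hφ : Function.Involutive φ) (β : Bool × I) (s : Fin n) :
    tubDist φ β (slotTube φ β.1 β.2 s) = 1 := by
  rw [tubDist, tubEnd_slotTube hφ, if_pos rfl]

theorem tubDist_slotTube_of_bodyAdj {β γ : Bool × I} (h : BodyAdj φ β γ) (s : Fin n)
    (hs : (φ (γ.2, s)).1 ≠ β.2) : tubDist φ β (slotTube φ γ.1 γ.2 s) = 3 := by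
  have : β.1 = !γ.1 := by simp [h.1]
  rw [tubDist, this, tubEnd_not_slotTube, if_neg hs]

theorem tubDist_slotTube_of_not_bodyAdj (hφ : Function.Involutive φ) {β γ : Bool × I}
    (h : γ ≠ β) (h' : ¬ BodyAdj φ β γ) (s : Fin n) :
    tubDist φ β (slotTube φ γ.1 γ.2 s) = 3 := by
  rw [tubDist, if_neg]
  intro e
  by_cases hc : β.1 = γ.1
  · rw [hc, tubEnd_slotTube hφ] at e
    exact h (Prod.ext hc.symm e)
  · have hc : β.1 = !γ.1 := by revert hc; cases β.1 <;> cases γ.1 <;> simp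
    rw [hc, tubEnd_not_slotTube] at e
    exact h' (BodyAdj.symm hφ ⟨hc, s, e⟩)

theorem abs_bodyDist_sub_tubDist_le (hφ : Function.Involutive φ) (β γ : Bool × I) (s : Fin n) :
    |bodyDist φ β γ - tubDist φ β (slotTube φ γ.1 γ.2 s)| ≤ 1 := by
  by_cases h : γ = β
  · subst h
    rw [bodyDist_self, tubDist_slotTube_self hφ]
    norm_num
  by_cases h' : BodyAdj φ β γ
  · rw [h'.bodyDist, tubDist]
    split_ifs <;> norm_num
  · rw [bodyDist_of_not_bodyAdj h h', tubDist_slotTube_of_not_bodyAdj hφ h h']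
    norm_num

theorem surfDist_bodyMap_tub (β : Bool × I) (c : Bool) (i : I) (s : Fin n) (l : Fin 3) :
    surfDist φ β (bodyMap φ c i (.tub s l)) = tubDist φ β (slotTube φ c i s) := by
  cases c <;> rfl

theorem tubIndicator_bodyMap_tub (c : Bool) (i : I) (s : Fin n) (l : Fin 3) :
    tubIndicator (bodyMap φ c i (.tub s l)) = 1 := by
  cases c <;> rfl

theorem BodyFacet.exists_slot (hn : 0 < n) (k : BodyFacet n) :
    ∃ s, ∀ v ∈ k.verts, v = .hub ∨ v = .bot ∨ (∃ t, v = .rim t) ∨ ∃ l, v = .tub s l := by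
  cases k with
  | left => exact ⟨⟨0, hn⟩, by simp [verts]⟩
  | right => exact ⟨⟨0, hn⟩, by simp [verts]⟩
  | _ s => exact ⟨s, by simp [verts]⟩

theorem exists_slot_surfDist_eq (hn : 0 < n) (c : Bool) (i : I) (k : BodyFacet n) :
    ∃ s, ∀ u ∈ k.verts.image (bodyMap φ c i),
      (tubIndicator u = 0 ∧ ∀ β, surfDist φ β u = bodyDist φ β (c, i)) ∨
      (tubIndicator u = 1 ∧ ∀ β, surfDist φ β u = tubDist φ β (slotTube φ c i s)) := by
  obtain ⟨s, hs⟩ := k.exists_slot hn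
  refine ⟨s, fun u hu => ?_⟩
  obtain ⟨v, hv, rfl⟩ := Finset.mem_image.1 hu
  rcases hs v hv with rfl | rfl | ⟨t, rfl⟩ | ⟨l, rfl⟩
  · exact Or.inl ⟨rfl, fun _ => rfl⟩
  · exact Or.inl ⟨rfl, fun _ => rfl⟩
  · exact Or.inl ⟨rfl, fun _ => rfl⟩
  · exact Or.inr ⟨tubIndicator_bodyMap_tub .., fun β => surfDist_bodyMap_tub ..⟩

theorem abs_surfDist_sub_le (hφ : Function.Involutive φ) (hn : 0 < n) (β : Bool × I) :
    ∀ t ∈ surfFacets φ, ∀ u ∈ t, ∀ v ∈ t, |surfDist φ β u - surfDist φ β v| ≤ 1 := by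
  rintro _ ⟨c, i, k, rfl⟩ u hu v hv
  obtain ⟨s, hs⟩ := exists_slot_surfDist_eq (φ := φ) hn c i k
  have := abs_bodyDist_sub_tubDist_le hφ β (c, i) s
  rcases hs u hu with ⟨-, h⟩ | ⟨-, h⟩ <;> rcases hs v hv with ⟨-, h'⟩ | ⟨-, h'⟩ <;> rw [h, h']
  · simp
  · exact this
  · rwa [abs_sub_comm]
  · simp

variable [Fintype I]

theorem exists_sum_surfDist_mul_eq (hn : 0 < n) {w : SurfVertex n I → ℝ}
    (hw : w ∈ realization (surfFacets φ)) :
    ∃ (γ : Bool × I) (s : Fin n) (θ : ℝ), 0 ≤ θ ∧ θ ≤ 1 ∧ ∀ β, ∑ u, surfDist φ β u * w u =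
      (1 - θ) * bodyDist φ β γ + θ * tubDist φ β (slotTube φ γ.1 γ.2 s) := by
  obtain ⟨_, ⟨c, i, k, rfl⟩, h0, h1, h2⟩ := hw
  obtain ⟨s, hs⟩ := exists_slot_surfDist_eq (φ := φ) hn c i k
  have ht : ∀ u : SurfVertex n I, 0 ≤ tubIndicator u ∧ tubIndicator u ≤ 1 := by
    intro u
    cases u <;> simp [tubIndicator]
  refine ⟨(c, i), s, ∑ u, tubIndicator u * w u,
    Finset.sum_nonneg fun u _ => mul_nonneg (ht u).1 (h0 u), ?_, fun β => ?_⟩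
  · rw [← h1]
    exact Finset.sum_le_sum fun u _ => mul_le_of_le_one_left (h0 u) (ht u).2
  · have : ∀ u, surfDist φ β u * w u = bodyDist φ β (c, i) * w u +
        (tubDist φ β (slotTube φ c i s) - bodyDist φ β (c, i)) * (tubIndicator u * w u) := by
      intro u
      by_cases hu : u ∈ k.verts.image (bodyMap φ c i)
      · rcases hs u hu with ⟨h, h'⟩ | ⟨h, h'⟩ <;> rw [h, h'] <;> ring
      · rw [h2 u hu]; ring
    rw [Finset.sum_congr rfl fun u _ => this u, Finset.sum_add_distrib, ← Finset.mul_sum,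
      ← Finset.mul_sum, h1]
    ring

theorem sum_sq_single_sub_midpoint {V : Type*} [Fintype V] [DecidableEq V] {h a b : V}
    (ha : h ≠ a) (hb : h ≠ b) (hab : a ≠ b) :
    ∑ u, ((Pi.single h 1 : V → ℝ) u -
      ((1 / 2 : ℝ) • (Pi.single a 1 : V → ℝ) + (1 / 2 : ℝ) • (Pi.single b 1 : V → ℝ)) u) ^ 2 =
        3 / 2 := by
  have : ∀ u, ((Pi.single h 1 : V → ℝ) u -
      ((1 / 2 : ℝ) • (Pi.single a 1 : V → ℝ) + (1 / 2 : ℝ) • (Pi.single b 1 : V → ℝ)) u) ^ 2 =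
      (Pi.single h 1 : V → ℝ) u + 1 / 4 * (Pi.single a 1 : V → ℝ) u +
        1 / 4 * (Pi.single b 1 : V → ℝ) u := by
    intro u
    simp only [Pi.add_apply, Pi.smul_apply, smul_eq_mul, Pi.single_apply]
    split_ifs <;> simp_all <;> norm_num
  rw [Finset.sum_congr rfl fun u _ => this u]
  simp only [Finset.sum_add_distrib, ← Finset.mul_sum, Finset.sum_pi_single']
  simp
  norm_num

theorem single_hub_mem_realization (β : Bool × I) :
    Pi.single (SurfVertex.hub β.1 β.2) 1 ∈ realization (surfFacets φ) :=
  ⟨_, image_mem_surfFacets φ β.1 β.2 .left, single_mem_baryFace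
    (Finset.mem_image_of_mem (bodyMap φ β.1 β.2) (by simp [BodyFacet.verts] :
      BodyVertex.hub ∈ (BodyFacet.left (n := n)).verts))⟩

/-- The cop number of the surface exceeds `k` when every body has more than `k` neighbours
and no two bodies have two common neighbours. -/
theorem lt_copNumber_of_surfFacets (hφ : Function.Involutive φ) (hn : 0 < n) [Nonempty I] {k : ℕ}
    (hdeg : ∀ β, ∃ f : Fin (k + 1) → Bool × I, Function.Injective f ∧ ∀ j, BodyAdj φ β (f j))
    (hcyc : ∀ i i' s t s' t', (φ (i, s)).1 = (φ (i', t)).1 → (φ (i, s')).1 = (φ (i', t')).1 →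
      i = i' ∨ (φ (i, s)).1 = (φ (i, s')).1)
    {X : Type} [MetricSpace X] (e : X ≃ₜ realization (surfFacets φ))
    (hdist : ∀ x y, ∀ t ∈ surfFacets φ, (e x).1 ∈ baryFace t → (e y).1 ∈ baryFace t →
      dist x y ^ 2 = 1 / 2 * ∑ u, ((e x).1 u - (e y).1 u) ^ 2)
    (hlip : ∀ D : SurfVertex n I → ℝ, (∀ t ∈ surfFacets φ, ∀ u ∈ t, ∀ v ∈ t, |D u - D v| ≤ 1) →
      ∀ x y, ∑ u, D u * (e y).1 u - ∑ u, D u * (e x).1 u ≤ 2 / √3 * dist x y) :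
    (k : ℕ∞) < copNumber X (fun x y => dist x y) := by
  have h3 : 0 < √3 := by positivity
  have hs3 : √3 ^ 2 = 3 := Real.sq_sqrt (by norm_num)
  set st : Bool × I → X := fun β => e.symm ⟨_, single_hub_mem_realization β⟩ with hst
  have est : ∀ β, (e (st β)).1 = Pi.single (SurfVertex.hub β.1 β.2) 1 := fun β => by simp [hst]
  have hval : ∀ β γ, ∑ u, surfDist φ β u * (e (st γ)).1 u = bodyDist φ β γ := by
    intro β γ
    rw [est]
    simp [Pi.single_apply, surfDist]
  have hlip' := fun β => hlip (surfDist φ β) (abs_surfDist_sub_le hφ hn β)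
  have far : ∀ {β γ : Bool × I}, γ ≠ β → ¬ BodyAdj φ β γ → ∀ (s : Fin n) (θ : ℝ),
      (1 - θ) * bodyDist φ β γ + θ * tubDist φ β (slotTube φ γ.1 γ.2 s) = 3 := by
    intro β γ h h' s θ
    rw [bodyDist_of_not_bodyAdj h h', tubDist_slotTube_of_not_bodyAdj hφ h h']
    ring
  refine lt_copNumber_of_stations st (BodyAdj φ)
    (fun β x => ∑ u, surfDist φ β u * (e x).1 u) (L := √3) (M := 2) (δ := 1 / 3)
    (ε := √3 / 6) h3 (by positivity) ?_ ?_ ?_ ?_ hdeg ?_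
  · rintro ⟨c, i⟩ ⟨c', j⟩ ⟨h1, s, h2⟩
    simp only at h1 h2
    subst h1 h2
    have side : ∀ c i s, (e (st (c, i))).1 ∈
        baryFace ((BodyFacet.hubSide s).verts.image (bodyMap φ c i)) := by
      intro c i s
      rw [est]
      exact single_mem_baryFace (Finset.mem_image_of_mem (bodyMap φ c i)
        (by simp [BodyFacet.verts] : BodyVertex.hub ∈ (BodyFacet.hubSide s).verts))
    obtain ⟨a, b, hab, m1, m2⟩ : ∃ a b : SurfVertex n I, a ≠ b ∧
        (∀ c i, SurfVertex.hub c i ≠ a) ∧ (∀ c i, SurfVertex.hub c i ≠ b) ∧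
        ({a, b} : Set (SurfVertex n I)) ⊆ (BodyFacet.hubSide s).verts.image (bodyMap φ c i) ∧
        ({a, b} : Set (SurfVertex n I)) ⊆
          (BodyFacet.hubSide (φ (i, s)).2).verts.image (bodyMap φ (!c) (φ (i, s)).1) := by
      refine ⟨.tub (slotTube φ c i s) 1, .tub (slotTube φ c i s) 2, by simp, by simp, by simp, ?_⟩
      cases c <;> simp [BodyFacet.verts, bodyMap, slotTube, insert_subset_iff, hφ (i, s), cornerSwap]
    obtain ⟨m2, m3, m4⟩ := m2
    have mid : ∀ t : Finset (SurfVertex n I), ({a, b} : Set (SurfVertex n I)) ⊆ t →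
        (1 / 2 : ℝ) • (Pi.single a 1 : SurfVertex n I → ℝ) + (1 / 2 : ℝ) • Pi.single b 1 ∈
          baryFace t := fun t ht =>
      convex_baryFace t (single_mem_baryFace (ht (by simp))) (single_mem_baryFace (ht (by simp)))
        (by norm_num) (by norm_num) (by norm_num)
    obtain ⟨m, hm⟩ : ∃ m, (e m).1 =
        (1 / 2 : ℝ) • (Pi.single a 1 : SurfVertex n I → ℝ) + (1 / 2 : ℝ) • Pi.single b 1 :=
      ⟨e.symm ⟨_, _, image_mem_surfFacets φ c i (.hubSide s), mid _ m3⟩, by simp⟩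
    have half : ∀ c i s, ({a, b} : Set (SurfVertex n I)) ⊆
        (BodyFacet.hubSide s).verts.image (bodyMap φ c i) → dist (st (c, i)) m ≤ √3 / 2 := by
      intro c i s h
      have := hdist (st (c, i)) m _ (image_mem_surfFacets φ c i (.hubSide s)) (side c i s)
        (by rw [hm]; exact mid _ h)
      rw [est, hm, sum_sq_single_sub_midpoint (m1 _ _) (m2 _ _) hab] at this
      refine abs_le_of_sq_le_sq' ?_ (by positivity) |>.2
      rw [this, div_pow, hs3]
      norm_num
    have := dist_triangle_right (st (c, i)) (st (!c, (φ (i, s)).1)) m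
    linarith [half c i s m3, half _ _ _ m4]
  · intro β x y hxy
    have h1 := hlip' β y x
    have h2 : 2 / √3 * dist y x ≤ 2 := by
      rw [div_mul_eq_mul_div, div_le_iff₀ h3, dist_comm]
      linarith
    linarith
  · intro β x hx
    have h1 := hlip' β (st β) x
    rw [hval, bodyDist_self] at h1
    have h2 : 1 / 3 < 2 / √3 * dist (st β) x := by linarith
    rw [div_mul_eq_mul_div, lt_div_iff₀ h3] at h2
    linarith
  · intro β x w₁ w₂ hx ha₁ ha₂ hw₁ hw₂
    obtain ⟨γ, s, θ, hθ0, hθ1, hγ⟩ := exists_sum_surfDist_mul_eq hn (e x).2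
    simp only [hγ] at hx hw₁ hw₂
    by_contra hne
    have near : ∀ w : Bool × I, BodyAdj φ β w →
        (1 - θ) * bodyDist φ w γ + θ * tubDist φ w (slotTube φ γ.1 γ.2 s) ≤ 2 + 1 / 3 →
        γ = w ∨ BodyAdj φ w γ := by
      intro w _ h
      by_contra hc
      push Not at hc
      rw [far hc.1 hc.2] at h
      norm_num at h
    have n₁ := near w₁ ha₁ hw₁
    have n₂ := near w₂ ha₂ hw₂
    have hcol : w₁.1 = w₂.1 := by rw [ha₁.1, ha₂.1]
    have hne2 : w₁.2 ≠ w₂.2 := fun h => hne (Prod.ext hcol h)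
    have b₁ : BodyAdj φ w₁ γ := by
      rcases n₁ with rfl | h
      · rcases n₂ with h | h
        · exact absurd h hne
        · have := h.1
          rw [hcol] at this
          simp at this
      · exact h
    have b₂ : BodyAdj φ w₂ γ := by
      rcases n₂ with rfl | h
      · have := b₁.1
        rw [hcol] at this
        simp at this
      · exact h
    by_cases hγβ : γ = β
    · subst hγβ
      rw [bodyDist_self, tubDist_slotTube_self hφ] at hx
      by_cases hs : (φ (γ.2, s)).1 = w₁.2
      · rw [b₂.bodyDist, tubDist_slotTube_of_bodyAdj b₂ s (by rw [hs]; exact hne2)] at hw₂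
        linarith
      · rw [b₁.bodyDist, tubDist_slotTube_of_bodyAdj b₁ s hs] at hw₁
        linarith
    · obtain ⟨g₁, s₁, e₁⟩ := ha₁
      obtain ⟨-, s₂, e₂⟩ := ha₂
      obtain ⟨c₁, t₁, f₁⟩ := b₁.symm hφ
      obtain ⟨-, t₂, f₂⟩ := b₂.symm hφ
      rcases hcyc β.2 γ.2 s₁ t₁ s₂ t₂ (by rw [e₁, f₁]) (by rw [e₂, f₂]) with h | h
      · refine hγβ (Prod.ext ?_ h.symm)
        rw [b₁.1, g₁, Bool.not_not]
      · rw [e₁, e₂] at h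
        exact hne2 h
  · obtain ⟨i⟩ := ‹Nonempty I›
    obtain ⟨f, -, hf⟩ := hdeg (false, i)
    refine ⟨(false, i), st (f 0), ?_⟩
    rw [hval, (hf 0).bodyDist]
    norm_num

end Surface

section Separation

variable {V : Type*} [Fintype V] {w w' : V → ℝ}

/-- Two weights which a function separates weakly, and whose integrals of that function agree, are
both supported on its zero set. -/
theorem eq_zero_of_sum_mul_eq {g : V → ℝ} (hw : ∀ v, 0 ≤ w v) (hw' : ∀ v, 0 ≤ w' v)
    (h : ∑ v, w v * g v = ∑ v, w' v * g v) (hg : ∀ v, w v ≠ 0 → 0 ≤ g v)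
    (hg' : ∀ v, w' v ≠ 0 → g v ≤ 0) :
    (∀ v, w v ≠ 0 → g v = 0) ∧ ∀ v, w' v ≠ 0 → g v = 0 := by
  have h₁ : ∀ v ∈ Finset.univ, 0 ≤ w v * g v := fun v _ => by
    by_cases hv : w v = 0
    · simp [hv]
    · exact mul_nonneg (hw v) (hg v hv)
  have h₂ : ∀ v ∈ Finset.univ, w' v * g v ≤ 0 := fun v _ => by
    by_cases hv : w' v = 0
    · simp [hv]
    · exact mul_nonpos_of_nonneg_of_nonpos (hw' v) (hg' v hv)
  have h₃ := Finset.sum_nonneg h₁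
  have h₄ := Finset.sum_nonpos h₂
  constructor <;> intro v hv
  · have := (Finset.sum_eq_zero_iff_of_nonneg h₁).1 (by linarith) v (Finset.mem_univ v)
    exact (mul_eq_zero.1 this).resolve_left hv
  · have := (Finset.sum_eq_zero_iff_of_nonpos h₂).1 (by linarith) v (Finset.mem_univ v)
    exact (mul_eq_zero.1 this).resolve_left hv

/-- Weights supported on three affinely independent points are determined by their barycentre. -/
theorem eq_of_sum_eq_of_support_subset [DecidableEq V] {p q : V → ℝ} {a b c : V} (hab : a ≠ b)
    (hac : a ≠ c) (hbc : b ≠ c) (h1 : ∑ v, w v = ∑ v, w' v)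
    (hp : ∑ v, w v * p v = ∑ v, w' v * p v) (hq : ∑ v, w v * q v = ∑ v, w' v * q v)
    (hs : ∀ v, v ≠ a → v ≠ b → v ≠ c → w v = w' v)
    (hdet : (p b - p a) * (q c - q a) - (p c - p a) * (q b - q a) ≠ 0) : w = w' := by
  have key : ∀ f : V → ℝ, ∑ v, w v * f v = ∑ v, w' v * f v →
      (w a - w' a) * f a + (w b - w' b) * f b + (w c - w' c) * f c = 0 := by
    intro f hf
    have h0 : ∑ v, (w v - w' v) * f v = 0 := by
      simp only [sub_mul, Finset.sum_sub_distrib, hf, sub_self]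
    rw [← Finset.sum_subset (Finset.subset_univ {a, b, c})] at h0
    · rw [Finset.sum_insert (by simp [hab, hac]), Finset.sum_insert (by simp [hbc]),
        Finset.sum_singleton] at h0
      linarith
    · intro v _ hv
      simp only [Finset.mem_insert, Finset.mem_singleton, not_or] at hv
      rw [hs v hv.1 hv.2.1 hv.2.2, sub_self, zero_mul]
  have e1 := key (fun _ => 1) (by simpa using h1)
  have e2 := key p hp
  have e3 := key q hq
  have hb : w b - w' b = 0 := by
    refine (mul_eq_zero.1 (?_ : (w b - w' b) * _ = 0)).resolve_right hdet
    linear_combination (q c - q a) * (e2 - p a * e1) - (p c - p a) * (e3 - q a * e1)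
  have hc : w c - w' c = 0 := by
    refine (mul_eq_zero.1 (?_ : (w c - w' c) * _ = 0)).resolve_right hdet
    linear_combination -(q b - q a) * (e2 - p a * e1) + (p b - p a) * (e3 - q a * e1)
  have ha : w a - w' a = 0 := by linarith
  funext v
  by_cases h₁ : v = a
  · subst h₁; linarith
  by_cases h₂ : v = b
  · subst h₂; linarith
  by_cases h₃ : v = c
  · subst h₃; linarith
  exact hs v h₁ h₂ h₃

/-- Points of two faces with the same image under an affine map agree if the two faces meet, at
most, in a nondegenerate triangle. -/
theorem eq_of_affine_separation [DecidableEq V] {t t' : Finset V} {x y z : V → ℝ}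
    (hw : w ∈ baryFace t) (hw' : w' ∈ baryFace t')
    (hx : ∑ v, w v * x v = ∑ v, w' v * x v) (hy : ∑ v, w v * y v = ∑ v, w' v * y v)
    (hz : ∑ v, w v * z v = ∑ v, w' v * z v) (A B C D : ℝ)
    (hg : ∀ v ∈ t, 0 ≤ A + B * x v + C * y v + D * z v)
    (hg' : ∀ v ∈ t', A + B * x v + C * y v + D * z v ≤ 0) (a b c : V)
    (hab : a ≠ b) (hac : a ≠ c) (hbc : b ≠ c)
    (h0 : ∀ v, v ∈ t ∨ v ∈ t' → A + B * x v + C * y v + D * z v = 0 → v = a ∨ v = b ∨ v = c)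
    (hdet : (x b - x a) * (y c - y a) - (x c - x a) * (y b - y a) ≠ 0 ∨
      (x b - x a) * (z c - z a) - (x c - x a) * (z b - z a) ≠ 0 ∨
      (y b - y a) * (z c - z a) - (y c - y a) * (z b - z a) ≠ 0) : w = w' := by
  obtain ⟨p, s, u⟩ := hw
  obtain ⟨p', s', u'⟩ := hw'
  have ht : ∀ v, w v ≠ 0 → v ∈ t := fun v h => by_contra fun hv => h (u v hv)
  have ht' : ∀ v, w' v ≠ 0 → v ∈ t' := fun v h => by_contra fun hv => h (u' v hv)
  have key : ∀ r : V → ℝ, ∑ v, r v * (A + B * x v + C * y v + D * z v) = A * ∑ v, r v +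
      B * ∑ v, r v * x v + C * ∑ v, r v * y v + D * ∑ v, r v * z v := by
    intro r
    simp only [Finset.mul_sum, ← Finset.sum_add_distrib]
    exact Finset.sum_congr rfl fun v _ => by ring
  obtain ⟨k, k'⟩ := eq_zero_of_sum_mul_eq (g := fun v => A + B * x v + C * y v + D * z v) p p'
    (by rw [key, key, hx, hy, hz, s, s']) (fun v h => hg v (ht v h)) (fun v h => hg' v (ht' v h))
  have hs : ∀ v, v ≠ a → v ≠ b → v ≠ c → w v = w' v := by
    intro v h₁ h₂ h₃
    have e : w v = 0 := by
      by_contra h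
      have := h0 v (Or.inl (ht v h)) (k v h)
      tauto
    have e' : w' v = 0 := by
      by_contra h
      have := h0 v (Or.inr (ht' v h)) (k' v h)
      tauto
    rw [e, e']
  have h1 : ∑ v, w v = ∑ v, w' v := s.trans s'.symm
  rcases hdet with h | h | h
  · exact eq_of_sum_eq_of_support_subset hab hac hbc h1 hx hy hs h
  · exact eq_of_sum_eq_of_support_subset hab hac hbc h1 hx hz hs h
  · exact eq_of_sum_eq_of_support_subset hab hac hbc h1 hy hz hs h

end Separation

/-- The numerical data of a position of a body in space. -/
structure BodyShape (n : ℕ) where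
  (ρ : Fin (n + 1) → ℝ)
  (o : Fin n → ℝ)
  (h R K : ℝ)
  R_pos : 0 < R
  one_lt_K : 1 < K
  K_add_one_lt : K + 1 < R
  strictMono : StrictMono ρ
  lt_h : ∀ t, ρ t < h
  h_sub_lt : ∀ t, h - ρ t < K * R
  mul_h_sub_lt : ∀ t, (K + 1) * (h - ρ t) < R * R
  castSucc_add_le : ∀ s, ρ s.castSucc + R ≤ o s
  add_le_succ : ∀ s, o s + R ≤ ρ s.succ

namespace BodyShape

variable {n : ℕ} (P : BodyShape n)

/-- The first coordinate of a corner of a tube, relative to the tube. -/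
def corner (K : ℝ) : Fin 3 → ℝ := ![1, 1 + K, 2]

/-- The first coordinate of a vertex of a body. -/
def x : BodyVertex n → ℝ
  | .hub => P.h
  | .bot => P.h
  | .rim t => P.ρ t
  | .tub s l => P.o s + corner P.K l

/-- The second coordinate of a vertex of a body. -/
def y : BodyVertex n → ℝ
  | .hub => P.R
  | .bot => P.R
  | .rim _ => 0
  | .tub _ l => corner P.K (cornerSwap l)

/-- The third coordinate of a vertex of a body. -/
def z : BodyVertex n → ℝ
  | .hub => -1
  | .bot => -2
  | .rim _ => -1
  | .tub _ _ => 0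

theorem one_le_corner (l : Fin 3) : 1 ≤ corner P.K l := by
  have := P.one_lt_K
  fin_cases l <;> simp [corner]
  linarith

theorem corner_le (l : Fin 3) : corner P.K l ≤ P.K + 1 := by
  have := P.one_lt_K
  fin_cases l <;> simp [corner] <;> linarith

/-- The first index of a rim vertex of a facet. -/
def lo : BodyFacet n → ℕ
  | .left => 0
  | .right => n
  | .base s | .hubSide s | .rimLeft s | .rimRight s | .tubBase s | .tubRight s | .tubLeft s => s

/-- The last index of a rim vertex of a facet. -/
def hi : BodyFacet n → ℕ
  | .left => 0
  | .right => n
  | .base s | .hubSide s | .rimLeft s | .rimRight s | .tubBase s | .tubRight s | .tubLeft s => s + 1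

theorem lo_le (k : BodyFacet n) : lo k ≤ n := by
  cases k <;> simp only [lo] <;> omega

theorem rim_mem {k : BodyFacet n} {t : Fin (n + 1)} (h : .rim t ∈ k.verts) :
    lo k ≤ t ∧ t ≤ hi k := by
  cases k <;> simp [BodyFacet.verts] at h <;> simp only [lo, hi] <;> grind

theorem tub_mem {k : BodyFacet n} {s : Fin n} {l : Fin 3} (h : .tub s l ∈ k.verts) :
    lo k = s ∧ hi k = s + 1 := by
  cases k <;> simp [BodyFacet.verts] at h <;> simp only [lo, hi] <;> grind

variable {w w' : BodyVertex n → ℝ} {k k' : BodyFacet n}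

theorem eq_of_hi_le_lo (hw : w ∈ baryFace k.verts) (hw' : w' ∈ baryFace k'.verts)
    (hx : ∑ v, w v * P.x v = ∑ v, w' v * P.x v) (hy : ∑ v, w v * P.y v = ∑ v, w' v * P.y v)
    (hz : ∑ v, w v * z v = ∑ v, w' v * z v) (hk : hi k' ≤ lo k) : w = w' := by
  obtain ⟨t, ht⟩ : ∃ t : Fin (n + 1), (t : ℕ) = lo k := ⟨⟨lo k, by have := lo_le k; omega⟩, rfl⟩
  have hR := P.R_pos
  have hh := P.lt_h t
  have above : ∀ r : Fin (n + 1), t < r → 0 < (P.ρ r - P.ρ t) * P.R := fun r hr =>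
    mul_pos (sub_pos.2 (P.strictMono hr)) hR
  have below : ∀ r : Fin (n + 1), r < t → (P.ρ r - P.ρ t) * P.R < 0 := fun r hr =>
    mul_neg_of_neg_of_pos (sub_neg.2 (P.strictMono hr)) hR
  have g : ∀ v : BodyVertex n, -P.ρ t * P.R + P.R * P.x v + -(P.h - P.ρ t) * P.y v + 0 * z v =
      (P.x v - P.ρ t) * P.R - P.y v * (P.h - P.ρ t) := fun v => by ring
  have tabove : ∀ (s : Fin n) (l : Fin 3), (t : ℕ) ≤ s →
      0 < (P.x (.tub s l) - P.ρ t) * P.R - P.y (.tub s l) * (P.h - P.ρ t) := by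
    intro s l hs
    have h1 := P.castSucc_add_le s
    have h2 : P.ρ t ≤ P.ρ s.castSucc := P.strictMono.monotone (by simpa [Fin.le_def] using hs)
    have h3 := P.mul_h_sub_lt t
    have h4 : P.y (.tub s l) * (P.h - P.ρ t) ≤ (P.K + 1) * (P.h - P.ρ t) :=
      mul_le_mul_of_nonneg_right (P.corner_le _) (by linarith)
    have h5 : P.R * P.R ≤ (P.x (.tub s l) - P.ρ t) * P.R := by
      refine mul_le_mul_of_nonneg_right ?_ hR.le
      have := P.one_le_corner l
      simp only [x]
      linarith
    linarith
  have tbelow : ∀ (s : Fin n) (l : Fin 3), (s : ℕ) < t →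
      (P.x (.tub s l) - P.ρ t) * P.R - P.y (.tub s l) * (P.h - P.ρ t) < 0 := by
    intro s l hs
    have h1 := P.add_le_succ s
    have h2 : P.ρ s.succ ≤ P.ρ t := P.strictMono.monotone (by simp [Fin.le_def]; omega)
    have h4 : 0 < P.y (.tub s l) * (P.h - P.ρ t) :=
      mul_pos (by have := P.one_le_corner (cornerSwap l); simp only [y]; linarith) (by linarith)
    have h5 : (P.x (.tub s l) - P.ρ t) * P.R ≤ 0 := by
      refine mul_nonpos_of_nonpos_of_nonneg ?_ hR.le
      have := P.corner_le l
      have := P.K_add_one_lt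
      simp only [x]
      linarith
    linarith
  refine eq_of_affine_separation hw hw' hx hy hz (-P.ρ t * P.R) P.R (-(P.h - P.ρ t)) 0 ?_ ?_
    .hub .bot (.rim t) (by simp) (by simp) (by simp) ?_ (Or.inr (Or.inr ?_))
  · intro v hv
    rw [g]
    rcases v with _ | _ | r | ⟨s, l⟩
    · simp only [x, y]; nlinarith
    · simp only [x, y]; nlinarith
    · have := (rim_mem hv).1
      rcases eq_or_ne t r with rfl | hne
      · simp [x, y]
      · have := above r (by have := Fin.val_ne_of_ne hne; rw [Fin.lt_def]; omega)
        simp only [x, y]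
        linarith
    · exact (tabove s l (by have := tub_mem hv; omega)).le
  · intro v hv
    rw [g]
    rcases v with _ | _ | r | ⟨s, l⟩
    · simp only [x, y]; nlinarith
    · simp only [x, y]; nlinarith
    · have := (rim_mem hv).2
      rcases eq_or_ne t r with rfl | hne
      · simp [x, y]
      · have := below r (by have := Fin.val_ne_of_ne hne; rw [Fin.lt_def]; omega)
        simp only [x, y]
        linarith
    · exact (tbelow s l (by have := tub_mem hv; omega)).le
  · intro v _ h
    rw [g] at h
    rcases v with _ | _ | r | ⟨s, l⟩
    · simp
    · simp
    · rcases lt_trichotomy t r with hr | rfl | hr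
      · have := above r hr
        simp only [x, y] at h
        linarith
      · simp
      · have := below r hr
        simp only [x, y] at h
        linarith
    · rcases le_or_gt (t : ℕ) s with hs | hs
      · exact absurd h (tabove s l hs).ne'
      · exact absurd h (tbelow s l hs).ne
  · simp only [y, z]
    nlinarith

end BodyShape

namespace BodyShape

variable {n : ℕ} (P : BodyShape n)

/-- The slot of a facet that is adjacent to a tube or to a hub and a tube. -/
def topSlot : BodyFacet n → Option (Fin n)
  | .left | .right | .base _ => none
  | .hubSide s | .rimLeft s | .rimRight s | .tubBase s | .tubRight s | .tubLeft s => some s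

/-- The vertices of the facets around a tube. -/
noncomputable def topVerts (s : Fin n) : Finset (BodyVertex n) :=
  {.hub, .rim s.castSucc, .rim s.succ, .tub s 0, .tub s 1, .tub s 2}

theorem verts_subset_topVerts {k : BodyFacet n} {s : Fin n} (h : topSlot k = some s) :
    k.verts ⊆ topVerts s := by
  cases k <;> simp [topSlot] at h <;> subst h <;> intro v <;>
    simp only [BodyFacet.verts, topVerts, Finset.mem_insert, Finset.mem_singleton] <;> tauto

theorem exists_affine_support {k : BodyFacet n} {s : Fin n} (h : topSlot k = some s) :
    ∃ (A B C D : ℝ) (a b c : BodyVertex n), a ≠ b ∧ a ≠ c ∧ b ≠ c ∧ k.verts = {a, b, c} ∧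
      (∀ v ∈ topVerts s, (v ∈ k.verts ∧ A + B * P.x v + C * P.y v + D * z v = 0) ∨
        (v ∉ k.verts ∧ 0 < A + B * P.x v + C * P.y v + D * z v)) ∧
      (P.x b - P.x a) * (z c - z a) - (P.x c - P.x a) * (z b - z a) ≠ 0 := by
  have h1 := P.castSucc_add_le s
  have h2 := P.add_le_succ s
  have h3 := P.lt_h s.succ
  have h4 := P.h_sub_lt s.succ
  have h5 := P.one_lt_K
  have h6 := P.K_add_one_lt
  have hR := P.R_pos
  have m1 : 0 < P.R * (P.ρ s.succ - P.ρ s.castSucc) := mul_pos hR (by linarith)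
  have m2 : 0 < (P.K - 1) * (P.R + (P.h - P.ρ s.succ)) := mul_pos (by linarith) (by linarith)
  have m3 : 0 < (P.K - 1) * (P.h - P.ρ s.castSucc) := mul_pos (by linarith) (by linarith)
  have m4 : 0 < (P.K - 1) * P.R := mul_pos (by linarith) (by linarith)
  have m5 : 0 < (P.K - 1) * (P.K + 1) := mul_pos (by linarith) (by linarith)
  have m6 : 0 < P.K * (P.ρ s.succ - P.ρ s.castSucc) := mul_pos (by linarith) (by linarith)
  have key : ∀ (M N ν μ : ℝ) (a b c : BodyVertex n), k.verts = {a, b, c} →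
      (∀ v ∈ topVerts s, ((v = a ∨ v = b ∨ v = c) ∧
          M * -z v + N * (1 + z v) - ν * (P.x v - P.o s) - μ * P.y v = 0) ∨
        (¬(v = a ∨ v = b ∨ v = c) ∧
          0 < M * -z v + N * (1 + z v) - ν * (P.x v - P.o s) - μ * P.y v)) →
      (P.x b - P.x a) * (z c - z a) - (P.x c - P.x a) * (z b - z a) ≠ 0 →
      ∃ (A B C D : ℝ) (a b c : BodyVertex n), a ≠ b ∧ a ≠ c ∧ b ≠ c ∧ k.verts = {a, b, c} ∧
        (∀ v ∈ topVerts s, (v ∈ k.verts ∧ A + B * P.x v + C * P.y v + D * z v = 0) ∨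
          (v ∉ k.verts ∧ 0 < A + B * P.x v + C * P.y v + D * z v)) ∧
        (P.x b - P.x a) * (z c - z a) - (P.x c - P.x a) * (z b - z a) ≠ 0 := by
    intro M N ν μ a b c hk hv hd
    have hc := k.card_verts
    rw [hk] at hc
    refine ⟨N + ν * P.o s, -ν, -μ, N - M, a, b, c, ?_, ?_, ?_, hk, fun v hvs => ?_, hd⟩
    · rintro rfl
      rw [Finset.insert_eq_of_mem (by simp)] at hc
      have := Finset.card_le_two (a := a) (b := c)
      omega
    · rintro rfl
      rw [Finset.insert_eq_of_mem (by simp)] at hc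
      have := Finset.card_le_two (a := b) (b := a)
      omega
    · rintro rfl
      rw [Finset.pair_eq_singleton] at hc
      have := Finset.card_le_two (a := a) (b := b)
      omega
    · have e : N + ν * P.o s + -ν * P.x v + -μ * P.y v + (N - M) * z v =
          M * -z v + N * (1 + z v) - ν * (P.x v - P.o s) - μ * P.y v := by ring
      rw [e, hk]
      simpa using hv v hvs
  have all : ∀ p : BodyVertex n → Prop, p .hub → p (.rim s.castSucc) → p (.rim s.succ) →
      p (.tub s 0) → p (.tub s 1) → p (.tub s 2) → ∀ v ∈ topVerts s, p v := by
    intro p _ _ _ _ _ _ v hv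
    simp only [topVerts, Finset.mem_insert, Finset.mem_singleton] at hv
    rcases hv with rfl | rfl | rfl | rfl | rfl | rfl <;> assumption
  cases k <;> simp only [topSlot, reduceCtorEq, Option.some.injEq] at h <;> subst h
  case hubSide s =>
    refine key (P.h - P.o s + P.R) (P.K + 3) 1 1 _ _ _ rfl ?_ ?_
    · refine all _ ?_ ?_ ?_ ?_ ?_ ?_ <;>
        first
        | (refine Or.inr ⟨by simp [Fin.ext_iff], ?_⟩; simp [x, y, z, corner, cornerSwap]; done)
        | (refine Or.inr ⟨by simp [Fin.ext_iff], ?_⟩; simp [x, y, z, corner, cornerSwap]; linarith)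
        | (refine Or.inl ⟨by simp, ?_⟩; simp [x, y, z, corner, cornerSwap]; done)
        | (refine Or.inl ⟨by simp, ?_⟩; simp [x, y, z, corner, cornerSwap]; ring)
    · simp only [x, z, corner, Matrix.cons_val]
      intro h
      linarith
  case rimLeft s =>
    refine key (P.K * (P.o s - P.ρ s.castSucc)) (1 - P.K) (-P.K) 1 _ _ _ rfl ?_ ?_
    · refine all _ ?_ ?_ ?_ ?_ ?_ ?_ <;>
        first
        | (refine Or.inr ⟨by simp [Fin.ext_iff], ?_⟩; simp [x, y, z, corner, cornerSwap]; done)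
        | (refine Or.inr ⟨by simp [Fin.ext_iff], ?_⟩; simp [x, y, z, corner, cornerSwap]; linarith)
        | (refine Or.inl ⟨by simp, ?_⟩; simp [x, y, z, corner, cornerSwap]; done)
        | (refine Or.inl ⟨by simp, ?_⟩; simp [x, y, z, corner, cornerSwap]; ring)
    · simp only [x, z, corner, Matrix.cons_val]
      intro h
      linarith
  case rimRight s =>
    refine key (P.ρ s.succ - P.o s) (1 - P.K) 1 (-P.K) _ _ _ rfl ?_ ?_
    · refine all _ ?_ ?_ ?_ ?_ ?_ ?_ <;>
        first
        | (refine Or.inr ⟨by simp [Fin.ext_iff], ?_⟩; simp [x, y, z, corner, cornerSwap]; done)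
        | (refine Or.inr ⟨by simp [Fin.ext_iff], ?_⟩; simp [x, y, z, corner, cornerSwap]; linarith)
        | (refine Or.inl ⟨by simp, ?_⟩; simp [x, y, z, corner, cornerSwap]; done)
        | (refine Or.inl ⟨by simp, ?_⟩; simp [x, y, z, corner, cornerSwap]; ring)
    · simp only [x, z, corner, Matrix.cons_val]
      intro h
      linarith
  case tubBase s =>
    refine key 0 (-1) 0 (-1) _ _ _ rfl ?_ ?_
    · refine all _ ?_ ?_ ?_ ?_ ?_ ?_ <;>
        first
        | (refine Or.inr ⟨by simp [Fin.ext_iff], ?_⟩; simp [x, y, z, corner, cornerSwap]; done)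
        | (refine Or.inr ⟨by simp [Fin.ext_iff], ?_⟩; simp [x, y, z, corner, cornerSwap]; linarith)
        | (refine Or.inl ⟨by simp, ?_⟩; simp [x, y, z, corner, cornerSwap])
    · simp only [x, z, corner, Matrix.cons_val]
      intro h
      linarith
  case tubRight s =>
    refine key (P.R * (P.ρ s.succ - P.o s)) (P.R * (1 + P.K) + 2 * (P.ρ s.succ - P.h)) P.R
      (P.ρ s.succ - P.h) _ _ _ rfl ?_ ?_
    · refine all _ ?_ ?_ ?_ ?_ ?_ ?_ <;>
        first
        | (refine Or.inr ⟨by simp [Fin.ext_iff], ?_⟩; simp [x, y, z, corner, cornerSwap]; done)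
        | (refine Or.inr ⟨by simp [Fin.ext_iff], ?_⟩; simp [x, y, z, corner, cornerSwap]; linarith)
        | (refine Or.inl ⟨by simp, ?_⟩; simp [x, y, z, corner, cornerSwap]; done)
        | (refine Or.inl ⟨by simp, ?_⟩; simp [x, y, z, corner, cornerSwap]; ring)
    · simp only [x, z, corner, Matrix.cons_val]
      intro h
      linarith
  case tubLeft s =>
    refine key (P.R * (P.o s - P.ρ s.castSucc))
      (-2 * P.R + (1 + P.K) * (P.h - P.ρ s.castSucc)) (-P.R) (P.h - P.ρ s.castSucc) _ _ _ rfl ?_ ?_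
    · refine all _ ?_ ?_ ?_ ?_ ?_ ?_ <;>
        first
        | (refine Or.inr ⟨by simp [Fin.ext_iff], ?_⟩; simp [x, y, z, corner, cornerSwap]; done)
        | (refine Or.inr ⟨by simp [Fin.ext_iff], ?_⟩; simp [x, y, z, corner, cornerSwap]; linarith)
        | (refine Or.inl ⟨by simp, ?_⟩; simp [x, y, z, corner, cornerSwap]; done)
        | (refine Or.inl ⟨by simp, ?_⟩; simp [x, y, z, corner, cornerSwap]; ring)
    · simp only [x, z, corner, Matrix.cons_val]
      intro h
      linarith

end BodyShape

namespace BodyShape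

variable {n : ℕ} (P : BodyShape n) {w w' : BodyVertex n → ℝ} {k k' : BodyFacet n}

theorem lo_eq_hi_or (k : BodyFacet n) : lo k = hi k ∨
    ∃ s : Fin n, lo k = s ∧ hi k = s + 1 ∧ (k = .base s ∨ topSlot k = some s) := by
  cases k with
  | left => exact Or.inl rfl
  | right => exact Or.inl rfl
  | base s => exact Or.inr ⟨s, rfl, rfl, Or.inl rfl⟩
  | _ s => exact Or.inr ⟨s, rfl, rfl, Or.inr rfl⟩

theorem eq_of_base_top {s : Fin n} (h : topSlot k' = some s)
    (hw : w ∈ baryFace (BodyFacet.base s).verts) (hw' : w' ∈ baryFace k'.verts)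
    (hx : ∑ v, w v * P.x v = ∑ v, w' v * P.x v) (hy : ∑ v, w v * P.y v = ∑ v, w' v * P.y v)
    (hz : ∑ v, w v * z v = ∑ v, w' v * z v) : w = w' := by
  have hsub := verts_subset_topVerts h
  have hρ := P.strictMono (Fin.castSucc_lt_succ (i := s))
  have hR := P.R_pos
  refine eq_of_affine_separation hw hw' hx hy hz (-1) 0 0 (-1) ?_ ?_
    .hub (.rim s.castSucc) (.rim s.succ) (by simp) (by simp) (by simp [Fin.ext_iff]) ?_ (Or.inl ?_)
  · intro v hv
    simp only [BodyFacet.verts, Finset.mem_insert, Finset.mem_singleton] at hv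
    rcases hv with rfl | rfl | rfl <;> norm_num [z]
  · intro v hv
    have := hsub hv
    simp only [topVerts, Finset.mem_insert, Finset.mem_singleton] at this
    rcases this with rfl | rfl | rfl | rfl | rfl | rfl <;> norm_num [z]
  · rintro v (hv | hv) h0
    · simp only [BodyFacet.verts, Finset.mem_insert, Finset.mem_singleton] at hv
      rcases hv with rfl | rfl | rfl
      · norm_num [z] at h0
      · simp
      · simp
    · have := hsub hv
      simp only [topVerts, Finset.mem_insert, Finset.mem_singleton] at this
      rcases this with rfl | rfl | rfl | rfl | rfl | rfl
      · simp
      · simp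
      · simp
      all_goals norm_num [z] at h0
  · have : (P.ρ s.succ - P.ρ s.castSucc) * P.R ≠ 0 := mul_ne_zero (by linarith) hR.ne'
    convert this using 1
    simp only [x, y]
    ring

/-- The position of a body in space is an embedding. -/
theorem eq_of_sum_eq (hw : w ∈ baryFace k.verts) (hw' : w' ∈ baryFace k'.verts)
    (hx : ∑ v, w v * P.x v = ∑ v, w' v * P.x v) (hy : ∑ v, w v * P.y v = ∑ v, w' v * P.y v)
    (hz : ∑ v, w v * z v = ∑ v, w' v * z v) : w = w' := by
  rcases le_or_gt (hi k') (lo k) with hk | hk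
  · exact P.eq_of_hi_le_lo hw hw' hx hy hz hk
  rcases le_or_gt (hi k) (lo k') with hk' | hk'
  · exact (P.eq_of_hi_le_lo hw' hw hx.symm hy.symm hz.symm hk').symm
  rcases lo_eq_hi_or k with h | ⟨s, h₁, h₂, h⟩ <;>
    rcases lo_eq_hi_or k' with h' | ⟨s', h₁', h₂', h'⟩ <;> try omega
  obtain rfl : s = s' := Fin.ext (by omega)
  rcases h with rfl | h <;> rcases h' with rfl | h'
  · have hρ := P.strictMono (Fin.castSucc_lt_succ (i := s))
    refine eq_of_affine_separation hw hw' hx hy hz 0 0 0 0 (by simp) (by simp)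
      .bot (.rim s.castSucc) (.rim s.succ) (by simp) (by simp) (by simp [Fin.ext_iff]) ?_
      (Or.inr (Or.inl ?_))
    · intro v hv _
      simpa [BodyFacet.verts] using hv
    · simp only [x, z]
      intro h
      linarith
  · exact P.eq_of_base_top h' hw hw' hx hy hz
  · exact (P.eq_of_base_top h hw' hw hx.symm hy.symm hz.symm).symm
  · obtain ⟨A, B, C, D, a, b, c, hab, hac, hbc, hk, hg, hd⟩ := P.exists_affine_support h'
    refine eq_of_affine_separation hw hw' hx hy hz A B C D (fun v hv => ?_) (fun v hv => ?_)
      a b c hab hac hbc ?_ (Or.inr (Or.inl hd))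
    · rcases hg v (verts_subset_topVerts h hv) with h | h
      · exact h.2.ge
      · exact h.2.le
    · rcases hg v (verts_subset_topVerts h' hv) with h | h
      · exact h.2.le
      · exact absurd hv h.1
    · rintro v hv h0
      have hv' : v ∈ topVerts s :=
        hv.elim (fun h₃ => verts_subset_topVerts h h₃) fun h₃ => verts_subset_topVerts h' h₃
      rcases hg v hv' with h | h
      · simpa [hk] using h.1
      · exact absurd h0 h.2.ne'

end BodyShape

theorem sum_mul_ne_of_forall_lt {W : Type*} [Fintype W] {w w' : W → ℝ} (hw : ∀ u, 0 ≤ w u) (hw' : ∀ u, 0 ≤ w' u)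
    (h1 : ∑ u, w u = 1) (h1' : ∑ u, w' u = 1) {g : W → ℝ} {M : ℝ} (h : ∀ u, w u ≠ 0 → g u < M)
    (h' : ∀ u, w' u ≠ 0 → M ≤ g u) : ∑ u, w u * g u ≠ ∑ u, w' u * g u := by
  intro he
  have := (eq_zero_of_sum_mul_eq (g := fun u => M - g u) hw hw' ?_
    (fun u hu => by linarith [h u hu]) fun u hu => by linarith [h' u hu]).1
  · refine one_ne_zero (α := ℝ) ?_
    rw [← h1]
    refine Finset.sum_eq_zero fun u _ => by_contra fun hu => ?_
    have := this u hu
    have := h u hu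
    linarith
  · simp only [mul_sub, Finset.sum_sub_distrib, ← Finset.sum_mul, h1, h1', he]

section Pullback

variable {V W : Type*} [Fintype V] [Fintype W] [DecidableEq W] {m : V → W}
  {t : Finset V} {w : W → ℝ}

theorem sum_comp_mul_of_mem_baryFace (hm : Function.Injective m) (hw : w ∈ baryFace (t.image m))
    (g : W → ℝ) : ∑ v, w (m v) * g (m v) = ∑ u, w u * g u := by
  refine Fintype.sum_of_injective m hm _ _ (fun u hu => ?_) fun _ => rfl
  rw [hw.2.2 u fun h => hu ?_, zero_mul]
  obtain ⟨v, -, rfl⟩ := Finset.mem_image.1 h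
  exact ⟨v, rfl⟩

theorem comp_mem_baryFace (hm : Function.Injective m) (hw : w ∈ baryFace (t.image m)) :
    w ∘ m ∈ baryFace t := by
  refine ⟨fun v => hw.1 _, ?_, fun v hv => hw.2.2 _ fun h => hv ?_⟩
  · have := sum_comp_mul_of_mem_baryFace hm hw fun _ => 1
    simp only [mul_one] at this
    exact this.trans hw.2.1
  · obtain ⟨v', hv', e⟩ := Finset.mem_image.1 h
    rwa [← hm e]

theorem eq_of_comp_eq {w' : W → ℝ} {t' : Finset V} (hw : w ∈ baryFace (t.image m))
    (hw' : w' ∈ baryFace (t'.image m)) (h : w ∘ m = w' ∘ m) : w = w' := by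
  funext u
  by_cases hu : u ∈ range m
  · obtain ⟨v, rfl⟩ := hu
    exact congrFun h v
  · rw [hw.2.2 u fun hh => hu ?_, hw'.2.2 u fun hh => hu ?_]
    all_goals
      obtain ⟨v, -, rfl⟩ := Finset.mem_image.1 hh
      exact ⟨v, rfl⟩

end Pullback

section Position

variable {n : ℕ} {I : Type} (φ : I × Fin n → I × Fin n) (P : I → BodyShape n) (Y : I → ℝ) (K : ℝ)

/-- The first coordinate of a vertex of the surface. -/
def surfX : SurfVertex n I → ℝ
  | .hub c i => bif c then Y i + (P i).R else (P i).h
  | .bot c i => bif c then Y i + (P i).R else (P i).h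
  | .rim c i t => bif c then Y i else (P i).ρ t
  | .tub e l => Y (φ e).1 + BodyShape.corner K l

/-- The second coordinate of a vertex of the surface. -/
def surfY : SurfVertex n I → ℝ
  | .hub c i => bif c then (P i).h else Y i + (P i).R
  | .bot c i => bif c then (P i).h else Y i + (P i).R
  | .rim c i t => bif c then (P i).ρ t else Y i
  | .tub e l => Y e.1 + BodyShape.corner K (cornerSwap l)

/-- The third coordinate of a vertex of the surface. -/
def surfZ : SurfVertex n I → ℝ
  | .hub c _ => bif c then 1 else -1
  | .bot c _ => bif c then 2 else -2
  | .rim c _ _ => bif c then 1 else -1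
  | .tub _ _ => 0

variable {φ P Y K}

theorem surf_bodyMap_false (hK : ∀ i, (P i).K = K) (hO : ∀ i s, (P i).o s = Y (φ (i, s)).1)
    (i : I) (v : BodyVertex n) :
    surfX φ P Y K (bodyMap φ false i v) = (P i).x v ∧
      surfY P Y K (bodyMap φ false i v) = Y i + (P i).y v ∧
      surfZ (bodyMap φ false i v) = BodyShape.z v := by
  cases v <;> simp [bodyMap, surfX, surfY, surfZ, BodyShape.x, BodyShape.y, BodyShape.z, hK, hO]

theorem surf_bodyMap_true (hφ : Function.Involutive φ) (hK : ∀ i, (P i).K = K)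
    (hO : ∀ i s, (P i).o s = Y (φ (i, s)).1) (i : I) (v : BodyVertex n) :
    surfY P Y K (bodyMap φ true i v) = (P i).x v ∧
      surfX φ P Y K (bodyMap φ true i v) = Y i + (P i).y v ∧
      -surfZ (bodyMap φ true i v) = BodyShape.z v := by
  cases v <;> simp [bodyMap, surfX, surfY, surfZ, BodyShape.x, BodyShape.y, BodyShape.z, hK, hO,
    cornerSwap_cornerSwap, hφ _]

/-- There are coordinates for which a body is in its own position. -/
theorem exists_surf_bodyMap (hφ : Function.Involutive φ) (hK : ∀ i, (P i).K = K)
    (hO : ∀ i s, (P i).o s = Y (φ (i, s)).1) (c : Bool) {S : (SurfVertex n I → ℝ) → ℝ}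
    {S' : (SurfVertex n I → ℝ) → ℝ} (hS : ∀ f, S (-f) = -S f) (hS' : ∀ f, S' (-f) = -S' f)
    (hx : S (surfX φ P Y K) = S' (surfX φ P Y K)) (hy : S (surfY P Y K) = S' (surfY P Y K))
    (hz : S surfZ = S' surfZ) : ∃ fx fy fz : SurfVertex n I → ℝ, S fx = S' fx ∧ S fy = S' fy ∧
      S fz = S' fz ∧ ∀ i v, fx (bodyMap φ c i v) = (P i).x v ∧
        fy (bodyMap φ c i v) = Y i + (P i).y v ∧ fz (bodyMap φ c i v) = BodyShape.z v := by
  cases c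
  · exact ⟨_, _, _, hx, hy, hz, surf_bodyMap_false hK hO⟩
  · exact ⟨_, _, _, hy, hx, by rw [hS, hS', hz], surf_bodyMap_true hφ hK hO⟩

theorem BodyShape.y_nonneg (P : BodyShape n) (v : BodyVertex n) : 0 ≤ P.y v := by
  have := P.R_pos
  rcases v with _ | _ | _ | ⟨s, l⟩ <;> simp only [y] <;> try linarith
  linarith [P.one_le_corner (cornerSwap l)]

theorem BodyShape.y_le (P : BodyShape n) (v : BodyVertex n) : P.y v ≤ P.R := by
  have := P.R_pos
  rcases v with _ | _ | _ | ⟨s, l⟩ <;> simp only [y] <;> try linarith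
  linarith [P.corner_le (cornerSwap l), P.K_add_one_lt]

variable [Fintype I] {w w' : SurfVertex n I → ℝ} {i i' : I} {k k' : BodyFacet n}

theorem eq_of_same_color (hφ : Function.Involutive φ) (hK : ∀ i, (P i).K = K)
    (hO : ∀ i s, (P i).o s = Y (φ (i, s)).1)
    (hY : ∀ i j, i ≠ j → Y i + (P i).R < Y j ∨ Y j + (P j).R < Y i) {c : Bool}
    (hw : w ∈ baryFace (k.verts.image (bodyMap φ c i)))
    (hw' : w' ∈ baryFace (k'.verts.image (bodyMap φ c i')))
    (hx : ∑ v, w v * surfX φ P Y K v = ∑ v, w' v * surfX φ P Y K v)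
    (hy : ∑ v, w v * surfY P Y K v = ∑ v, w' v * surfY P Y K v)
    (hz : ∑ v, w v * surfZ v = ∑ v, w' v * surfZ v) : w = w' := by
  obtain ⟨fx, fy, fz, ex, ey, ez, hf⟩ := exists_surf_bodyMap (S := fun f => ∑ v, w v * f v)
    (S' := fun f => ∑ v, w' v * f v) hφ hK hO c (by simp) (by simp) hx hy hz
  have range : ∀ {u : SurfVertex n I → ℝ} {j : I} {l : BodyFacet n},
      u ∈ baryFace (l.verts.image (bodyMap φ c j)) → ∀ v, u v ≠ 0 →
      Y j ≤ fy v ∧ fy v ≤ Y j + (P j).R := by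
    intro u j l hu v hv
    have : v ∈ l.verts.image (bodyMap φ c j) := by_contra fun h => hv (hu.2.2 v h)
    obtain ⟨v, -, rfl⟩ := Finset.mem_image.1 this
    rw [(hf j v).2.1]
    constructor
    · linarith [(P j).y_nonneg v]
    · linarith [(P j).y_le v]
  by_cases hi : i = i'
  · subst hi
    have inj := bodyMap_injective hφ c i
    refine eq_of_comp_eq hw hw' ?_
    have ex' := ex
    have ey' := ey
    have ez' := ez
    simp only [← sum_comp_mul_of_mem_baryFace inj hw, ← sum_comp_mul_of_mem_baryFace inj hw', hf]
      at ex' ey' ez'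
    have b := comp_mem_baryFace inj hw
    have b' := comp_mem_baryFace inj hw'
    refine (P i).eq_of_sum_eq b b' ex' ?_ ez'
    have s := b.2.1
    have s' := b'.2.1
    simp only [Function.comp_apply] at s s'
    simp only [mul_add, Finset.sum_add_distrib, ← Finset.sum_mul, s, s'] at ey'
    simpa using ey'
  · exfalso
    rcases hY i i' hi with h | h
    · refine sum_mul_ne_of_forall_lt hw.1 hw'.1 hw.2.1 hw'.2.1 (M := Y i') ?_ ?_ ey
      · intro u hu
        linarith [(range hw u hu).2]
      · exact fun u hu => (range hw' u hu).1
    · refine sum_mul_ne_of_forall_lt hw'.1 hw.1 hw'.2.1 hw.2.1 (M := Y i) ?_ ?_ ey.symm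
      · intro u hu
        linarith [(range hw' u hu).2]
      · exact fun u hu => (range hw u hu).1

theorem exists_support_subset_tub {c : Bool} (hw : w ∈ baryFace (k.verts.image (bodyMap φ c i)))
    (hz : ∀ u, w u ≠ 0 → surfZ u = 0) : ∃ e, ∀ u, w u ≠ 0 → ∃ l, u = .tub e l := by
  have h : ∀ u, w u ≠ 0 → ∃ (s : Fin n) (l : Fin 3), (s : ℕ) = BodyShape.lo k ∧ u = bodyMap φ c i (.tub s l) := by
    intro u hu
    have : u ∈ k.verts.image (bodyMap φ c i) := by_contra fun h => hu (hw.2.2 u h)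
    obtain ⟨v, hv, rfl⟩ := Finset.mem_image.1 this
    have h0 := hz _ hu
    rcases v with _ | _ | _ | ⟨s, l⟩
    · cases c <;> simp [bodyMap, surfZ] at h0
    · cases c <;> simp [bodyMap, surfZ] at h0
    · cases c <;> simp [bodyMap, surfZ] at h0
    · exact ⟨s, l, (BodyShape.tub_mem hv).1.symm, rfl⟩
  obtain ⟨u₀, h₀⟩ : ∃ u, w u ≠ 0 := by
    by_contra! hc
    have := hw.2.1
    simp [hc] at this
  obtain ⟨s, -, hs, -⟩ := h u₀ h₀
  refine ⟨bif c then φ (i, s) else (i, s), fun u hu => ?_⟩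
  obtain ⟨s', l', hs', rfl⟩ := h u hu
  obtain rfl : s' = s := Fin.ext (by omega)
  cases c <;> exact ⟨_, rfl⟩

theorem eq_of_different_color (hK : ∀ i, (P i).K = K)
    (hY : ∀ i j, i ≠ j → Y i + (P i).R < Y j ∨ Y j + (P j).R < Y i)
    (hslot : ∀ i s t, (φ (i, s)).1 = (φ (i, t)).1 → s = t)
    (hw : w ∈ baryFace (k.verts.image (bodyMap φ false i)))
    (hw' : w' ∈ baryFace (k'.verts.image (bodyMap φ true i')))
    (hx : ∑ v, w v * surfX φ P Y K v = ∑ v, w' v * surfX φ P Y K v)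
    (hy : ∑ v, w v * surfY P Y K v = ∑ v, w' v * surfY P Y K v)
    (hz : ∑ v, w v * surfZ v = ∑ v, w' v * surfZ v) : w = w' := by
  have hK1 : 1 < K := by
    rw [← hK i]
    exact (P i).one_lt_K
  have hs : (∀ u, w' u ≠ 0 → surfZ u = 0) ∧ ∀ u, w u ≠ 0 → surfZ u = 0 := by
    refine eq_zero_of_sum_mul_eq hw'.1 hw.1 hz.symm (fun u hu => ?_) (fun u hu => ?_)
    · have : u ∈ k'.verts.image (bodyMap φ true i') := by_contra fun h => hu (hw'.2.2 u h)
      obtain ⟨v, hv, rfl⟩ := Finset.mem_image.1 this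
      cases v <;> simp [bodyMap, surfZ]
    · have : u ∈ k.verts.image (bodyMap φ false i) := by_contra fun h => hu (hw.2.2 u h)
      obtain ⟨v, hv, rfl⟩ := Finset.mem_image.1 this
      cases v <;> simp [bodyMap, surfZ]
  obtain ⟨e, he⟩ := exists_support_subset_tub hw hs.2
  obtain ⟨e', he'⟩ := exists_support_subset_tub hw' hs.1
  have corner_pos : ∀ l, 0 ≤ BodyShape.corner K l := fun l => by
    have := (P i).one_le_corner l
    rw [hK] at this
    linarith
  have corner_lt : ∀ j l, BodyShape.corner K l < (P j).R := fun j l => by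
    have := (P j).corner_le l
    have := (P j).K_add_one_lt
    rw [hK] at *
    linarith
  have sep : ∀ (g : SurfVertex n I → ℝ) (q : Fin 3 → Fin 3) (f : I × Fin n → I),
      (∀ e l, g (.tub e l) = Y (f e) + BodyShape.corner K (q l)) →
      ∑ v, w v * g v = ∑ v, w' v * g v → f e = f e' := by
    intro g q f hg hs
    by_contra hne
    rcases hY _ _ hne with h | h
    · refine sum_mul_ne_of_forall_lt hw.1 hw'.1 hw.2.1 hw'.2.1 (M := Y (f e')) ?_ ?_ hs
      · intro u hu
        obtain ⟨l, rfl⟩ := he u hu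
        rw [hg]
        linarith [corner_lt (f e) (q l)]
      · intro u hu
        obtain ⟨l, rfl⟩ := he' u hu
        rw [hg]
        linarith [corner_pos (q l)]
    · refine sum_mul_ne_of_forall_lt hw'.1 hw.1 hw'.2.1 hw.2.1 (M := Y (f e)) ?_ ?_ hs.symm
      · intro u hu
        obtain ⟨l, rfl⟩ := he' u hu
        rw [hg]
        linarith [corner_lt (f e') (q l)]
      · intro u hu
        obtain ⟨l, rfl⟩ := he u hu
        rw [hg]
        linarith [corner_pos (q l)]
  have e1 := sep _ cornerSwap Prod.fst (fun _ _ => rfl) hy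
  have e2 := sep _ id (fun e => (φ e).1) (fun _ _ => rfl) hx
  obtain rfl : e = e' := by
    obtain ⟨a, s⟩ := e
    obtain ⟨a', s'⟩ := e'
    obtain rfl : a = a' := e1
    rw [hslot _ _ _ e2]
  refine eq_of_sum_eq_of_support_subset (a := .tub e 0) (b := .tub e 1) (c := .tub e 2)
    (by simp) (by simp) (by simp) (hw.2.1.trans hw'.2.1.symm) hx hy (fun v h₀ h₁ h₂ => ?_) ?_
  · have hv : ∀ l, v ≠ .tub e l := fun l h => by
      subst h
      fin_cases l <;> simp at h₀ h₁ h₂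
    have a : w v = 0 := by_contra fun h => let ⟨l, hl⟩ := he v h; hv l hl
    have a' : w' v = 0 := by_contra fun h => let ⟨l, hl⟩ := he' v h; hv l hl
    rw [a, a']
  · simp only [surfX, surfY, BodyShape.corner, cornerSwap, Matrix.cons_val]
    intro h
    nlinarith

/-- The position of the surface in space is an embedding. -/
theorem eq_of_sum_surf_eq (hφ : Function.Involutive φ) (hK : ∀ i, (P i).K = K)
    (hO : ∀ i s, (P i).o s = Y (φ (i, s)).1)
    (hY : ∀ i j, i ≠ j → Y i + (P i).R < Y j ∨ Y j + (P j).R < Y i)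
    (hslot : ∀ i s t, (φ (i, s)).1 = (φ (i, t)).1 → s = t)
    (hw : w ∈ realization (surfFacets φ)) (hw' : w' ∈ realization (surfFacets φ))
    (hx : ∑ v, w v * surfX φ P Y K v = ∑ v, w' v * surfX φ P Y K v)
    (hy : ∑ v, w v * surfY P Y K v = ∑ v, w' v * surfY P Y K v)
    (hz : ∑ v, w v * surfZ v = ∑ v, w' v * surfZ v) : w = w' := by
  obtain ⟨_, ⟨c, i, k, rfl⟩, hw⟩ := hw
  obtain ⟨_, ⟨c', i', k', rfl⟩, hw'⟩ := hw'
  cases c <;> cases c'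
  · exact eq_of_same_color hφ hK hO hY hw hw' hx hy hz
  · exact eq_of_different_color hK hY hslot hw hw' hx hy hz
  · exact (eq_of_different_color hK hY hslot hw' hw hx.symm hy.symm hz.symm).symm
  · exact eq_of_same_color hφ hK hO hY hw hw' hx hy hz

/-- The surface embeds in space. -/
theorem exists_continuous_injOn_realization (hφ : Function.Involutive φ) (hK : ∀ i, (P i).K = K)
    (hO : ∀ i s, (P i).o s = Y (φ (i, s)).1)
    (hY : ∀ i j, i ≠ j → Y i + (P i).R < Y j ∨ Y j + (P j).R < Y i)
    (hslot : ∀ i s t, (φ (i, s)).1 = (φ (i, t)).1 → s = t) :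
    ∃ F : (SurfVertex n I → ℝ) → EuclideanSpace ℝ (Fin 3),
      Continuous F ∧ InjOn F (realization (surfFacets φ)) := by
  refine ⟨fun w => !₂[∑ v, w v * surfX φ P Y K v, ∑ v, w v * surfY P Y K v, ∑ v, w v * surfZ v],
    ?_, fun w hw w' hw' h => ?_⟩
  · refine (PiLp.continuous_toLp 2 _).comp (continuous_pi fun j => ?_)
    fin_cases j <;> simp <;> fun_prop
  · have h0 := congrArg (fun p => p 0) h
    have h1 := congrArg (fun p => p 1) h
    have h2 := congrArg (fun p => p 2) h
    exact eq_of_sum_surf_eq hφ hK hO hY hslot hw hw' h0 h1 h2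

end Position

section Gluing

variable {n p : ℕ}

/-- The gluing of slots in which the bodies of the two colours are incident like the points and the
lines of an affine plane. -/
def slotGlue (n p : ℕ) (e : (Fin n × ZMod p) × Fin n) : (Fin n × ZMod p) × Fin n :=
  ((e.2, (e.2 : ℕ) * (e.1.1 : ℕ) - e.1.2), e.1.1)

theorem slotGlue_involutive : Function.Involutive (slotGlue n p) := by
  rintro ⟨⟨a, b⟩, s⟩
  simp [slotGlue, mul_comm]

theorem bodyAdj_slotGlue (c : Bool) (i : Fin n × ZMod p) (s : Fin n) :
    BodyAdj (slotGlue n p) (c, i) (!c, (slotGlue n p (i, s)).1) := ⟨rfl, s, rfl⟩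

theorem natCast_injective_of_lt (hp : n < p) {s t : Fin n}
    (h : ((s : ℕ) : ZMod p) = ((t : ℕ) : ZMod p)) : s = t := by
  rw [ZMod.natCast_eq_natCast_iff', Nat.mod_eq_of_lt (by omega), Nat.mod_eq_of_lt (by omega)] at h
  exact Fin.ext h

theorem slotGlue_no_four_cycle [Fact p.Prime] (hp : n < p) (i i' : Fin n × ZMod p)
    (s t s' t' : Fin n) (h : (slotGlue n p (i, s)).1 = (slotGlue n p (i', t)).1)
    (h' : (slotGlue n p (i, s')).1 = (slotGlue n p (i', t')).1) :
    i = i' ∨ (slotGlue n p (i, s)).1 = (slotGlue n p (i, s')).1 := by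
  obtain ⟨a, b⟩ := i
  obtain ⟨a', b'⟩ := i'
  simp only [slotGlue, Prod.mk.injEq] at h h' ⊢
  obtain ⟨rfl, h⟩ := h
  obtain ⟨rfl, h'⟩ := h'
  have key : (((s : ℕ) : ZMod p) - (s' : ℕ)) * ((a : ℕ) - (a' : ℕ)) = 0 := by
    linear_combination h - h'
  rcases mul_eq_zero.1 key with h₀ | h₀
  · obtain rfl := natCast_injective_of_lt hp (sub_eq_zero.1 h₀)
    exact Or.inr ⟨rfl, rfl⟩
  · obtain rfl := natCast_injective_of_lt hp (sub_eq_zero.1 h₀)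
    exact Or.inl ⟨rfl, by linear_combination -h⟩

theorem exists_bodyAdj_slotGlue {k : ℕ} (hk : k + 1 ≤ n) (β : Bool × Fin n × ZMod p) :
    ∃ f : Fin (k + 1) → Bool × Fin n × ZMod p,
      Function.Injective f ∧ ∀ j, BodyAdj (slotGlue n p) β (f j) := by
  refine ⟨fun j => (!β.1, (slotGlue n p (β.2, Fin.castLE hk j)).1), fun j j' h => ?_,
    fun j => bodyAdj_slotGlue β.1 β.2 _⟩
  simpa [slotGlue] using congrArg (fun x => x.2.1) h

theorem reflTransGen_bodyAdj_slotGlue (hn : 2 ≤ n) (hp : 0 < p) (β γ : Bool × Fin n × ZMod p) :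
    Relation.ReflTransGen (BodyAdj (slotGlue n p)) β γ := by
  have : NeZero p := ⟨hp.ne'⟩
  have two : ∀ c (a a' s : Fin n) (b : ZMod p), Relation.ReflTransGen (BodyAdj (slotGlue n p))
      (c, (a, b)) (c, (a', b + (s : ℕ) * ((a' : ℕ) - (a : ℕ)))) := by
    intro c a a' s b
    have h₁ := bodyAdj_slotGlue c (a, b) s
    have h₂ := bodyAdj_slotGlue (!c) (slotGlue n p ((a, b), s)).1 a'
    have e : (!!c, (slotGlue n p ((slotGlue n p ((a, b), s)).1, a')).1) =
        (c, (a', b + ((s : ℕ) : ZMod p) * ((a' : ℕ) - (a : ℕ)))) := by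
      simp only [slotGlue, Bool.not_not, Prod.mk.injEq, true_and]
      ring
    rw [e] at h₂
    exact (Relation.ReflTransGen.single h₁).tail h₂
  have flat : ∀ c (a a' : Fin n) (b : ZMod p), Relation.ReflTransGen (BodyAdj (slotGlue n p))
      (c, (a, b)) (c, (a', b)) := by
    intro c a a' b
    simpa using two c a a' ⟨0, by omega⟩ b
  have shift : ∀ (m : ℕ) c (a : Fin n) (b : ZMod p),
      Relation.ReflTransGen (BodyAdj (slotGlue n p)) (c, (a, b)) (c, (a, b + m)) := by
    intro m c a b
    induction m with
    | zero => simpa using Relation.ReflTransGen.refl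
    | succ m ih =>
      have h := two c ⟨0, by omega⟩ ⟨1, by omega⟩ ⟨1, by omega⟩ (b + m)
      have h' := (ih.trans (flat c a ⟨0, by omega⟩ _)).trans (h.trans (flat c _ a _))
      simpa [add_assoc] using h'
  have same : ∀ c i j, Relation.ReflTransGen (BodyAdj (slotGlue n p)) (c, i) (c, j) := by
    rintro c ⟨a, b⟩ ⟨a', b'⟩
    have h := (flat c a a' b).trans (shift (b' - b).val c a' b)
    rwa [ZMod.natCast_zmod_val, add_sub_cancel] at h
  obtain ⟨c, i⟩ := β
  obtain ⟨c', j⟩ := γ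
  by_cases h : c' = c
  · rw [h]
    exact same c i j
  · have h₁ := bodyAdj_slotGlue c i ⟨0, by omega⟩
    rw [← Bool.eq_not_of_ne h] at h₁
    exact (Relation.ReflTransGen.single h₁).trans (same c' _ j)

/-- The position of a body along the coordinate axes. -/
noncomputable def rank (R : ℝ) (i : Fin n × ZMod p) : ℝ := 2 * R * ((i.1 : ℕ) * p + i.2.val)

theorem rank_separated [NeZero p] {R : ℝ} (hR : 0 < R) {i j : Fin n × ZMod p} (hij : i ≠ j) :
    rank R i + R < rank R j ∨ rank R j + R < rank R i := by
  obtain ⟨a, b⟩ := i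
  obtain ⟨a', b'⟩ := j
  have hb := b.val_lt
  have hb' := b'.val_lt
  have key : ∀ x y : ℕ, x < y → 2 * R * x + R < 2 * R * y := by
    intro x y h
    have : (x : ℝ) + 1 ≤ y := by exact_mod_cast h
    nlinarith
  have hne : (a : ℕ) * p + b.val ≠ a' * p + b'.val := by
    intro h
    have h₁ := congrArg (· / p) h
    have h₂ := congrArg (· % p) h
    have hp : 0 < p := by omega
    simp only [mul_comm _ p, Nat.mul_add_div hp, Nat.div_eq_of_lt hb, Nat.div_eq_of_lt hb',
      Nat.mul_add_mod, Nat.mod_eq_of_lt hb, Nat.mod_eq_of_lt hb', add_zero] at h₁ h₂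
    exact hij (Prod.ext (Fin.ext h₁) (ZMod.val_injective p h₂))
  rcases lt_or_gt_of_ne hne with h | h
  · left
    simpa [rank] using key _ _ h
  · right
    simpa [rank] using key _ _ h

/-- The shape of a body in the position of the glued surface. -/
noncomputable def slotShape (n p : ℕ) [NeZero p] (i : Fin n × ZMod p) : BodyShape n where
  ρ t := 2 * ((2 * p * n + 5) * (2 * p * n + 2)) * (p * (t : ℕ)) -
    (2 * p * n + 5) * (2 * p * n + 2)
  o s := rank ((2 * p * n + 5) * (2 * p * n + 2)) (slotGlue n p (i, s)).1
  h := 2 * ((2 * p * n + 5) * (2 * p * n + 2)) * (p * n)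
  R := (2 * p * n + 5) * (2 * p * n + 2)
  K := 2 * p * n + 2
  R_pos := by positivity
  one_lt_K := by
    have : (0 : ℝ) ≤ 2 * p * n := by positivity
    linarith
  K_add_one_lt := by
    have : (0 : ℝ) ≤ 2 * p * n := by positivity
    nlinarith
  strictMono s t hst := by
    have hp : 0 < (p : ℝ) := by exact_mod_cast Nat.pos_of_neZero p
    have hst : ((s : ℕ) : ℝ) < (t : ℕ) := by exact_mod_cast hst
    simp only
    gcongr
  lt_h t := by
    have hp : 0 < (p : ℝ) := by exact_mod_cast Nat.pos_of_neZero p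
    have ht : ((t : ℕ) : ℝ) ≤ n := by exact_mod_cast Nat.lt_succ_iff.1 t.2
    have : (0 : ℝ) < (2 * p * n + 5) * (2 * p * n + 2) := by positivity
    have : 2 * (((2 : ℝ) * p * n + 5) * (2 * p * n + 2)) * (p * (t : ℕ)) ≤
      2 * ((2 * p * n + 5) * (2 * p * n + 2)) * (p * n) := by gcongr
    linarith
  h_sub_lt t := by
    have h0 : (0 : ℝ) ≤ 2 * (((2 : ℝ) * p * n + 5) * (2 * p * n + 2)) * (p * (t : ℕ)) := by
      positivity
    have h1 : (0 : ℝ) < (2 * p * n + 5) * (2 * p * n + 2) := by positivity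
    nlinarith
  mul_h_sub_lt t := by
    have h0 : (0 : ℝ) ≤ (2 * p * n + 2 + 1) *
      (2 * (((2 : ℝ) * p * n + 5) * (2 * p * n + 2)) * (p * (t : ℕ))) := by positivity
    have h1 : (0 : ℝ) < (2 * p * n + 5) * (2 * p * n + 2) := by positivity
    have h2 : (0 : ℝ) ≤ 2 * p * n := by positivity
    have h3 : (0 : ℝ) < ((2 * p * n + 5) * (2 * p * n + 2)) *
      ((2 * p * n + 5) * (2 * p * n + 2) - (2 * p * n + 2 + 1) * (2 * p * n + 1)) :=
      mul_pos h1 (by nlinarith)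
    linarith
  castSucc_add_le s := by
    have h1 : (0 : ℝ) < (2 * p * n + 5) * (2 * p * n + 2) := by positivity
    have h2 : (0 : ℝ) ≤ 2 * ((2 * p * n + 5) * (2 * p * n + 2)) *
      ((slotGlue n p (i, s)).1.2.val : ℝ) := by positivity
    simp only [rank, slotGlue, Fin.val_castSucc] at h2 ⊢
    linarith
  add_le_succ s := by
    have h1 : (0 : ℝ) < (2 * p * n + 5) * (2 * p * n + 2) := by positivity
    have h2 : ((slotGlue n p (i, s)).1.2.val : ℝ) + 1 ≤ p := by
      exact_mod_cast ZMod.val_lt (slotGlue n p (i, s)).1.2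
    have h3 := mul_le_mul_of_nonneg_left h2 h1.le
    simp only [rank, slotGlue, Fin.val_succ, Nat.cast_add, Nat.cast_one] at h3 ⊢
    linarith

end Gluing

/-- Mohar's surfaces, realized with simplicial metrics as in the paper.
For every `k` there is a simplicially metrized game space `(X,d)` homeomorphic to a closed
orientable surface whose cop number exceeds `k`. -/
theorem exists_simplicial_surface_large_cop_number (k : ℕ) :
    ∃ (X : Type) (_ : MetricSpace X),
      GameSpaceD X (fun x y => dist x y) ∧
      SimpliciallyMetrized X ∧
      IsClosedOrientableSurface X ∧
      (k : ℕ∞) < copNumber X (fun x y => dist x y) := by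
  obtain ⟨p, hp, hprime⟩ := Nat.exists_infinite_primes (k + 3)
  have : Fact p.Prime := ⟨hprime⟩
  have hφ := slotGlue_involutive (n := k + 2) (p := p)
  obtain ⟨X, hX, e, hgame, hsimp, hpath, hdist, hlip⟩ :=
    exists_simplicially_metrized (surfFacets (slotGlue (k + 2) p)) (card_of_mem_surfFacets hφ)
      ⟨_, image_mem_surfFacets _ false (0, 0) .left⟩ fun _ _ _ _ u _ v _ =>
        reflTransGen_sharesFacet hφ (reflTransGen_bodyAdj_slotGlue (by omega) (by omega)) u v
  obtain ⟨F, hF, hinj⟩ := exists_continuous_injOn_realization (P := slotShape (k + 2) p) hφ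
    (fun _ => rfl) (fun _ _ => rfl)
    (fun _ _ h => rank_separated (slotShape (k + 2) p (0, 0)).R_pos h)
    fun _ _ _ h => congrArg Prod.fst h
  refine ⟨X, hX, hgame, hsimp, isClosedOrientableSurface_of_isLinkCycle hpath
    (fun _ _ u _ => exists_isLinkCycle_surfFacets hφ (by omega) u) F hF hinj e, ?_⟩
  exact lt_copNumber_of_surfFacets hφ (by omega) (exists_bodyAdj_slotGlue (by omega))
    (slotGlue_no_four_cycle (by omega)) e hdist hlip
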